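/- arXiv:2604.27535 — 6 statements merged into one kernel-verified Lean document; each statement's English description precedes it below -/
import Mathlib

section
/- Let n ≥ 3 and let 𝒢 = {G_1, …, G_n} be a family of n graphs (not necessarily distinct) on a common vertex set V with |V| = n. If σ(𝒢) ≥ 4n/3 − 1, then every vertex of V is contained in a rainbow cycle of length ℓ for every ℓ with 3 ≤ ℓ ≤ n. -/
/-- `c`, `φ` encode a rainbow cycle of length `ℓ` in the graph family `G`:
`c` lists the vertices of the cycle in cyclic order (injectively), and `φ`
injectively assigns to the edge `c i — c (i+1)` a member of the family
containing it. -/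
def IsRainbowCycle {V ι : Type*} {ℓ : ℕ} (G : ι → SimpleGraph V)
    (c : ZMod ℓ → V) (φ : ZMod ℓ → ι) : Prop :=
  Function.Injective c ∧ Function.Injective φ ∧
    ∀ i : ZMod ℓ, (G (φ i)).Adj (c i) (c (i + 1))

/-- The family `G` contains a rainbow cycle of length `ℓ`. -/
def HasRainbowCycle {V ι : Type*} (G : ι → SimpleGraph V) (ℓ : ℕ) : Prop :=
  ∃ (c : ZMod ℓ → V) (φ : ZMod ℓ → ι), IsRainbowCycle G c φ

/-- The family `G` contains a rainbow cycle of length `ℓ` passing through `x`. -/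
def HasRainbowCycleThrough {V ι : Type*} (G : ι → SimpleGraph V) (ℓ : ℕ) (x : V) : Prop :=
  ∃ (c : ZMod ℓ → V) (φ : ZMod ℓ → ι), IsRainbowCycle G c φ ∧ ∃ i, c i = x


namespace RB
open Finset
open scoped Classical

variable {V ι : Type*}

/-- A rainbow cycle indexed by natural numbers. -/
def NCyc (G : ι → SimpleGraph V) (ℓ : ℕ) (c : ℕ → V) (φ : ℕ → ι) : Prop :=
  (∀ i j, i < ℓ → j < ℓ → c i = c j → i = j) ∧ (∀ i j, i < ℓ → j < ℓ → φ i = φ j → i = j) ∧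
  (∀ i, i + 1 < ℓ → (G (φ i)).Adj (c i) (c (i+1))) ∧ (G (φ (ℓ-1))).Adj (c (ℓ-1)) (c 0)

/-- A rainbow path on `N` vertices indexed by natural numbers. -/
def NPath (G : ι → SimpleGraph V) (N : ℕ) (p : ℕ → V) (ψ : ℕ → ι) : Prop :=
  (∀ i j, i < N → j < N → p i = p j → i = j) ∧
  (∀ i j, i + 1 < N → j + 1 < N → ψ i = ψ j → i = j) ∧
  (∀ i, i + 1 < N → (G (ψ i)).Adj (p i) (p (i+1)))

lemma val_succ {ℓ : ℕ} (hl : 2 ≤ ℓ) (z : ZMod ℓ) :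
    (z + 1).val = if z.val + 1 < ℓ then z.val + 1 else 0 := by
  have : NeZero ℓ := ⟨by omega⟩
  have : Fact (1 < ℓ) := ⟨by omega⟩
  have h := ZMod.val_lt z
  rw [ZMod.val_add, ZMod.val_one]
  split_ifs with h1
  · exact Nat.mod_eq_of_lt h1
  · have : z.val + 1 = ℓ := by omega
    rw [this, Nat.mod_self]

lemma NCyc.through {G : ι → SimpleGraph V} {ℓ : ℕ} {c : ℕ → V} {φ : ℕ → ι} (hl : 2 ≤ ℓ)
    (h : NCyc G ℓ c φ) (j : ℕ) (hj : j < ℓ) : HasRainbowCycleThrough G ℓ (c j) := by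
  have : NeZero ℓ := ⟨by omega⟩
  obtain ⟨h1, h2, h3, h4⟩ := h
  refine ⟨fun z => c z.val, fun z => φ z.val, ⟨?_, ?_, ?_⟩, (j : ZMod ℓ), ?_⟩
  · intro a b hab
    exact ZMod.val_injective _ (h1 _ _ (ZMod.val_lt a) (ZMod.val_lt b) hab)
  · intro a b hab
    exact ZMod.val_injective _ (h2 _ _ (ZMod.val_lt a) (ZMod.val_lt b) hab)
  · intro z
    have hz := ZMod.val_lt z
    simp only [val_succ hl]
    split_ifs with h5
    · exact h3 _ h5
    · have : z.val = ℓ - 1 := by omega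
      rw [this]; exact h4
  · simp only [ZMod.val_natCast, Nat.mod_eq_of_lt hj]

lemma cast_inj {N : ℕ} {a : ZMod N} {i j : ℕ} (hi : i < N) (hj : j < N)
    (h : a + (i : ZMod N) = a + j) : i = j := by
  have := add_left_cancel h
  rw [ZMod.natCast_eq_natCast_iff', Nat.mod_eq_of_lt hi, Nat.mod_eq_of_lt hj] at this
  exact this

lemma arc {G : ι → SimpleGraph V} {N m : ℕ} {c : ZMod N → V} {φ : ZMod N → ι}
    (h : IsRainbowCycle G c φ) (hm : m ≤ N) (a : ZMod N) :
    NPath G m (fun j => c (a + j)) (fun j => φ (a + j)) := by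
  refine ⟨?_, ?_, ?_⟩
  · intro i j hi hj hij
    exact cast_inj (by omega) (by omega) (h.1 hij)
  · intro i j hi hj hij
    exact cast_inj (by omega) (by omega) (h.2.1 hij)
  · intro i hi
    have := h.2.2 (a + i)
    simp only [Nat.cast_add, Nat.cast_one, ← add_assoc]
    exact this

lemma NPath.close {G : ι → SimpleGraph V} {N : ℕ} {p : ℕ → V} {ψ : ℕ → ι} (hN : 1 ≤ N)
    (h : NPath G N p ψ) (y : V) (hy : ∀ j, j < N → p j ≠ y) (a b : ι) (hab : a ≠ b)
    (ha : ∀ j, j + 1 < N → ψ j ≠ a) (hb : ∀ j, j + 1 < N → ψ j ≠ b)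
    (h1 : (G a).Adj (p (N-1)) y) (h2 : (G b).Adj y (p 0)) :
    NCyc G (N+1) (fun j => if j < N then p j else y)
      (fun j => if j + 1 < N then ψ j else if j + 1 = N then a else b) := by
  obtain ⟨g1, g2, g3⟩ := h
  refine ⟨?_, ?_, ?_, ?_⟩
  · intro i j hi hj hij
    simp only at hij
    split_ifs at hij with q1 q2 q2
    · exact g1 _ _ q1 q2 hij
    · exact absurd hij (hy _ q1)
    · exact absurd hij.symm (hy _ q2)
    · omega
  · intro i j hi hj hij
    simp only at hij
    split_ifs at hij with q1 q2 q3 q4 q5 q6 q7 q8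
    all_goals first
      | omega
      | exact g2 _ _ (by assumption) (by assumption) hij
      | exact absurd hij (ha _ (by assumption))
      | exact absurd hij (hb _ (by assumption))
      | exact absurd hij.symm (ha _ (by assumption))
      | exact absurd hij.symm (hb _ (by assumption))
      | exact absurd hij hab
      | exact absurd hij.symm hab
  · intro i hi
    simp only
    by_cases q : i + 1 < N
    · rw [if_pos q, if_pos (by omega), if_pos q]
      exact g3 i q
    · have : i = N - 1 := by omega
      subst this
      rw [if_neg q, if_pos (by omega), if_pos (by omega), if_neg q]
      exact h1
  · simp only [Nat.add_sub_cancel]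
    rw [if_neg (by omega), if_neg (by omega), if_neg (by omega), if_pos (by omega)]
    exact h2

lemma NPath.rotate {G : ι → SimpleGraph V} {N : ℕ} {p : ℕ → V} {ψ : ℕ → ι}
    (h : NPath G N p ψ) (t : ℕ) (ht : t + 1 < N)
    (h1 : (G (ψ t)).Adj (p t) (p (N-1))) :
    NPath G N (fun j => if j ≤ t then p j else p (N + t - j))
      (fun j => if j ≤ t then ψ j else ψ (N + t - 1 - j)) := by
  obtain ⟨g1, g2, g3⟩ := h
  refine ⟨?_, ?_, ?_⟩
  · intro i j hi hj hij
    simp only at hij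
    split_ifs at hij with q1 q2 q2
    all_goals
      have := g1 _ _ (by omega) (by omega) hij
      omega
  · intro i j hi hj hij
    simp only at hij
    split_ifs at hij with q1 q2 q2
    all_goals
      have := g2 _ _ (by omega) (by omega) hij
      omega
  · intro i hi
    simp only
    rcases lt_trichotomy i t with q | q | q
    · rw [if_pos q.le, if_pos q.le, if_pos (by omega)]
      exact g3 i hi
    · subst q
      rw [if_pos le_rfl, if_pos le_rfl, if_neg (by omega)]
      have : N + i - (i+1) = N - 1 := by omega
      rw [this]; exact h1
    · rw [if_neg (by omega), if_neg (by omega), if_neg (by omega)]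
      have := g3 (N + t - 1 - i) (by omega)
      have e1 : N + t - (i + 1) = N + t - 1 - i := by omega
      have e2 : N + t - i = N + t - 1 - i + 1 := by omega
      rw [e1, e2]; exact this.symm

lemma ore [Fintype ι] {N : ℕ} (S : Finset V) (hS : #S = N) (hN : 2 ≤ N)
    (hι : N + 1 ≤ Fintype.card ι) (G : ι → SimpleGraph V)
    (h : ∀ u ∈ S, ∀ v ∈ S, u ≠ v → ∀ i, ¬ (G i).Adj u v → ∀ p q,
      N ≤ #{w ∈ S | (G p).Adj u w} + #{w ∈ S | (G q).Adj v w}) :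
    ∃ (c : ZMod N → V) (φ : ZMod N → ι), IsRainbowCycle G c φ ∧ ∀ i, c i ∈ S := by
  have : NeZero N := ⟨by omega⟩
  have key : ∀ b, b ≤ N → ∃ (c : ZMod N → V) (φ : ZMod N → ι), Function.Injective c ∧
      Function.Injective φ ∧ (∀ i, c i ∈ S) ∧
      b ≤ #{z : ZMod N | (G (φ z)).Adj (c z) (c (z + 1))} := by
    intro b
    induction b with
    | zero =>
      intro _
      have h1 : Fintype.card (ZMod N) ≤ Fintype.card S := by
        rw [ZMod.card, Fintype.card_coe, hS]
      have h2 : Fintype.card (ZMod N) ≤ Fintype.card ι := by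
        rw [ZMod.card]; omega
      obtain ⟨f⟩ := Function.Embedding.nonempty_of_card_le h1
      obtain ⟨g⟩ := Function.Embedding.nonempty_of_card_le h2
      exact ⟨fun z => (f z : V), g, fun a b hab => f.injective (Subtype.ext hab), g.injective,
        fun i => (f i).2, Nat.zero_le _⟩
    | succ b ih =>
      intro hb
      obtain ⟨c, φ, hc, hφ, hcS, hg⟩ := ih (by omega)
      by_cases hg2 : b + 1 ≤ #{z : ZMod N | (G (φ z)).Adj (c z) (c (z + 1))}
      · exact ⟨c, φ, hc, hφ, hcS, hg2⟩
      have hbad : ∃ z0, ¬ (G (φ z0)).Adj (c z0) (c (z0 + 1)) := by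
        by_contra hcon
        push Not at hcon
        apply hg2
        rw [Finset.filter_true_of_mem (fun z _ => hcon z), Finset.card_univ, ZMod.card]
        exact hb
      obtain ⟨z0, hz0⟩ := hbad
      set w : ℕ → V := fun j => c (z0 + 1 + j) with hw
      set ψ : ℕ → ι := fun j => φ (z0 + 1 + j) with hψ
      have winj : ∀ i j, i < N → j < N → w i = w j → i = j := fun i j hi hj hij =>
        cast_inj hi hj (hc hij)
      have ψinj : ∀ i j, i < N → j < N → ψ i = ψ j → i = j := fun i j hi hj hij =>
        cast_inj hi hj (hφ hij)
      have wS : ∀ j, w j ∈ S := fun j => hcS _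
      have e0 : z0 + 1 + ((N - 1 : ℕ) : ZMod N) = z0 := by
        rw [add_assoc]
        have : (1 : ZMod N) + ((N - 1 : ℕ) : ZMod N) = 0 := by
          have h1 : ((1 + (N - 1) : ℕ) : ZMod N) = 0 := by
            rw [Nat.add_sub_cancel' (by omega)]; exact ZMod.natCast_self N
          push_cast at h1
          exact h1
        rw [this, add_zero]
      have bad : ¬ (G (ψ (N-1))).Adj (w (N-1)) (w 0) := by
        simp only [hw, hψ, e0, Nat.cast_zero, add_zero]
        exact hz0
      -- surjectivity onto S
      have wsurj : ∀ v ∈ S, ∃ j, j < N ∧ w j = v := by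
        have himg : (Finset.range N).image w = S := by
          apply Finset.eq_of_subset_of_card_le
          · intro v hv
            obtain ⟨j, _, rfl⟩ := Finset.mem_image.1 hv
            exact wS j
          · rw [Finset.card_image_of_injOn, Finset.card_range, hS]
            intro i hi j hj hij
            exact winj i j (by simpa using hi) (by simpa using hj) hij
        intro v hv
        rw [← himg] at hv
        obtain ⟨j, hj, rfl⟩ := Finset.mem_image.1 hv
        exact ⟨j, by simpa using hj, rfl⟩
      obtain ⟨β, hβ⟩ : ∃ β, ∀ z, φ z ≠ β := by
        by_contra hcon
        push Not at hcon
        have := Fintype.card_le_of_surjective φ hcon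
        rw [ZMod.card] at this
        omega
      have hdeg := h _ (wS (N-1)) _ (wS 0)
        (fun e => by have := winj _ _ (by omega) (by omega) e; omega) _ bad β (ψ (N-1))
      set T1 := (Finset.range (N-1)).filter (fun t => (G (ψ (N-1))).Adj (w 0) (w (t+1))) with hT1
      set T2 := (Finset.range (N-1)).filter (fun t => (G β).Adj (w t) (w (N-1))) with hT2
      have c1 : #{v ∈ S | (G (ψ (N-1))).Adj (w 0) v} ≤ #T1 := by
        refine le_trans (Finset.card_le_card (t := T1.image (fun t => w (t+1))) ?_)
          Finset.card_image_le
        intro v hv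
        rw [Finset.mem_filter] at hv
        obtain ⟨j, hj, rfl⟩ := wsurj v hv.1
        have hj0 : j ≠ 0 := by rintro rfl; exact (G _).loopless.irrefl _ hv.2
        refine Finset.mem_image.2 ⟨j - 1, ?_, by rw [Nat.sub_add_cancel (by omega)]⟩
        rw [hT1, Finset.mem_filter, Finset.mem_range, Nat.sub_add_cancel (by omega)]
        exact ⟨by omega, hv.2⟩
      have c2 : #{v ∈ S | (G β).Adj (w (N-1)) v} ≤ #T2 := by
        refine le_trans (Finset.card_le_card (t := T2.image w) ?_)
          Finset.card_image_le
        intro v hv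
        rw [Finset.mem_filter] at hv
        obtain ⟨j, hj, rfl⟩ := wsurj v hv.1
        have hj0 : j ≠ N - 1 := by rintro rfl; exact (G _).loopless.irrefl _ hv.2
        refine Finset.mem_image.2 ⟨j, ?_, rfl⟩
        rw [hT2, Finset.mem_filter, Finset.mem_range]
        exact ⟨by omega, hv.2.symm⟩
      obtain ⟨t, ht⟩ : (T1 ∩ T2).Nonempty := by
        rw [← Finset.card_pos]
        have h1 := Finset.card_union_add_card_inter T1 T2
        have h2 : #(T1 ∪ T2) ≤ N - 1 := by
          rw [← Finset.card_range (N-1)]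
          exact Finset.card_le_card (Finset.union_subset (Finset.filter_subset _ _)
            (Finset.filter_subset _ _))
        omega
      simp only [hT1, hT2, Finset.mem_inter, Finset.mem_filter, Finset.mem_range] at ht
      obtain ⟨⟨htN, ht1⟩, -, ht2⟩ := ht
      set ρ : ℕ → ℕ := fun j => if j ≤ t then j else N + t - j with hρ
      set ψ' : ℕ → ι := fun j => if j < t then ψ j else if j = t then β else
        if j + 1 = N then ψ (N-1) else ψ (N + t - 1 - j) with hψ'
      refine ⟨fun z => w (ρ z.val), fun z => ψ' z.val, ?_, ?_, fun i => wS _, ?_⟩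
      · intro a b hab
        have ha := ZMod.val_lt a
        have hb := ZMod.val_lt b
        apply ZMod.val_injective
        simp only [hρ] at hab
        split_ifs at hab
        all_goals
          have := winj _ _ (by omega) (by omega) hab
          omega
      · intro a b hab
        have ha := ZMod.val_lt a
        have hb := ZMod.val_lt b
        apply ZMod.val_injective
        simp only [hψ'] at hab
        split_ifs at hab
        all_goals first
          | omega
          | exact absurd hab (hβ _)
          | exact absurd hab.symm (hβ _)
          | (have := ψinj _ _ (by omega) (by omega) hab
             omega)
      · set J := (Finset.range (N-1)).filter (fun j => (G (ψ j)).Adj (w j) (w (j+1))) with hJ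
        have hJc : b ≤ #J := by
          refine le_trans hg (le_trans (Finset.card_le_card
            (t := J.image (fun j : ℕ => z0 + 1 + (j : ZMod N))) ?_) Finset.card_image_le)
          intro z hz
          rw [Finset.mem_filter] at hz
          have ez : z0 + 1 + (((z - (z0 + 1)).val : ℕ) : ZMod N) = z := by
            rw [ZMod.natCast_zmod_val]; ring
          have hlt := ZMod.val_lt (z - (z0 + 1))
          refine Finset.mem_image.2 ⟨(z - (z0+1)).val, ?_, ez⟩
          rw [hJ, Finset.mem_filter, Finset.mem_range]
          constructor
          · by_contra hcon
            have : (z - (z0+1)).val = N - 1 := by omega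
            rw [this, e0] at ez
            subst ez
            exact hz0 hz.2
          · simp only [hw, hψ, Nat.cast_add, Nat.cast_one, ← add_assoc] at ez ⊢
            rw [ez]; exact hz.2
        set f : ℕ → ℕ := fun j => if j < t then j else if j = t then N - 1 else N + t - 1 - j with hf
        have hfin : Set.InjOn f (J : Set ℕ) := by
          intro i hi j hj hij
          have hi' : i < N - 1 := by
            have := (Finset.mem_filter.1 (Finset.mem_coe.1 hi)).1; simpa using this
          have hj' : j < N - 1 := by
            have := (Finset.mem_filter.1 (Finset.mem_coe.1 hj)).1; simpa using this
          simp only [hf] at hij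
          split_ifs at hij <;> omega
        have htn : t ∉ J.image f := by
          intro hcon
          obtain ⟨i, hi, hij⟩ := Finset.mem_image.1 hcon
          have hi' : i < N - 1 := by
            have := (Finset.mem_filter.1 hi).1; simpa using this
          simp only [hf] at hij
          split_ifs at hij <;> omega
        have hcard : #(insert t (J.image f)) = #J + 1 := by
          rw [Finset.card_insert_of_notMem htn, Finset.card_image_of_injOn hfin]
        have hlt : ∀ j ∈ insert t (J.image f), j < N := by
          intro j hj
          rcases Finset.mem_insert.1 hj with rfl | hj
          · omega
          · obtain ⟨i, hi, rfl⟩ := Finset.mem_image.1 hj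
            have hi' : i < N - 1 := by
              have := (Finset.mem_filter.1 hi).1; simpa using this
            simp only [hf]
            split_ifs <;> omega
        have hcard2 : #((insert t (J.image f)).image (fun j : ℕ => (j : ZMod N)))
            = #(insert t (J.image f)) := by
          apply Finset.card_image_of_injOn
          intro i hi j hj hij
          exact cast_inj (a := (0 : ZMod N)) (hlt i hi) (hlt j hj) (by simpa using hij)
        have hle : b + 1 ≤ #((insert t (J.image f)).image (fun j : ℕ => (j : ZMod N))) := by
          omega
        refine le_trans hle (Finset.card_le_card ?_)
        intro z hz
        obtain ⟨j, hj, rfl⟩ := Finset.mem_image.1 hz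
        have hjN := hlt j hj
        rw [Finset.mem_filter]
        refine ⟨Finset.mem_univ _, ?_⟩
        beta_reduce
        rw [val_succ hN, ZMod.val_natCast, Nat.mod_eq_of_lt hjN]
        rcases Finset.mem_insert.1 hj with rfl | hj
        · have a1 : ρ j = j := by simp [hρ]
          have a2 : ρ (j + 1) = N - 1 := by
            simp only [hρ]; rw [if_neg (by omega)]; omega
          have a3 : ψ' j = β := by simp [hψ']
          rw [if_pos (by omega), a1, a2, a3]
          exact ht2
        · obtain ⟨i, hi, rfl⟩ := Finset.mem_image.1 hj
          obtain ⟨hi1, hi2⟩ := Finset.mem_filter.1 hi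
          rw [Finset.mem_range] at hi1
          rcases lt_trichotomy i t with q | q | q
          · have a0 : f i = i := by simp only [hf]; rw [if_pos q]
            have a1 : ρ i = i := by simp only [hρ]; rw [if_pos q.le]
            have a2 : ρ (i + 1) = i + 1 := by simp only [hρ]; rw [if_pos (by omega)]
            have a3 : ψ' i = ψ i := by simp only [hψ']; rw [if_pos q]
            rw [a0, if_pos (by omega), a1, a2, a3]
            exact hi2
          · have a0 : f i = N - 1 := by simp only [hf]; rw [if_neg (by omega), if_pos q]
            have a1 : ρ (N-1) = t + 1 := by simp only [hρ]; rw [if_neg (by omega)]; omega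
            have a2 : ρ 0 = 0 := by simp [hρ]
            have a3 : ψ' (N-1) = ψ (N-1) := by
              simp only [hψ']; rw [if_neg (by omega), if_neg (by omega), if_pos (by omega)]
            rw [a0, if_neg (by omega), a1, a2, a3]
            exact ht1.symm
          · have a0 : f i = N + t - 1 - i := by
              simp only [hf]; rw [if_neg (by omega), if_neg (by omega)]
            have a1 : ρ (N + t - 1 - i) = i + 1 := by
              simp only [hρ]; rw [if_neg (by omega)]; omega
            have a2 : ρ (N + t - 1 - i + 1) = i := by
              simp only [hρ]; rw [if_neg (by omega)]; omega
            have a3 : ψ' (N + t - 1 - i) = ψ i := by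
              simp only [hψ']; rw [if_neg (by omega), if_neg (by omega), if_neg (by omega)]
              congr 1; omega
            rw [a0, if_pos (by omega), a1, a2, a3]
            exact hi2.symm
  obtain ⟨c, φ, hc, hφ, hcS, hg⟩ := key N le_rfl
  refine ⟨c, φ, ⟨hc, hφ, ?_⟩, hcS⟩
  have : ({z : ZMod N | (G (φ z)).Adj (c z) (c (z + 1))} : Finset (ZMod N)) = Finset.univ := by
    apply Finset.eq_univ_of_card
    rw [ZMod.card]
    refine le_antisymm ?_ hg
    refine le_trans (Finset.card_le_univ _) ?_
    rw [ZMod.card]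
  intro i
  have hi := Finset.mem_univ i
  rw [← this, Finset.mem_filter] at hi
  exact hi.2

/-- Degree of `u` in the graph with index `p`. -/
noncomputable def dg [Fintype V] (G : ι → SimpleGraph V) (p : ι) (u : V) : ℕ :=
  #{w : V | (G p).Adj u w}

/-- The standing hypotheses with integral degree condition. -/
def Hyp [Fintype V] [Fintype ι] (G : ι → SimpleGraph V) (n : ℕ) : Prop :=
  Fintype.card V = n ∧ Fintype.card ι = n ∧
  ∀ u v, u ≠ v → (∃ i, ¬ (G i).Adj u v) → ∀ p q, 4 * n ≤ 3 * (dg G p u + dg G q v) + 3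

lemma NPath.single (G : ι → SimpleGraph V) (v : V) (ψ : ℕ → ι) :
    NPath G 1 (fun _ => v) ψ :=
  ⟨fun i j hi hj _ => by omega, fun i j hi hj _ => by omega, fun i hi => by omega⟩

lemma NPath.snoc {G : ι → SimpleGraph V} {N : ℕ} {p : ℕ → V} {ψ : ℕ → ι} (hN : 1 ≤ N)
    (h : NPath G N p ψ) (y : V) (hy : ∀ j, j < N → p j ≠ y) (a : ι)
    (ha : ∀ j, j + 1 < N → ψ j ≠ a) (h1 : (G a).Adj (p (N-1)) y) :
    NPath G (N+1) (fun j => if j < N then p j else y)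
      (fun j => if j + 1 < N then ψ j else a) := by
  obtain ⟨g1, g2, g3⟩ := h
  refine ⟨?_, ?_, ?_⟩
  · intro i j hi hj hij
    simp only at hij
    split_ifs at hij with q1 q2 q2
    · exact g1 _ _ q1 q2 hij
    · exact absurd hij (hy _ q1)
    · exact absurd hij.symm (hy _ q2)
    · omega
  · intro i j hi hj hij
    simp only at hij
    split_ifs at hij with q1 q2 q2
    · exact g2 _ _ q1 q2 hij
    · exact absurd hij (ha _ q1)
    · exact absurd hij.symm (ha _ q2)
    · omega
  · intro i hi
    simp only
    by_cases q : i + 1 < N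
    · rw [if_pos q, if_pos (by omega), if_pos q]
      exact g3 i q
    · have : i = N - 1 := by omega
      subst this
      rw [if_neg q, if_pos (by omega), if_neg q]
      exact h1

lemma NPath.close_thr {G : ι → SimpleGraph V} {N : ℕ} {p : ℕ → V} {ψ : ℕ → ι} (hN : 1 ≤ N)
    (h : NPath G N p ψ) (y : V) (hy : ∀ j, j < N → p j ≠ y) (a b : ι) (hab : a ≠ b)
    (ha : ∀ j, j + 1 < N → ψ j ≠ a) (hb : ∀ j, j + 1 < N → ψ j ≠ b)
    (h1 : (G a).Adj (p (N-1)) y) (h2 : (G b).Adj y (p 0)) :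
    HasRainbowCycleThrough G (N+1) y ∧ ∀ j, j < N → HasRainbowCycleThrough G (N+1) (p j) := by
  have hc := h.close hN y hy a b hab ha hb h1 h2
  constructor
  · have := hc.through (by omega) N (by omega)
    simpa using this
  · intro j hj
    have := hc.through (by omega) j (by omega)
    simpa [hj] using this

section
set_option linter.unusedSectionVars false
variable [Fintype V] [Fintype ι] {G : ι → SimpleGraph V} {n : ℕ}

lemma dg_lt (G : ι → SimpleGraph V) (p : ι) (u : V) : dg G p u + 1 ≤ Fintype.card V := by
  have h : u ∉ ({w : V | (G p).Adj u w} : Finset V) := by simp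
  have := Finset.card_le_univ (insert u ({w : V | (G p).Adj u w} : Finset V))
  rw [Finset.card_insert_of_notMem h] at this
  exact this

lemma dg_lt2 (G : ι → SimpleGraph V) (p : ι) (u v : V) (huv : u ≠ v) (h0 : ¬ (G p).Adj u v) :
    dg G p u + 2 ≤ Fintype.card V := by
  have h : v ∉ ({w : V | (G p).Adj u w} : Finset V) := by simpa using h0
  have h2 : u ∉ insert v ({w : V | (G p).Adj u w} : Finset V) := by simp [huv]
  have := Finset.card_le_univ (insert u (insert v ({w : V | (G p).Adj u w} : Finset V)))
  rw [Finset.card_insert_of_notMem h2, Finset.card_insert_of_notMem h] at this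
  exact this

lemma dg_full (G : ι → SimpleGraph V) (p : ι) (u : V) (h : ∀ w, u ≠ w → (G p).Adj u w) :
    dg G p u + 1 = Fintype.card V := by
  have h0 : u ∉ ({w : V | (G p).Adj u w} : Finset V) := by simp
  have : insert u ({w : V | (G p).Adj u w} : Finset V) = univ := by
    ext w
    by_cases hw : u = w
    · simp [hw]
    · simp [h w hw]
  have h2 := Finset.card_insert_of_notMem h0
  rw [this, Finset.card_univ] at h2
  exact h2.symm

lemma min_deg (h : Hyp G n) (hn : 3 ≤ n) (p : ι) (x : V) : n + 3 ≤ 3 * dg G p x := by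
  obtain ⟨hV, hI, hs⟩ := h
  by_cases hx : ∃ w, x ≠ w ∧ ∃ i, ¬ (G i).Adj x w
  · obtain ⟨w, hw, i, hi⟩ := hx
    have h1 := hs x w hw ⟨i, hi⟩ p i
    have h2 := dg_lt2 G i w x hw.symm (fun h => hi h.symm)
    omega
  · push Not at hx
    have := dg_full G p x (fun w hw => hx w hw p)
    omega

lemma colours (hI : Fintype.card ι = n) (hn : 1 ≤ n) :
    ∃ col : ℕ → ι, ∀ i j, i < n → j < n → col i = col j → i = j := by
  let e := Fintype.equivFinOfCardEq hI
  refine ⟨fun j => if h : j < n then e.symm ⟨j, h⟩ else e.symm ⟨0, by omega⟩, ?_⟩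
  intro i j hi hj hij
  simpa [hi, hj] using hij

lemma inter_card {α : Type*} [Fintype α] [DecidableEq α] {n : ℕ} (A B : Finset α)
    (hV : Fintype.card α = n) : #A + #B ≤ n + #(A ∩ B) := by
  have h1 := Finset.card_union_add_card_inter A B
  have h2 := Finset.card_le_univ (A ∪ B)
  omega

lemma inter_card1 (A B : Finset V) (x : V) (hA : x ∉ A) (hB : x ∉ B)
    (hV : Fintype.card V = n) : #A + #B + 1 ≤ n + #(A ∩ B) := by
  have h1 := Finset.card_union_add_card_inter A B
  have h3 : x ∉ A ∪ B := by simp [hA, hB]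
  have h2 := Finset.card_le_univ (insert x (A ∪ B))
  rw [Finset.card_insert_of_notMem h3] at h2
  omega

lemma len3 (h : Hyp G n) (hn : 3 ≤ n) (x : V) : HasRainbowCycleThrough G 3 x := by
  have hmd := min_deg h hn
  obtain ⟨hV, hI, hs⟩ := h
  obtain ⟨col, hcol⟩ := colours hI (by omega)
  have h01 : col 0 ≠ col 1 := fun e => by have := hcol 0 1 (by omega) (by omega) e; omega
  have h02 : col 0 ≠ col 2 := fun e => by have := hcol 0 2 (by omega) (by omega) e; omega
  have h12 : col 1 ≠ col 2 := fun e => by have := hcol 1 2 (by omega) (by omega) e; omega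
  by_contra hcon
  have tri : ∀ y z, (G (col 0)).Adj x y → (G (col 1)).Adj x z → ¬ (G (col 2)).Adj y z := by
    intro y z hy hz hyz
    have p2 := (NPath.single G y (fun _ => col 2)).snoc le_rfl z (fun _ _ => hyz.ne) (col 2)
      (fun j hj => by omega) hyz
    refine hcon (p2.close_thr (by omega) x ?_ (col 1) (col 0) h01.symm ?_ ?_ ?_ ?_).1
    · intro j hj
      split_ifs
      · exact hy.ne.symm
      · exact hz.ne.symm
    · intro j hj; simpa using h12.symm
    · intro j hj; simpa using h02.symm
    · simpa using hz.symm
    · simpa using hy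
  have d0 := hmd (col 0) x
  have d1 := hmd (col 1) x
  obtain ⟨y, hy⟩ : ({w : V | (G (col 0)).Adj x w} : Finset V).Nonempty := by
    rw [← Finset.card_pos]; unfold dg at d0; omega
  obtain ⟨z, hz, hzy⟩ := Finset.exists_mem_ne
    (s := ({w : V | (G (col 1)).Adj x w} : Finset V)) (by unfold dg at d1; omega) y
  have hy' : (G (col 0)).Adj x y := by simpa using hy
  have hz' : (G (col 1)).Adj x z := by simpa using hz
  have h4 := hs y z hzy.symm ⟨col 2, tri y z hy' hz'⟩ (col 2) (col 2)
  have a1 := inter_card ({w : V | (G (col 2)).Adj y w} : Finset V)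
    ({w : V | (G (col 1)).Adj x w} : Finset V) hV
  have a2 := inter_card ({w : V | (G (col 2)).Adj z w} : Finset V)
    ({w : V | (G (col 0)).Adj x w} : Finset V) hV
  have b1 : ({w : V | (G (col 2)).Adj y w} : Finset V) ∩
    ({w : V | (G (col 1)).Adj x w} : Finset V) = ∅ := by
    ext w
    simp only [Finset.mem_inter, Finset.mem_filter, Finset.mem_univ, true_and,
      Finset.notMem_empty, iff_false, not_and]
    exact fun q1 q2 => tri y w hy' q2 q1
  have b2 : ({w : V | (G (col 2)).Adj z w} : Finset V) ∩
    ({w : V | (G (col 0)).Adj x w} : Finset V) = ∅ := by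
    ext w
    simp only [Finset.mem_inter, Finset.mem_filter, Finset.mem_univ, true_and,
      Finset.notMem_empty, iff_false, not_and]
    exact fun q1 q2 => tri w z q2 hz' q1.symm
  rw [b1, Finset.card_empty] at a1
  rw [b2, Finset.card_empty] at a2
  unfold dg at h4 d0 d1
  omega

lemma len4 (h : Hyp G n) (hn : 4 ≤ n) (x : V) : HasRainbowCycleThrough G 4 x := by
  have hmd := min_deg h (by omega)
  obtain ⟨hV, hI, hs⟩ := h
  have key : ∃ a, ∃ i, x ≠ a ∧
      (∀ p, 2 ≤ #(({w : V | (G p).Adj x w} : Finset V) ∩ ({w : V | (G i).Adj a w} : Finset V))) ∧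
      (∀ p q, 1 ≤ #(({w : V | (G p).Adj x w} : Finset V) ∩ ({w : V | (G q).Adj a w} : Finset V))) := by
    by_cases hx : ∃ w, x ≠ w ∧ ∃ i, ¬ (G i).Adj x w
    · obtain ⟨a, ha, i, hi⟩ := hx
      refine ⟨a, i, ha, ?_, ?_⟩
      · intro p
        have h1 := inter_card1 ({w : V | (G p).Adj x w} : Finset V)
          {w : V | (G i).Adj a w} x (by simp) (by simpa using fun e => hi e.symm) hV
        have h2 := hs x a ha ⟨i, hi⟩ p i
        unfold dg at h2
        omega
      · intro p q
        have h1 := inter_card ({w : V | (G p).Adj x w} : Finset V)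
          {w : V | (G q).Adj a w} hV
        have h2 := hs x a ha ⟨i, hi⟩ p q
        unfold dg at h2
        omega
    · push Not at hx
      obtain ⟨a, ha⟩ := Fintype.exists_ne_of_one_lt_card (by omega) x
      obtain ⟨col, hcol⟩ := colours hI (by omega)
      have : ∀ p q, 2 ≤ #(({w : V | (G p).Adj x w} : Finset V) ∩ ({w : V | (G q).Adj a w} : Finset V)) := by
        intro p q
        have h1 := inter_card ({w : V | (G p).Adj x w} : Finset V)
          {w : V | (G q).Adj a w} hV
        have h2 := hmd q a
        have h3 := dg_full G p x (fun w hw => hx w hw p)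
        unfold dg at h2 h3
        omega
      exact ⟨a, col 0, ha.symm, fun p => this p _, fun p q => by have := this p q; omega⟩
  obtain ⟨a, i, hxa, k1, k2⟩ := key
  have hcard : 3 ≤ #((univ : Finset ι).erase i) := by
    rw [Finset.card_erase_of_mem (Finset.mem_univ _), Finset.card_univ]; omega
  obtain ⟨p, p', q', hp, hp', hq', e1, e2, e3⟩ := Finset.two_lt_card_iff.1 hcard
  simp only [Finset.mem_erase, Finset.mem_univ, and_true] at hp hp' hq'
  obtain ⟨y, hy⟩ := Finset.card_pos.1 (k2 p' q')
  obtain ⟨z, hz, hzy⟩ := Finset.exists_mem_ne (k1 p) y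
  simp only [Finset.mem_inter, Finset.mem_filter, Finset.mem_univ, true_and] at hy hz
  obtain ⟨y1, y2⟩ := hy
  obtain ⟨z1, z2⟩ := hz
  have p2 := (NPath.single G y (fun _ => q')).snoc le_rfl a (fun _ _ => y2.ne.symm) q'
      (fun j hj => by omega) y2.symm
  have p3 := p2.snoc (by omega) z (by
    intro j hj
    split_ifs
    · exact hzy.symm
    · exact z2.ne) i (by intro j hj; simpa using hq') (by simpa using z2)
  refine (p3.close_thr (by omega) x ?_ p p' e1 ?_ ?_ ?_ ?_).1
  · intro j hj
    split_ifs
    · exact y1.ne.symm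
    · exact hxa.symm
    · exact z1.ne.symm
  · intro j hj
    split_ifs
    · exact e2.symm
    · exact e2.symm
    · exact hp.symm
  · intro j hj
    split_ifs
    · exact e3.symm
    · exact e3.symm
    · exact hp'.symm
  · simpa using z1.symm
  · simpa using y1

lemma deg_restrict (T : Finset V) (p : ι) (u : V) :
    dg G p u ≤ #{w ∈ univ \ T | (G p).Adj u w} + #T := by
  unfold dg
  refine le_trans (Finset.card_le_card
    (t := ({w ∈ univ \ T | (G p).Adj u w} : Finset V) ∪ T) ?_) (Finset.card_union_le _ _)
  intro w hw
  simp only [Finset.mem_filter, Finset.mem_univ, true_and, Finset.mem_union,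
    Finset.mem_sdiff] at hw ⊢
  tauto

lemma oreOn (h : Hyp G n) (T : Finset V) (t : ℕ) (hT : #T = t) (ht : 1 ≤ t) (hn : t + 2 ≤ n)
    (hnt : 3 * t + 1 ≤ n) :
    ∃ (c : ZMod (n - t) → V) (φ : ZMod (n - t) → ι), IsRainbowCycle G c φ ∧ (∀ i, c i ∉ T) ∧
      (∀ v, v ∉ T → ∃ i, c i = v) := by
  obtain ⟨hV, hI, hs⟩ := h
  have hS : #(univ \ T) = n - t := by
    rw [Finset.card_sdiff_of_subset (Finset.subset_univ _), Finset.card_univ, hV, hT]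
  obtain ⟨c, φ, hc, hcS⟩ := ore (univ \ T) hS (by omega) (by omega) G (by
    intro u _ v _ huv i hi p q
    have h1 := hs u v huv ⟨i, hi⟩ p q
    have h2 := deg_restrict (G := G) T p u
    have h3 := deg_restrict (G := G) T q v
    omega)
  have : NeZero (n - t) := ⟨by omega⟩
  refine ⟨c, φ, hc, fun i => by simpa using hcS i, ?_⟩
  have himg : univ.image c = univ \ T := by
    apply Finset.eq_of_subset_of_card_le
    · intro v hv
      obtain ⟨j, _, rfl⟩ := Finset.mem_image.1 hv
      exact hcS j
    · rw [Finset.card_image_of_injective _ hc.1, Finset.card_univ, ZMod.card, hS]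
  intro v hv
  have : v ∈ univ.image c := by rw [himg]; simpa using hv
  obtain ⟨i, _, hi⟩ := Finset.mem_image.1 this
  exact ⟨i, hi⟩

lemma cnt {N : ℕ} [NeZero N] {T : Finset V} {c : ZMod N → V} (hc : ∀ v, v ∉ T → ∃ i, c i = v)
    (y : V) (hy : y ∈ T) (κ : ι) : dg G κ y + 1 ≤ #{i : ZMod N | (G κ).Adj y (c i)} + #T := by
  have h1 : #(T.erase y) + 1 = #T := Finset.card_erase_add_one hy
  have h2 : dg G κ y ≤ #{i : ZMod N | (G κ).Adj y (c i)} + #(T.erase y) := by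
    unfold dg
    refine le_trans (Finset.card_le_card
      (t := ({i : ZMod N | (G κ).Adj y (c i)} : Finset _).image c ∪ T.erase y) ?_)
      (le_trans (Finset.card_union_le _ _) (Nat.add_le_add_right Finset.card_image_le _))
    intro w hw
    have hw' : (G κ).Adj y w := by simpa using hw
    by_cases hwT : w ∈ T
    · exact Finset.mem_union_right _ (Finset.mem_erase.2 ⟨hw'.ne.symm, hwT⟩)
    · obtain ⟨i, rfl⟩ := hc w hwT
      exact Finset.mem_union_left _ (Finset.mem_image_of_mem _ (by simpa using hw'))
  omega

lemma spare1 {N : ℕ} [NeZero N] (φ : ZMod N → ι) (hN : N + 1 ≤ Fintype.card ι) :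
    ∃ κ, ∀ z, φ z ≠ κ := by
  by_contra hcon
  push Not at hcon
  have := Fintype.card_le_of_surjective φ hcon
  rw [ZMod.card] at this
  omega

lemma spare2 {N : ℕ} [NeZero N] (φ : ZMod N → ι) (hN : N + 2 ≤ Fintype.card ι) :
    ∃ κ κ', κ ≠ κ' ∧ (∀ z, φ z ≠ κ) ∧ ∀ z, φ z ≠ κ' := by
  have h1 : #(univ.image φ) ≤ N := by
    refine le_trans Finset.card_image_le ?_
    rw [Finset.card_univ, ZMod.card]
  have h2 : 1 < #(univ \ univ.image φ) := by
    rw [Finset.card_sdiff_of_subset (Finset.subset_univ _), Finset.card_univ]; omega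
  obtain ⟨a, b, ha, hb, hab⟩ := Finset.one_lt_card_iff.1 h2
  refine ⟨a, b, hab, ?_, ?_⟩
  · intro z hz; simp at ha; exact ha z hz
  · intro z hz; simp at hb; exact hb z hz

lemma len_pred (h : Hyp G n) (hn : 4 ≤ n) (x : V) : HasRainbowCycleThrough G (n - 1) x := by
  obtain ⟨w, hw⟩ := Fintype.exists_ne_of_one_lt_card (by have := h.1; omega) x
  obtain ⟨c, φ, hc, -, h2⟩ := oreOn h {w} 1 (by simp) le_rfl (by omega) (by omega)
  exact ⟨c, φ, hc, h2 x (by simpa using hw.symm)⟩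

lemma card_shift {N : ℕ} [NeZero N] (P : ZMod N → Prop) (s : ZMod N) :
    #{i : ZMod N | P (i + s)} = #{i : ZMod N | P i} := by
  refine Finset.card_equiv (Equiv.addRight s) ?_
  intro i
  simp

lemma mid_high (h : Hyp G n) (hn : 7 ≤ n) (x : V) (hd : ∀ p, n + 1 ≤ 2 * dg G p x) (k : ℕ)
    (hk : k + 4 ≤ n) (hk1 : 1 ≤ k) : HasRainbowCycleThrough G (k + 2) x := by
  obtain ⟨w, hw⟩ := Fintype.exists_ne_of_one_lt_card (by have := h.1; omega) x
  have hT : #({x, w} : Finset V) = 2 := Finset.card_pair hw.symm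
  obtain ⟨c, φ, hc, h1, h2⟩ := oreOn h {x, w} 2 hT (by omega) (by omega) (by omega)
  have : NeZero (n - 2) := ⟨by omega⟩
  obtain ⟨κ, κ', hκ, s1, s2⟩ := spare2 φ (by have := h.2.1; omega)
  have c1 := cnt (G := G) h2 x (by simp) κ
  have c2 := cnt (G := G) h2 x (by simp) κ'
  rw [← card_shift (fun i => (G κ').Adj x (c i)) (k : ZMod (n-2))] at c2
  have hne : (({i : ZMod (n-2) | (G κ).Adj x (c i)} : Finset _) ∩
      ({i : ZMod (n-2) | (G κ').Adj x (c (i + k))} : Finset _)).Nonempty := by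
    rw [← Finset.card_pos]
    have := inter_card ({i : ZMod (n-2) | (G κ).Adj x (c i)} : Finset _)
      ({i : ZMod (n-2) | (G κ').Adj x (c (i + k))} : Finset _) (ZMod.card (n-2))
    have := hd κ
    have := hd κ'
    omega
  obtain ⟨i, hi⟩ := hne
  simp only [Finset.mem_inter, Finset.mem_filter, Finset.mem_univ, true_and] at hi
  have hx : ∀ z, c z ≠ x := fun z hz => h1 z (by simp [hz])
  refine ((arc hc (m := k + 1) (by omega) i).close_thr (by omega) x (fun j _ => hx _) κ' κ hκ.symm
    (fun j _ => s2 _) (fun j _ => s1 _) ?_ ?_).1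
  · simpa using hi.2.symm
  · simpa using hi.1

lemma mid_long (h : Hyp G n) (hn : 7 ≤ n) (x y : V) (hxy : x ≠ y) (e : ℕ)
    (hy : ∀ q, e ≤ dg G q y) (k : ℕ) (hk : k + 4 ≤ n) (hlong : 2 * n < k + 3 + 2 * e) :
    HasRainbowCycleThrough G (k + 2) x := by
  obtain ⟨w, hw⟩ : ∃ w, w ∉ ({x, y} : Finset V) := by
    by_contra hcon
    push Not at hcon
    have h3 : #(univ : Finset V) ≤ #({x, y} : Finset V) :=
      Finset.card_le_card (fun v _ => hcon v)
    rw [Finset.card_pair hxy, Finset.card_univ, h.1] at h3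
    omega
  have hwx : w ≠ x := fun e => hw (by simp [e])
  have hwy : w ≠ y := fun e => hw (by simp [e])
  have hT : #({y, w} : Finset V) = 2 := Finset.card_pair hwy.symm
  obtain ⟨c, φ, hc, h1, h2⟩ := oreOn h {y, w} 2 hT (by omega) (by omega) (by omega)
  have : NeZero (n - 2) := ⟨by omega⟩
  obtain ⟨κ, κ', hκ, s1, s2⟩ := spare2 φ (by have := h.2.1; omega)
  obtain ⟨z0, hz0⟩ := h2 x (by simp [hxy, hwx.symm])
  have hbad : ∀ (q : ι) (s : ZMod (n-2)),
      #((Finset.range (k+1)).filter (fun j : ℕ => ¬ (G q).Adj y (c (z0 - (j : ZMod (n-2)) + s)))) + e + 1 ≤ n := by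
    intro q s
    have c1 := cnt (G := G) h2 y (by simp) q
    have c3 := hy q
    have c2 : #((Finset.range (k+1)).filter (fun j : ℕ => ¬ (G q).Adj y (c (z0 - (j : ZMod (n-2)) + s)))) ≤
        #{i : ZMod (n-2) | ¬ (G q).Adj y (c i)} := by
      refine Finset.card_le_card_of_injOn (fun j : ℕ => z0 - ((j : ℕ) : ZMod (n-2)) + s) ?_ ?_
      · intro j hj
        simp only [Finset.coe_filter, Set.mem_ofPred_eq] at hj
        simpa using hj.2
      · intro i hi j hj hij
        simp only [Finset.coe_filter, Set.mem_ofPred_eq, Finset.mem_range] at hi hj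
        have h5 : (i : ZMod (n-2)) = j := by
          have := add_right_cancel hij
          exact sub_right_inj.1 this
        exact cast_inj (N := n - 2) (a := 0) (i := i) (j := j) (by omega) (by omega) (by simpa using h5)
    have c4 := Finset.card_filter_add_card_filter_not (s := (univ : Finset (ZMod (n-2))))
      (fun i => (G q).Adj y (c i))
    rw [Finset.card_univ, ZMod.card] at c4
    omega
  have b1 := hbad κ 0
  have b2 := hbad κ' k
  obtain ⟨j, hj, hjn⟩ := Finset.exists_mem_notMem_of_card_lt_card
    (s := ((Finset.range (k+1)).filter (fun j : ℕ => ¬ (G κ).Adj y (c (z0 - (j : ZMod (n-2)) + 0))) ∪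
      (Finset.range (k+1)).filter (fun j : ℕ => ¬ (G κ').Adj y (c (z0 - (j : ZMod (n-2)) + k))) : Finset ℕ))
    (t := Finset.range (k+1)) (by
      refine lt_of_le_of_lt (Finset.card_union_le _ _) ?_
      rw [Finset.card_range]
      omega)
  have hj' : j < k + 1 := by simpa using hj
  simp only [Finset.mem_union, Finset.mem_filter, hj, true_and, not_or, not_not, add_zero] at hjn
  have hyc : ∀ z, c z ≠ y := fun z hz => h1 z (by simp [hz])
  have := ((arc hc (m := k + 1) (by omega) (z0 - j)).close_thr (by omega) y
    (fun j _ => hyc _) κ' κ hκ.symm (fun j _ => s2 _) (fun j _ => s1 _)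
    (by simpa using hjn.2.symm) (by simpa using hjn.1)).2 j hj'
  simpa [hz0] using this

lemma NPath.congr {G : ι → SimpleGraph V} {N : ℕ} {p : ℕ → V} {ψ ψ' : ℕ → ι}
    (h : NPath G N p ψ) (hψ : ∀ j, j + 1 < N → ψ j = ψ' j) : NPath G N p ψ' := by
  obtain ⟨g1, g2, g3⟩ := h
  refine ⟨g1, ?_, ?_⟩
  · intro i j hi hj hij
    rw [← hψ i hi, ← hψ j hj] at hij
    exact g2 i j hi hj hij
  · intro i hi
    rw [← hψ i hi]; exact g3 i hi

lemma greedy (A : Finset V) (hA : A.Nonempty) (col : ℕ → ι)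
    (hcol : ∀ i j, i < n → j < n → col i = col j → i = j) (r : ℕ) (hr : r ≤ n)
    (hext : ∀ a ∈ A, ∀ q, r ≤ #{v ∈ A | (G q).Adj a v} + 1) :
    ∀ s, 1 ≤ s → s ≤ r → ∃ p, NPath G s p col ∧ ∀ j, j < s → p j ∈ A := by
  intro s hs
  induction s, hs using Nat.le_induction with
  | base =>
    intro _
    obtain ⟨a, ha⟩ := hA
    exact ⟨fun _ => a, NPath.single G a col, fun _ _ => ha⟩
  | succ s hs ih =>
    intro hsr
    obtain ⟨p, hp, hpA⟩ := ih (by omega)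
    have hx := hext (p (s-1)) (hpA _ (by omega)) (col (s-1))
    obtain ⟨v, hv, hvn⟩ := Finset.exists_mem_notMem_of_card_lt_card
      (s := (Finset.range (s-1)).image p)
      (t := ({v ∈ A | (G (col (s-1))).Adj (p (s-1)) v} : Finset V)) (by
        have := Finset.card_image_le (s := Finset.range (s-1)) (f := p)
        rw [Finset.card_range] at this
        omega)
    rw [Finset.mem_filter] at hv
    have hpv : ∀ j, j < s → p j ≠ v := by
      intro j hj hjv
      by_cases hjs : j = s - 1
      · subst hjs; exact hv.2.ne hjv
      · exact hvn (Finset.mem_image.2 ⟨j, by simp; omega, hjv⟩)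
    have := hp.snoc hs v hpv (col (s-1)) (by
      intro j hj e
      have := hcol _ _ (by omega) (by omega) e
      omega) hv.2
    refine ⟨_, this.congr ?_, ?_⟩
    · intro j hj
      split_ifs with hh
      · rfl
      · congr 1; omega
    · intro j hj
      split_ifs with hh
      · exact hpA j hh
      · exact hv.1

lemma mid_short (h : Hyp G n) (x : V) (A : Finset V) (hA : A.Nonempty) (hxA : x ∉ A)
    (d e r : ℕ) (hr : 1 ≤ r) (hrn : r + 3 ≤ n) (hd : ∀ q, d ≤ dg G q x)
    (he : ∀ a ∈ A, ∀ q, e ≤ dg G q a) (h1 : n + r ≤ #A + e + 1) (h2 : n + r + 1 ≤ d + e) :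
    HasRainbowCycleThrough G (r + 3) x := by
  obtain ⟨hV, hI, -⟩ := h
  obtain ⟨col, hcol⟩ := colours hI (by omega)
  obtain ⟨p, hp, hpA⟩ := greedy (G := G) A hA col hcol r (by omega) (by
    intro a ha q
    have a1 := inter_card A ({v : V | (G q).Adj a v} : Finset V) hV
    have a2 := he a ha q
    have a3 : A ∩ ({v : V | (G q).Adj a v} : Finset V) = {v ∈ A | (G q).Adj a v} := by
      ext v; simp
    rw [a3] at a1
    unfold dg at a2
    omega) r hr le_rfl
  have hcn : ∀ i j, i < n → j < n → i ≠ j → col i ≠ col j := fun i j hi hj hij e =>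
    hij (hcol i j hi hj e)
  have hcom : ∀ a ∈ A, ∀ q q', r + 1 ≤
      #(({v : V | (G q).Adj x v} : Finset V) ∩ ({v : V | (G q').Adj a v} : Finset V)) := by
    intro a ha q q'
    have a1 := inter_card ({v : V | (G q).Adj x v} : Finset V)
      ({v : V | (G q').Adj a v} : Finset V) hV
    have a2 := he a ha q'
    have a3 := hd q
    unfold dg at a2 a3
    omega
  have him : #((Finset.range r).image p) ≤ r := by
    have := Finset.card_image_le (s := Finset.range r) (f := p)
    rwa [Finset.card_range] at this
  obtain ⟨z, hz, hzn⟩ := Finset.exists_mem_notMem_of_card_lt_card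
    (lt_of_le_of_lt him (hcom (p (r-1)) (hpA _ (by omega)) (col r) (col (r-1))))
  simp only [Finset.mem_inter, Finset.mem_filter, Finset.mem_univ, true_and] at hz
  have hzp : ∀ j, j < r → p j ≠ z := fun j hj e =>
    hzn (Finset.mem_image.2 ⟨j, by simpa using hj, e⟩)
  have him2 : #(((Finset.range r).erase 0).image p) + 1 ≤ r := by
    have := Finset.card_image_le (s := (Finset.range r).erase 0) (f := p)
    have h0 := Finset.card_erase_add_one (s := Finset.range r) (a := 0) (by simp; omega)
    rw [Finset.card_range] at h0
    omega
  obtain ⟨y, hy, hyn⟩ := Finset.exists_mem_notMem_of_card_lt_card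
    (s := insert z (((Finset.range r).erase 0).image p))
    (lt_of_le_of_lt (le_trans (Finset.card_insert_le _ _) him2)
      (hcom (p 0) (hpA _ (by omega)) (col (r+1)) (col (r+2))))
  simp only [Finset.mem_inter, Finset.mem_filter, Finset.mem_univ, true_and] at hy
  have hyz : z ≠ y := fun e => hyn (by rw [← e]; exact Finset.mem_insert_self _ _)
  have hyp : ∀ j, j < r → p j ≠ y := by
    intro j hj e
    by_cases hj0 : j = 0
    · subst hj0; exact hy.2.ne e
    · exact hyn (Finset.mem_insert_of_mem (Finset.mem_image.2 ⟨j, by simp; omega, e⟩))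
  have hxp : ∀ j, j < r → p j ≠ x := fun j hj e => hxA (e ▸ hpA j hj)
  have p1 := hp.snoc hr z hzp (col (r-1))
    (fun j hj => hcn _ _ (by omega) (by omega) (by omega)) hz.2
  have p1' : NPath G (r+1) (fun j => if j < r then p j else z) col := p1.congr (by
    intro j hj
    split_ifs with hh
    · rfl
    · congr 1; omega)
  have p2 := p1'.snoc (by omega) x (by
      intro j hj
      split_ifs with hh
      · exact hxp j hh
      · exact hz.1.ne.symm) (col r)
    (fun j hj => hcn _ _ (by omega) (by omega) (by omega)) (by simpa using hz.1.symm)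
  have p2' : NPath G (r+2) (fun j => if j < r + 1 then (if j < r then p j else z) else x) col :=
    p2.congr (by
    intro j hj
    split_ifs with hh
    · rfl
    · congr 1; omega)
  have := (p2'.close_thr (by omega) y (by
      intro j hj
      split_ifs with hh hh2
      · exact hyp j hh2
      · exact hyz
      · exact hy.1.ne) (col (r+1)) (col (r+2)) (hcn _ _ (by omega) (by omega) (by omega))
      (fun j hj => hcn _ _ (by omega) (by omega) (by omega))
      (fun j hj => hcn _ _ (by omega) (by omega) (by omega)) (by simpa using hy.1)
      (by
        have h0 : 0 < r := by omega
        simpa [h0] using hy.2.symm)).2 (r+1) (by omega)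
  simpa using this

lemma mid (h : Hyp G n) (hn : 7 ≤ n) (x : V) (ℓ : ℕ) (hl : 5 ≤ ℓ) (hln : ℓ + 2 ≤ n) :
    HasRainbowCycleThrough G ℓ x := by
  have : Nonempty ι := Fintype.card_pos_iff.1 (by have := h.2.1; omega)
  obtain ⟨p0, hp0⟩ := Finite.exists_min (fun p => dg G p x)
  obtain ⟨d, hd⟩ : ∃ d, d = dg G p0 x := ⟨_, rfl⟩
  rw [← hd] at hp0
  by_cases hh : n + 1 ≤ 2 * d
  · have := mid_high h hn x (fun p => by have := hp0 p; omega) (ℓ - 2) (by omega) (by omega)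
    rwa [Nat.sub_add_cancel (by omega)] at this
  obtain ⟨e, he1, he2⟩ : ∃ e, 4 * n ≤ 3 * (d + e) + 3 ∧ ∀ m, 4 * n ≤ 3 * (d + m) + 3 → e ≤ m :=
    ⟨(4 * n - 1 - 3 * d) / 3, by omega, by intro m hm; omega⟩
  set A : Finset V := {a : V | x ≠ a ∧ ∃ i, ¬ (G i).Adj x a} with hAdef
  have hA : ∀ a ∈ A, ∀ q, e ≤ dg G q a := by
    intro a ha q
    rw [hAdef, Finset.mem_filter] at ha
    apply he2
    rw [hd]
    exact h.2.2 x a ha.2.1 ha.2.2 p0 q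
  have hAc : n ≤ #A + d + 1 := by
    have h1 : (univ : Finset V) ⊆ A ∪ insert x ({w : V | (G p0).Adj x w} : Finset V) := by
      intro v _
      by_cases hv : x = v
      · simp [hv]
      · by_cases hv2 : (G p0).Adj x v
        · simp [hv2]
        · rw [Finset.mem_union, hAdef, Finset.mem_filter]
          exact Or.inl ⟨Finset.mem_univ _, hv, p0, hv2⟩
    have h2 := Finset.card_le_card h1
    have h3 := Finset.card_union_le A (insert x ({w : V | (G p0).Adj x w} : Finset V))
    have h4 := Finset.card_insert_le x ({w : V | (G p0).Adj x w} : Finset V)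
    rw [Finset.card_univ, h.1] at h2
    unfold dg at hd
    omega
  have hAne : A.Nonempty := by rw [← Finset.card_pos]; omega
  by_cases hlong : 2 * n < ℓ + 1 + 2 * e
  · obtain ⟨y, hy⟩ := hAne
    have hy2 := hy
    rw [hAdef, Finset.mem_filter] at hy2
    have := mid_long h hn x y hy2.2.1 e (hA y hy) (ℓ - 2) (by omega) (by omega)
    rwa [Nat.sub_add_cancel (by omega)] at this
  · have := mid_short h x A hAne (by simp [hAdef]) d e (ℓ - 3) (by omega) (by omega) hp0 hA
      (by omega) (by omega)
    rwa [Nat.sub_add_cancel (by omega)] at this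

lemma ham_any (hV : Fintype.card V = n) (hn : 1 ≤ n) (x y : V)
    (h : HasRainbowCycleThrough G n y) : HasRainbowCycleThrough G n x := by
  have : NeZero n := ⟨by omega⟩
  obtain ⟨c, φ, hc, -⟩ := h
  have hb := (Fintype.bijective_iff_injective_and_card c).2 ⟨hc.1, by rw [ZMod.card, hV]⟩
  exact ⟨c, φ, hc, hb.2 x⟩

lemma exists_good (h : Hyp G n) (hn : 4 ≤ n) :
    ∃ y, ∀ v p q, 4 * n ≤ 3 * (dg G p v + dg G q y) + 3 := by
  obtain ⟨hV, hI, hs⟩ := h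
  have : Nonempty ι := Fintype.card_pos_iff.1 (by omega)
  have : Nonempty V := Fintype.card_pos_iff.1 (by omega)
  obtain ⟨⟨x0, q0⟩, hm⟩ := Finite.exists_min (fun z : V × ι => dg G z.2 z.1)
  by_cases hx : ∃ w, x0 ≠ w ∧ ∃ i, ¬ (G i).Adj x0 w
  · obtain ⟨w, hw, hi⟩ := hx
    refine ⟨w, fun v p q => ?_⟩
    have h1 := hs x0 w hw hi q0 q
    have h2 := hm (v, p)
    simp only at h2
    omega
  · push Not at hx
    refine ⟨x0, fun v p q => ?_⟩
    have h1 := dg_full G q0 x0 (fun w hw => hx w hw q0)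
    have h2 := hm (v, p)
    have h3 := hm (x0, q)
    simp only at h2 h3
    omega

lemma last_idx {N : ℕ} (hN : 1 ≤ N) (k : ZMod N) : k + 1 + ((N - 1 : ℕ) : ZMod N) = k := by
  have h1 : ((1 + (N - 1) : ℕ) : ZMod N) = 0 := by
    rw [Nat.add_sub_cancel' hN]; exact ZMod.natCast_self N
  push_cast at h1
  rw [add_assoc, h1, add_zero]

lemma ham_rot {N : ℕ} (hN : 2 ≤ N) {c : ZMod N → V} {φ : ZMod N → ι}
    (hc : IsRainbowCycle G c φ) (y : V) (hy : ∀ i, c i ≠ y) (κ : ι) (hκ : ∀ i, φ i ≠ κ)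
    (hcon : ¬ HasRainbowCycleThrough G (N + 1) y) (k i : ZMod N)
    (h1 : (G κ).Adj y (c (k + 1))) (h2 : (G (φ i)).Adj (c i) (c k)) :
    ¬ (G (φ k)).Adj y (c (i + 1)) := by
  intro h3
  have : NeZero N := ⟨by omega⟩
  have hl := last_idx (by omega : 1 ≤ N) k
  obtain ⟨t, htN, ht⟩ : ∃ t : ℕ, t < N ∧ k + 1 + (t : ZMod N) = i :=
    ⟨(i - (k+1)).val, ZMod.val_lt _, by rw [ZMod.natCast_zmod_val]; ring⟩
  have ht1 : t + 1 < N := by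
    by_contra hh
    have e : t = N - 1 := by omega
    rw [e, hl] at ht
    rw [ht] at h2
    exact (G (φ i)).loopless.irrefl _ h2
  have hp := arc hc (le_refl N) (k + 1)
  have hr := hp.rotate t ht1 (by rw [hl, ht]; exact h2)
  have hφ : ∀ j : ℕ, j + 1 < N → φ (k + 1 + (j : ZMod N)) ≠ φ k := by
    intro j hj e
    have e1 := hc.2.1 e
    have e2 := e1.trans hl.symm
    have := cast_inj (by omega) (by omega) e2
    omega
  refine hcon (hr.close_thr (by omega) y ?_ (φ k) κ (hκ k) ?_ ?_ ?_ ?_).1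
  · intro j hj
    split_ifs <;> exact hy _
  · intro j hj
    split_ifs with hh
    · exact hφ j hj
    · exact hφ _ (by omega)
  · intro j hj
    split_ifs <;> exact hκ _
  · rw [if_neg (by omega)]
    have e : N + t - (N - 1) = t + 1 := by omega
    rw [e, Nat.cast_add, Nat.cast_one, ← add_assoc, ht]
    exact h3.symm
  · simpa using h1

lemma ham_ins {N : ℕ} (hN : 2 ≤ N) {c : ZMod N → V} {φ : ZMod N → ι}
    (hc : IsRainbowCycle G c φ) (y : V) (hy : ∀ i, c i ≠ y) (κ : ι) (hκ : ∀ i, φ i ≠ κ)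
    (hcon : ¬ HasRainbowCycleThrough G (N + 1) y) (k : ZMod N)
    (h1 : (G κ).Adj y (c (k + 1))) : ¬ (G (φ k)).Adj (c k) y := by
  intro h3
  have hl := last_idx (by omega : 1 ≤ N) k
  have hp := arc hc (le_refl N) (k + 1)
  have hφ : ∀ j : ℕ, j + 1 < N → φ (k + 1 + (j : ZMod N)) ≠ φ k := by
    intro j hj e
    have e1 := hc.2.1 e
    have e2 := e1.trans hl.symm
    have := cast_inj (by omega) (by omega) e2
    omega
  refine hcon (hp.close_thr (by omega) y (fun j _ => hy _) (φ k) κ (hκ k) (fun j hj => hφ j hj)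
    (fun j _ => hκ _) ?_ ?_).1
  · rw [hl]; exact h3
  · simpa using h1

lemma ham (h : Hyp G n) (hn : 4 ≤ n) (x : V) : HasRainbowCycleThrough G n x := by
  obtain ⟨y, hgood⟩ := exists_good h hn
  refine ham_any h.1 (by omega) x y ?_
  by_contra hcon
  obtain ⟨N, rfl⟩ : ∃ N, n = N + 1 := ⟨n - 1, by omega⟩
  have : NeZero N := ⟨by omega⟩
  obtain ⟨c, φ, hc, h1, h2⟩ : ∃ (c : ZMod N → V) (φ : ZMod N → ι), IsRainbowCycle G c φ ∧
      (∀ i, c i ∉ ({y} : Finset V)) ∧ (∀ v, v ∉ ({y} : Finset V) → ∃ i, c i = v) :=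
    oreOn h {y} 1 (by simp) le_rfl (by omega) (by omega)
  have hy : ∀ i, c i ≠ y := fun i => by simpa using h1 i
  obtain ⟨κ, hκ⟩ := spare1 φ (by have := h.2.1; omega)
  have : Nonempty ι := ⟨κ⟩
  obtain ⟨q0, hq0⟩ := Finite.exists_min (fun q => dg G q y)
  obtain ⟨μ, hμ⟩ : ∃ μ, μ = dg G q0 y := ⟨_, rfl⟩
  rw [← hμ] at hq0
  have hcntq : ∀ q, μ ≤ #{i : ZMod N | (G q).Adj y (c (i + 1))} := by
    intro q
    have a1 := cnt (G := G) h2 y (by simp) q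
    rw [← card_shift (fun i => (G q).Adj y (c i)) 1, Finset.card_singleton] at a1
    have := hq0 q
    omega
  set X : Finset (ZMod N) := {k : ZMod N | (G κ).Adj y (c (k + 1))} with hX
  have hD : μ ≤ #X := hcntq κ
  have hXN : #X ≤ N := by
    have := Finset.card_le_univ X
    rwa [ZMod.card] at this
  have hin : ∀ k ∈ X, #{i : ZMod N | (G (φ i)).Adj (c i) (c k)} + μ ≤ N := by
    intro k hk
    have hk' : (G κ).Adj y (c (k + 1)) := by simpa [hX] using hk
    have a1 := hcntq (φ k)
    have a2 : Disjoint ({i : ZMod N | (G (φ i)).Adj (c i) (c k)} : Finset _)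
        ({i : ZMod N | (G (φ k)).Adj y (c (i + 1))} : Finset _) := by
      rw [Finset.disjoint_left]
      intro i hi hi2
      simp only [Finset.mem_filter, Finset.mem_univ, true_and] at hi hi2
      exact ham_rot (by omega) hc y hy κ hκ hcon k i hk' hi hi2
    have a3 := Finset.card_le_univ (({i : ZMod N | (G (φ i)).Adj (c i) (c k)} : Finset _) ∪
      ({i : ZMod N | (G (φ k)).Adj y (c (i + 1))} : Finset _))
    rw [Finset.card_union_of_disjoint a2, ZMod.card] at a3
    omega
  have hin2 : ∀ k, #{i : ZMod N | (G (φ i)).Adj (c i) (c k)} + 1 ≤ N := by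
    intro k
    have a1 : k ∉ ({i : ZMod N | (G (φ i)).Adj (c i) (c k)} : Finset _) := by simp
    have a2 := Finset.card_le_univ (insert k ({i : ZMod N | (G (φ i)).Adj (c i) (c k)} : Finset _))
    rw [Finset.card_insert_of_notMem a1, ZMod.card] at a2
    exact a2
  have hiny : #{i : ZMod N | (G (φ i)).Adj (c i) y} + #X ≤ N := by
    have a2 : Disjoint ({i : ZMod N | (G (φ i)).Adj (c i) y} : Finset _) X := by
      rw [Finset.disjoint_left]
      intro i hi hi2
      simp only [hX, Finset.mem_filter, Finset.mem_univ, true_and] at hi hi2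
      exact ham_ins (by omega) hc y hy κ hκ hcon i hi2 hi
    have a3 := Finset.card_le_univ (({i : ZMod N | (G (φ i)).Adj (c i) y} : Finset _) ∪ X)
    rw [Finset.card_union_of_disjoint a2, ZMod.card] at a3
    exact a3
  have hdeg : ∀ i, dg G (φ i) (c i) ≤ (if (G (φ i)).Adj (c i) y then 1 else 0) +
      #{k : ZMod N | (G (φ i)).Adj (c i) (c k)} := by
    intro i
    have a1 : ({w : V | (G (φ i)).Adj (c i) w} : Finset V) ⊆
        (({y} : Finset V).filter (fun w => (G (φ i)).Adj (c i) w)) ∪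
        ({k : ZMod N | (G (φ i)).Adj (c i) (c k)} : Finset _).image c := by
      intro w hw
      have hw' : (G (φ i)).Adj (c i) w := by simpa using hw
      by_cases hwy : w = y
      · exact Finset.mem_union_left _ (by simp [hwy, hwy ▸ hw'])
      · obtain ⟨k, rfl⟩ := h2 w (by simpa using hwy)
        exact Finset.mem_union_right _ (Finset.mem_image_of_mem _ (by simpa using hw'))
    have a2 := (Finset.card_le_card a1).trans (Finset.card_union_le _ _)
    have a3 := Finset.card_image_le (s := ({k : ZMod N | (G (φ i)).Adj (c i) (c k)} : Finset _))
      (f := c)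
    have a4 : #(({y} : Finset V).filter (fun w => (G (φ i)).Adj (c i) w)) =
        (if (G (φ i)).Adj (c i) y then 1 else 0) := by
      rw [Finset.card_filter, Finset.sum_singleton]
    unfold dg
    omega
  have hsum1 : ∑ i, dg G (φ i) (c i) ≤ #{i : ZMod N | (G (φ i)).Adj (c i) y} +
      ∑ k, #{i : ZMod N | (G (φ i)).Adj (c i) (c k)} := by
    refine (Finset.sum_le_sum (fun i _ => hdeg i)).trans ?_
    rw [Finset.sum_add_distrib, ← Finset.card_filter]
    refine Nat.add_le_add_left (le_of_eq ?_) _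
    simp only [Finset.card_filter]
    exact Finset.sum_comm
  have hsum2 : ∑ k, #{i : ZMod N | (G (φ i)).Adj (c i) (c k)} ≤
      #X * (N - μ) + (N - #X) * (N - 1) := by
    rw [← Finset.sum_add_sum_compl X]
    have hXc : #Xᶜ = N - #X := by rw [Finset.card_compl, ZMod.card]
    rw [← hXc]
    refine Nat.add_le_add ?_ ?_
    · have := Finset.sum_le_card_nsmul X _ (N - μ) (fun k hk => by
        have := hin k hk; exact Nat.le_sub_of_add_le this)
      simpa using this
    · have := Finset.sum_le_card_nsmul Xᶜ _ (N - 1) (fun k hk => by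
        have := hin2 k; exact Nat.le_sub_of_add_le this)
      simpa using this
  have hlow : N * (4 * N + 1) ≤ 3 * ∑ i, dg G (φ i) (c i) + N * (3 * μ) := by
    have a1 : ∑ _i : ZMod N, (4 * N + 1) ≤ ∑ i : ZMod N, (3 * dg G (φ i) (c i) + 3 * μ) := by
      refine Finset.sum_le_sum (fun i _ => ?_)
      have := hgood (c i) (φ i) q0
      omega
    have a2 : ∑ _i : ZMod N, (4 * N + 1) = N * (4 * N + 1) := by
      rw [Finset.sum_const, Finset.card_univ, ZMod.card, smul_eq_mul]
    have a3 : ∑ i : ZMod N, (3 * dg G (φ i) (c i) + 3 * μ) =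
        3 * ∑ i, dg G (φ i) (c i) + N * (3 * μ) := by
      rw [Finset.sum_add_distrib, ← Finset.mul_sum, Finset.sum_const, Finset.card_univ, ZMod.card,
        smul_eq_mul]
    rw [a2, a3] at a1
    exact a1
  have hμN : μ ≤ N := hD.trans hXN
  generalize (∑ i, dg G (φ i) (c i)) = S at *
  generalize (∑ k, #{i : ZMod N | (G (φ i)).Adj (c i) (c k)}) = S2 at *
  generalize #{i : ZMod N | (G (φ i)).Adj (c i) y} = Y at *
  generalize #X = D at *
  zify [hμN, hXN, (by omega : 1 ≤ N)] at *
  have f1 : (S : ℤ) + D * μ ≤ N * N := by nlinarith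
  have f2 : (μ : ℤ) * μ ≤ D * μ := mul_le_mul_of_nonneg_right hD (by positivity)
  have f3 : (3 : ℤ) ≤ N := by linarith
  nlinarith [sq_nonneg (2 * (μ : ℤ) - N)]

end

end RB

theorem stmt2 {V : Type*} [Fintype V] {n : ℕ} (hn : 3 ≤ n)
    (hV : Fintype.card V = n)
    (G : ZMod n → SimpleGraph V) [∀ i, DecidableRel (G i).Adj]
    (hσ : ∀ u v : V, u ≠ v → (∃ i, ¬ (G i).Adj u v) →
      ∀ p q, (4 * (n : ℝ) / 3 - 1) ≤ ((G p).degree u + (G q).degree v : ℝ)) :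
    ∀ x : V, ∀ ℓ : ℕ, 3 ≤ ℓ → ℓ ≤ n → HasRainbowCycleThrough G ℓ x := by
  have : NeZero n := ⟨by omega⟩
  have hyp : RB.Hyp G n := by
    refine ⟨hV, ZMod.card n, ?_⟩
    intro u v huv hi p q
    have h1 := hσ u v huv hi p q
    have hdg : ∀ p u, RB.dg G p u = (G p).degree u := by
      intro p u
      rw [← SimpleGraph.card_neighborFinset_eq_degree, SimpleGraph.neighborFinset_eq_filter]
      unfold RB.dg
      congr
    rw [hdg, hdg]
    have h2 : (4 * (n : ℝ)) ≤ 3 * ((G p).degree u + (G q).degree v) + 3 := by linarith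
    exact_mod_cast h2
  intro x l h3 hl
  by_cases e3 : l = 3
  · subst e3; exact RB.len3 hyp hn x
  by_cases e4 : l = 4
  · subst e4; exact RB.len4 hyp hl x
  by_cases en : l = n
  · subst en; exact RB.ham hyp (by omega) x
  by_cases en1 : l = n - 1
  · subst en1; exact RB.len_pred hyp (by omega) x
  exact RB.mid hyp (by omega) x l (by omega) (by omega)
end

section
/- Let n ≥ 3 and let 𝒢 = {G_1, …, G_n} be a family of n graphs (not necessarily distinct) on a common vertex set V with |V| = n. If σ(𝒢) ≥ n, then either every vertex of V is contained in a rainbow cycle of length n − 1 in 𝒢, or n is even and G_1 = ⋯ = G_n = K_{n/2,n/2}. -/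
structure RP {V ι : Type*} (G : ι → SimpleGraph V) (m : ℕ) (u : ℕ → V) (c : ℕ → ι) : Prop where
  vinj : ∀ i j, i < m → j < m → u i = u j → i = j
  cinj : ∀ i j, i + 1 < m → j + 1 < m → c i = c j → i = j
  adj : ∀ i, i + 1 < m → (G (c i)).Adj (u i) (u (i + 1))

structure RC {V ι : Type*} (G : ι → SimpleGraph V) (m : ℕ) (v : ℕ → V) (c : ℕ → ι) : Prop where
  vinj : ∀ i j, v i = v j ↔ i % m = j % m
  cinj : ∀ i j, c i = c j ↔ i % m = j % m
  adj : ∀ i, (G (c i)).Adj (v i) (v (i + 1))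

section helpers
variable {V ι : Type*} {G : ι → SimpleGraph V}

lemma add_mod_cancel {k i j m : ℕ} : (k + i) % m = (k + j) % m ↔ i % m = j % m :=
  ⟨fun h => Nat.ModEq.add_left_cancel' k h, fun h => Nat.ModEq.add_left k h⟩

lemma RC.rot {m : ℕ} {v : ℕ → V} {c : ℕ → ι} (h : RC G m v c) (k : ℕ) :
    RC G m (fun i => v (k + i)) (fun i => c (k + i)) where
  vinj i j := by rw [h.vinj, add_mod_cancel]
  cinj i j := by rw [h.cinj, add_mod_cancel]
  adj i := h.adj (k + i)

lemma RC.path {m l : ℕ} {v : ℕ → V} {c : ℕ → ι} (h : RC G m v c) (hl : l ≤ m) :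
    RP G l v c where
  vinj i j hi hj e := by
    rw [h.vinj, Nat.mod_eq_of_lt (by omega), Nat.mod_eq_of_lt (by omega)] at e; exact e
  cinj i j hi hj e := by
    rw [h.cinj, Nat.mod_eq_of_lt (by omega), Nat.mod_eq_of_lt (by omega)] at e; exact e
  adj i _ := h.adj i

lemma RP.close {m : ℕ} {u : ℕ → V} {c : ℕ → ι} (h : RP G m u c) (hm : 1 ≤ m) {a : ι}
    (ha : ∀ i, i + 1 < m → c i ≠ a) (hadj : (G a).Adj (u (m - 1)) (u 0)) :
    RC G m (fun i => u (i % m)) (fun i => if i % m + 1 < m then c (i % m) else a) where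
  vinj i j := ⟨fun e => h.vinj _ _ (Nat.mod_lt _ hm) (Nat.mod_lt _ hm) e, fun e => by simp [e]⟩
  cinj i j := by
    have h1 := Nat.mod_lt i hm
    have h2 := Nat.mod_lt j hm
    constructor
    · intro e
      try simp only at e
      split_ifs at e with h3 h4 h4
      · exact h.cinj _ _ h3 h4 e
      · exact absurd e (ha _ h3)
      · exact absurd e.symm (ha _ h4)
      · omega
    · intro e
      simp [e]
  adj i := by
    have h1 := Nat.mod_lt i hm
    have h2 : (i + 1) % m = (i % m + 1) % m := by simp
    try simp only
    rw [h2]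
    split_ifs with h3
    · rw [Nat.mod_eq_of_lt h3]
      exact h.adj _ h3
    · have h4 : i % m = m - 1 := by omega
      rw [h4, Nat.sub_add_cancel hm, Nat.mod_self]
      exact hadj

lemma RP.rev {m : ℕ} {u : ℕ → V} {c : ℕ → ι} (h : RP G m u c) :
    RP G m (fun i => u (m - 1 - i)) (fun i => c (m - 2 - i)) where
  vinj i j hi hj e := by
    have := h.vinj _ _ (by omega) (by omega) e
    omega
  cinj i j hi hj e := by
    have := h.cinj _ _ (by omega) (by omega) e
    omega
  adj i hi := by
    have := h.adj (m - 2 - i) (by omega)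
    have e : m - 2 - i + 1 = m - 1 - i := by omega
    have e' : m - 1 - (i + 1) = m - 2 - i := by omega
    try simp only
    rw [e']
    rw [e] at this
    exact this.symm

lemma RP.append {m : ℕ} {u : ℕ → V} {c : ℕ → ι} (h : RP G m u c) (hm : 1 ≤ m) {s : ι} {w : V}
    (hs : ∀ i, i + 1 < m → c i ≠ s) (hw : ∀ i, i < m → u i ≠ w)
    (hadj : (G s).Adj (u (m - 1)) w) :
    RP G (m + 1) (fun i => if i < m then u i else w) (fun i => if i + 1 < m then c i else s) where
  vinj i j hi hj e := by
    try simp only at e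
    split_ifs at e with h1 h2 h2
    · exact h.vinj _ _ h1 h2 e
    · exact absurd e (hw _ h1)
    · exact absurd e.symm (hw _ h2)
    · omega
  cinj i j hi hj e := by
    try simp only at e
    split_ifs at e with h1 h2 h2
    · exact h.cinj _ _ h1 h2 e
    · exact absurd e (hs _ h1)
    · exact absurd e.symm (hs _ h2)
    · omega
  adj i hi := by
    try simp only
    by_cases h1 : i + 1 < m
    · rw [if_pos h1, if_pos (by omega), if_pos h1]
      exact h.adj i h1
    · rw [if_neg h1, if_pos (by omega), if_neg h1]
      have : i = m - 1 := by omega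
      rw [this]; exact hadj

/-- crossing chords: re-route the path -/
lemma RP.cross {m : ℕ} {u : ℕ → V} {c : ℕ → ι} (h : RP G m u c) {k : ℕ} (hk : k + 1 < m)
    {b : ι} (hb : ∀ i, i + 1 < m → c i ≠ b) (hbk : (G b).Adj (u k) (u (m - 1))) :
    RP G m (fun i => if i ≤ k then u i else u (m + k - i))
      (fun i => if i < k then c i else if i = k then b else c (m + k - 1 - i)) where
  vinj i j hi hj e := by
    try simp only at e
    split_ifs at e with h1 h2 h2
    all_goals
      have := h.vinj _ _ (by omega) (by omega) e
      omega
  cinj i j hi hj e := by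
    try simp only at e
    split_ifs at e
    all_goals first
      | omega
      | exact absurd e (hb _ (by omega))
      | exact absurd e.symm (hb _ (by omega))
      | (have := h.cinj _ _ (by omega) (by omega) e
         omega)
  adj i hi := by
    try simp only
    rcases lt_trichotomy i k with h1 | h1 | h1
    · rw [if_pos h1, if_pos h1.le, if_pos (by omega)]
      exact h.adj i (by omega)
    · subst h1
      rw [if_neg (lt_irrefl _), if_pos rfl, if_pos le_rfl, if_neg (by omega)]
      have : m + i - (i + 1) = m - 1 := by omega
      rw [this]; exact hbk
    · rw [if_neg (by omega), if_neg (by omega), if_neg (by omega), if_neg (by omega)]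
      have e1 : m + k - (i + 1) = m + k - 1 - i := by omega
      have e2 : m + k - i = m + k - 1 - i + 1 := by omega
      rw [e1, e2]
      exact (h.adj _ (by omega)).symm

lemma RP.cross_close {m : ℕ} {u : ℕ → V} {c : ℕ → ι} (h : RP G m u c) {k : ℕ} (hk : k + 1 < m)
    {a b : ι} (hab : a ≠ b) (ha : ∀ i, i + 1 < m → c i ≠ a) (hb : ∀ i, i + 1 < m → c i ≠ b)
    (hak : (G a).Adj (u 0) (u (k + 1))) (hbk : (G b).Adj (u k) (u (m - 1)))
    {j : ℕ} (hj : j < m) :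
    ∃ v c', RC G m v c' ∧ ∃ i, v i = u j := by
  have h1 := (h.cross hk hb hbk).close (a := a) (by omega) (by
    intro i hi
    try simp only
    split_ifs
    · exact ha _ hi
    · exact hab.symm
    · exact ha _ (by omega)) (by
    try simp only
    rw [if_neg (by omega), if_pos (Nat.zero_le _)]
    have : m + k - (m - 1) = k + 1 := by omega
    rw [this]; exact hak.symm)
  by_cases h2 : j ≤ k
  · refine ⟨_, _, h1, j, ?_⟩
    simp only [Nat.mod_eq_of_lt hj, if_pos h2]
  · refine ⟨_, _, h1, m + k - j, ?_⟩
    have e : (m + k - j) % m = m + k - j := Nat.mod_eq_of_lt (by omega)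
    simp only [e]
    rw [if_neg (by omega)]
    congr 1; omega

variable [Fintype V] [∀ i, DecidableRel (G i).Adj]

open Classical in
lemma RP.deg_first {m : ℕ} {u : ℕ → V} {c : ℕ → ι} (_h : RP G m u c) (_hm : 1 ≤ m) (a : ι) :
    (G a).degree (u 0) ≤
      ((Finset.range (m - 1)).filter (fun k => (G a).Adj (u 0) (u (k + 1)))).card +
      (Finset.univ.filter (fun w => (G a).Adj (u 0) w ∧ ∀ i, i < m → u i ≠ w)).card := by
  rw [← SimpleGraph.card_neighborFinset_eq_degree]
  refine le_trans (Finset.card_le_card (t := (((Finset.range (m - 1)).filter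
    (fun k => (G a).Adj (u 0) (u (k + 1)))).image (fun k => u (k + 1))) ∪ _) ?_)
    ((Finset.card_union_le _ _).trans (Nat.add_le_add_right Finset.card_image_le _))
  intro w hw
  rw [SimpleGraph.mem_neighborFinset] at hw
  simp only [Finset.mem_union, Finset.mem_image, Finset.mem_filter, Finset.mem_range,
    Finset.mem_univ, true_and]
  by_cases hx : ∀ i, i < m → u i ≠ w
  · exact Or.inr ⟨hw, hx⟩
  · push Not at hx
    obtain ⟨i, hi, rfl⟩ := hx
    have : i ≠ 0 := by rintro rfl; exact hw.ne rfl
    obtain ⟨k, rfl⟩ := Nat.exists_eq_succ_of_ne_zero this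
    exact Or.inl ⟨k, ⟨by omega, hw⟩, rfl⟩

open Classical in
lemma RP.deg_last {m : ℕ} {u : ℕ → V} {c : ℕ → ι} (_h : RP G m u c) (_hm : 1 ≤ m) (b : ι) :
    (G b).degree (u (m - 1)) ≤
      ((Finset.range (m - 1)).filter (fun k => (G b).Adj (u k) (u (m - 1)))).card +
      (Finset.univ.filter (fun w => (G b).Adj (u (m - 1)) w ∧ ∀ i, i < m → u i ≠ w)).card := by
  rw [← SimpleGraph.card_neighborFinset_eq_degree]
  refine le_trans (Finset.card_le_card (t := (((Finset.range (m - 1)).filter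
    (fun k => (G b).Adj (u k) (u (m - 1)))).image (fun k => u k)) ∪ _) ?_)
    ((Finset.card_union_le _ _).trans (Nat.add_le_add_right Finset.card_image_le _))
  intro w hw
  rw [SimpleGraph.mem_neighborFinset] at hw
  simp only [Finset.mem_union, Finset.mem_image, Finset.mem_filter, Finset.mem_range,
    Finset.mem_univ, true_and]
  by_cases hx : ∀ i, i < m → u i ≠ w
  · exact Or.inr ⟨hw, hx⟩
  · push Not at hx
    obtain ⟨i, hi, rfl⟩ := hx
    have : i ≠ m - 1 := by rintro rfl; exact hw.ne rfl
    exact Or.inl ⟨i, ⟨by omega, hw.symm⟩, rfl⟩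

/-- every colour has an edge across each cut -/
lemma cut {n : ℕ} (hV : Fintype.card V = n)
    (hσ : ∀ u v : V, u ≠ v → (∃ i, ¬ (G i).Adj u v) →
      ∀ p q, n ≤ (G p).degree u + (G q).degree v)
    (S : Finset V) (z w : V) (hz : z ∈ S) (hw : w ∉ S) (s : ι) :
    ∃ z ∈ S, ∃ w, w ∉ S ∧ (G s).Adj z w := by
  classical
  by_contra hcon
  push Not at hcon
  have h1 := hσ z w (by rintro rfl; exact hw hz) ⟨s, hcon z hz w hw⟩ s s
  have h2 : (G s).degree z < S.card := by
    rw [← SimpleGraph.card_neighborFinset_eq_degree]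
    apply Finset.card_lt_card
    rw [Finset.ssubset_iff_of_subset]
    · exact ⟨z, hz, by simp⟩
    · intro y hy
      rw [SimpleGraph.mem_neighborFinset] at hy
      by_contra hyS
      exact hcon z hz y hyS hy
  have h3 : (G s).degree w < Sᶜ.card := by
    rw [← SimpleGraph.card_neighborFinset_eq_degree]
    apply Finset.card_lt_card
    rw [Finset.ssubset_iff_of_subset]
    · exact ⟨w, by simpa using hw, by simp⟩
    · intro y hy
      rw [SimpleGraph.mem_neighborFinset] at hy
      rw [Finset.mem_compl]
      intro hyS
      exact hcon y hyS w hw hy.symm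
  have := Finset.card_add_card_compl S
  omega

lemma exists_spare [Fintype ι] (s : Finset ι) (h : s.card < Fintype.card ι) : ∃ a, a ∉ s := by
  by_contra hcon
  push Not at hcon
  have : s = Finset.univ := Finset.eq_univ_iff_forall.2 hcon
  rw [this, Finset.card_univ] at h
  omega

lemma RC.extend {n m : ℕ} [Fintype ι] (hι : Fintype.card ι = n) (hV : Fintype.card V = n)
    (hσ : ∀ u v : V, u ≠ v → (∃ i, ¬ (G i).Adj u v) →
      ∀ p q, n ≤ (G p).degree u + (G q).degree v)
    {v : ℕ → V} {c : ℕ → ι} (h : RC G m v c) (hm : 1 ≤ m) (hmn : m < n) {x : V} {i : ℕ}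
    (hx : v i = x) : ∃ u c', RP G (m + 1) u c' ∧ ∃ i, i < m + 1 ∧ u i = x := by
  classical
  obtain ⟨s, hs⟩ := exists_spare ((Finset.range m).image c)
    (lt_of_le_of_lt Finset.card_image_le (by simp; omega))
  obtain ⟨w, hw⟩ := exists_spare ((Finset.range m).image v)
    (lt_of_le_of_lt Finset.card_image_le (by simp; omega))
  have hmod : ∀ i, v i ∈ (Finset.range m).image v := fun i =>
    Finset.mem_image.2 ⟨i % m, Finset.mem_range.2 (Nat.mod_lt _ hm), by rw [h.vinj]; simp⟩
  have hcmod : ∀ i, c i ∈ (Finset.range m).image c := fun i =>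
    Finset.mem_image.2 ⟨i % m, Finset.mem_range.2 (Nat.mod_lt _ hm), by rw [h.cinj]; simp⟩
  obtain ⟨z, hz, w, hw, hzw⟩ := cut hV hσ _ (v 0) w (hmod 0) hw s
  obtain ⟨k, -, rfl⟩ := Finset.mem_image.1 hz
  have h1 := ((h.rot (k + 1)).path le_rfl).append (s := s) (w := w) hm
    (fun i _ e => hs (e ▸ hcmod _)) (fun i _ e => hw (e ▸ hmod _)) (by
      have : v (k + 1 + (m - 1)) = v k := by
        rw [h.vinj]
        have : k + 1 + (m - 1) = k + m := by omega
        rw [this]; simp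
      try simp only
      rw [this]; exact hzw)
  refine ⟨_, _, h1, (i + (m - 1) * (k + 1)) % m, ?_, ?_⟩
  · have := Nat.mod_lt (i + (m - 1) * (k + 1)) hm
    omega
  · try simp only
    rw [if_pos (Nat.mod_lt _ hm), ← hx, h.vinj]
    rw [Nat.add_mod_mod]
    obtain ⟨m, rfl⟩ := Nat.exists_eq_add_of_le' hm
    have : k + 1 + (i + (m + 1 - 1) * (k + 1)) = i + (m + 1) * (k + 1) := by
      simp only [Nat.add_sub_cancel]; ring
    rw [this]; simp

lemma two_spare [Fintype ι] (s : Finset ι) (h : s.card + 1 < Fintype.card ι) :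
    ∃ a b, a ≠ b ∧ a ∉ s ∧ b ∉ s := by
  classical
  obtain ⟨a, ha⟩ := exists_spare s (by omega)
  obtain ⟨b, hb⟩ := exists_spare (insert a s)
    (lt_of_le_of_lt (Finset.card_insert_le _ _) h)
  rw [Finset.mem_insert, not_or] at hb
  exact ⟨a, b, fun e => hb.1 e.symm, ha, hb.2⟩

lemma RP.two_spare {m : ℕ} [Fintype ι] {u : ℕ → V} {c : ℕ → ι} (_h : RP G m u c)
    (hm : 1 ≤ m) (hι : m < Fintype.card ι) :
    ∃ a b, a ≠ b ∧ (∀ i, i + 1 < m → c i ≠ a) ∧ (∀ i, i + 1 < m → c i ≠ b) := by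
  classical
  obtain ⟨a, b, hab, ha, hb⟩ := _root_.two_spare ((Finset.range (m - 1)).image c)
    (lt_of_le_of_lt (Nat.add_le_add_right Finset.card_image_le 1) (by simp; omega))
  refine ⟨a, b, hab, fun i hi e => ha ?_, fun i hi e => hb ?_⟩ <;>
  exact Finset.mem_image.2 ⟨i, Finset.mem_range.2 (by omega), e⟩

lemma RP.extend {n m : ℕ} [Fintype ι] (hι : Fintype.card ι = n) (hV : Fintype.card V = n)
    (hσ : ∀ u v : V, u ≠ v → (∃ i, ¬ (G i).Adj u v) →
      ∀ p q, n ≤ (G p).degree u + (G q).degree v)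
    {u : ℕ → V} {c : ℕ → ι} (h : RP G m u c) (hm : 2 ≤ m) (hmn : m < n) {x : V} {j : ℕ}
    (hj : j < m) (hx : u j = x) : ∃ u c', RP G (m + 1) u c' ∧ ∃ i, i < m + 1 ∧ u i = x := by
  classical
  obtain ⟨a, b, hab, ha, hb⟩ := h.two_spare (by omega) (hι ▸ hmn)
  by_cases hB : ∃ w, (G b).Adj (u (m - 1)) w ∧ ∀ i, i < m → u i ≠ w
  · obtain ⟨w, hw, hw'⟩ := hB
    refine ⟨_, _, h.append (by omega) hb hw' hw, j, by omega, ?_⟩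
    simp [hj, hx]
  by_cases hA : ∃ w, (G a).Adj (u 0) w ∧ ∀ i, i < m → u i ≠ w
  · obtain ⟨w, hw, hw'⟩ := hA
    refine ⟨_, _, h.rev.append (s := a) (w := w) (by omega) (fun i hi => ha _ (by omega))
      (fun i hi => hw' _ (by omega)) (by simpa using hw), m - 1 - j, by omega, ?_⟩
    try simp only
    rw [if_pos (by omega), ← hx]
    congr 1; omega
  by_cases hc : ∃ k, k + 1 < m ∧ (G a).Adj (u 0) (u (k + 1)) ∧ (G b).Adj (u k) (u (m - 1))
  · obtain ⟨k, hk, h1, h2⟩ := hc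
    obtain ⟨v, c', hv, i, hi⟩ := h.cross_close hk hab ha hb h1 h2 hj
    exact hv.extend hι hV hσ (by omega) hmn (hi.trans hx)
  by_cases hadj : (G a).Adj (u (m - 1)) (u 0)
  · exact (h.close (by omega) ha hadj).extend (i := j) hι hV hσ (by omega) hmn
      (by simp [Nat.mod_eq_of_lt hj, hx])
  exfalso
  have h0 : u 0 ≠ u (m - 1) := fun e => by
    have := h.vinj _ _ (by omega) (by omega) e
    omega
  have h1 := hσ _ _ h0 ⟨a, fun e => hadj e.symm⟩ a b
  have h2 := h.deg_first (by omega) a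
  have h3 := h.deg_last (by omega) b
  rw [Finset.filter_eq_empty_iff.2 (fun w _ hw => hA ⟨w, hw⟩), Finset.card_empty] at h2
  rw [Finset.filter_eq_empty_iff.2 (fun w _ hw => hB ⟨w, hw⟩), Finset.card_empty] at h3
  have h4 : Disjoint ((Finset.range (m - 1)).filter (fun k => (G a).Adj (u 0) (u (k + 1))))
      ((Finset.range (m - 1)).filter (fun k => (G b).Adj (u k) (u (m - 1)))) := by
    rw [Finset.disjoint_filter]
    intro k hk h1 h2
    rw [Finset.mem_range] at hk
    exact hc ⟨k, by omega, h1, h2⟩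
  have h5 := Finset.card_union_of_disjoint h4
  have h6 := Finset.card_le_card (Finset.union_subset
    (Finset.filter_subset (fun k => (G a).Adj (u 0) (u (k + 1))) (Finset.range (m - 1)))
    (Finset.filter_subset (fun k => (G b).Adj (u k) (u (m - 1))) (Finset.range (m - 1))))
  rw [Finset.card_range] at h6
  omega

lemma exists_path {n : ℕ} [Fintype ι] (hι : Fintype.card ι = n) (hV : Fintype.card V = n)
    (hσ : ∀ u v : V, u ≠ v → (∃ i, ¬ (G i).Adj u v) →
      ∀ p q, n ≤ (G p).degree u + (G q).degree v) (x : V) (m : ℕ) (hmn : m + 2 ≤ n) :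
    ∃ u c, RP G (m + 2) u c ∧ ∃ i, i < m + 2 ∧ u i = x := by
  classical
  induction m with
  | zero =>
    obtain ⟨s, -⟩ := exists_spare (∅ : Finset ι) (by simp; omega)
    obtain ⟨w, hw⟩ := exists_spare ({x} : Finset V) (by simp; omega)
    obtain ⟨z, hz, w, hw, hzw⟩ := cut hV hσ {x} x w (by simp) hw s
    rw [Finset.mem_singleton] at hz hw
    subst hz
    have h0 : RP G 1 (fun _ => z) (fun _ => s) := ⟨by intros; omega, by intros; omega, by intros; omega⟩
    refine ⟨_, _, h0.append le_rfl (by intros; omega) (fun i _ e => hw e.symm) hzw, 0, by omega, ?_⟩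
    simp
  | succ m ih =>
    obtain ⟨u, c, h, i, hi, hx⟩ := ih (by omega)
    exact h.extend hι hV hσ (by omega) (by omega) hi hx

lemma key {m : ℕ} (hm : 2 ≤ m) (hV : Fintype.card V = m + 1)
    (hσ : ∀ u v : V, u ≠ v → (∃ i, ¬ (G i).Adj u v) →
      ∀ p q, m + 1 ≤ (G p).degree u + (G q).degree v) {x : V}
    (hno : ∀ v c, RC G m v c → ∀ i, v i ≠ x)
    {u : ℕ → V} {c : ℕ → ι} (h : RP G m u c) {j : ℕ}
    (hj : j < m) (hx : u j = x) {a b : ι} (hab : a ≠ b)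
    (ha : ∀ i, i + 1 < m → c i ≠ a) (hb : ∀ i, i + 1 < m → c i ≠ b) :
    (∀ w, (∀ i, i < m → u i ≠ w) → (G a).Adj (u 0) w ∧ (G b).Adj (u (m - 1)) w) ∧
    (¬ (G a).Adj (u 0) (u (m - 1))) ∧
    ∀ k, k + 1 < m → ((G a).Adj (u 0) (u (k + 1)) ↔ ¬ (G b).Adj (u k) (u (m - 1))) := by
  classical
  have hc : ∀ k, k + 1 < m → (G a).Adj (u 0) (u (k + 1)) → ¬ (G b).Adj (u k) (u (m - 1)) := by
    intro k hk h1 h2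
    obtain ⟨v, c', hv, i, hi⟩ := h.cross_close hk hab ha hb h1 h2 hj
    exact hno _ _ hv i (hi.trans hx)
  have hadj : ¬ (G a).Adj (u (m - 1)) (u 0) := fun hadj =>
    hno _ _ (h.close (by omega) ha hadj) j (by simp [Nat.mod_eq_of_lt hj, hx])
  have h0 : u 0 ≠ u (m - 1) := fun e => by
    have := h.vinj _ _ (by omega) (by omega) e
    omega
  have h1 := hσ _ _ h0 ⟨a, fun e => hadj e.symm⟩ a b
  have h2 := h.deg_first (by omega) a
  have h3 := h.deg_last (by omega) b
  have hout : ∀ S : Finset V, (∀ w ∈ S, ∀ i, i < m → u i ≠ w) → S.card ≤ 1 := by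
    intro S hS
    have e1 : ((Finset.range m).image u).card = m := by
      rw [Finset.card_image_of_injOn, Finset.card_range]
      intro i hi j hj e
      exact h.vinj i j (by simpa using hi) (by simpa using hj) e
    have e2 : Disjoint S ((Finset.range m).image u) := by
      rw [Finset.disjoint_left]
      intro w hw hw'
      obtain ⟨i, hi, rfl⟩ := Finset.mem_image.1 hw'
      exact hS _ hw i (Finset.mem_range.1 hi) rfl
    have e3 := Finset.card_union_of_disjoint e2
    have e4 := Finset.card_le_univ (S ∪ (Finset.range m).image u)
    omega
  have h4 : Disjoint ((Finset.range (m - 1)).filter (fun k => (G a).Adj (u 0) (u (k + 1))))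
      ((Finset.range (m - 1)).filter (fun k => (G b).Adj (u k) (u (m - 1)))) := by
    rw [Finset.disjoint_filter]
    intro k hk h1 h2
    rw [Finset.mem_range] at hk
    exact hc k (by omega) h1 h2
  have h5 := Finset.card_union_of_disjoint h4
  have hsub := Finset.union_subset
    (Finset.filter_subset (fun k => (G a).Adj (u 0) (u (k + 1))) (Finset.range (m - 1)))
    (Finset.filter_subset (fun k => (G b).Adj (u k) (u (m - 1))) (Finset.range (m - 1)))
  have h6 := Finset.card_le_card hsub
  rw [Finset.card_range] at h6
  have h7 := hout (Finset.univ.filter (fun w => (G a).Adj (u 0) w ∧ ∀ i, i < m → u i ≠ w))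
    (fun w hw => (Finset.mem_filter.1 hw).2.2)
  have h8 := hout (Finset.univ.filter (fun w => (G b).Adj (u (m - 1)) w ∧ ∀ i, i < m → u i ≠ w))
    (fun w hw => (Finset.mem_filter.1 hw).2.2)
  have huniq : ∀ w w', (∀ i, i < m → u i ≠ w) → (∀ i, i < m → u i ≠ w') → w = w' := by
    intro w w' hw hw'
    by_contra hne
    have := hout {w, w'} (by
      intro y hy
      simp only [Finset.mem_insert, Finset.mem_singleton] at hy
      rcases hy with rfl | rfl
      · exact hw
      · exact hw')
    rw [Finset.card_pair hne] at this
    omega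
  refine ⟨fun w hw => ⟨?_, ?_⟩, fun e => hadj e.symm, fun k hk => ⟨hc k hk, fun hB => ?_⟩⟩
  · obtain ⟨w', hw'⟩ := Finset.card_pos.1 (show 0 < (Finset.univ.filter
      (fun w => (G a).Adj (u 0) w ∧ ∀ i, i < m → u i ≠ w)).card by omega)
    rw [Finset.mem_filter] at hw'
    rw [huniq w w' hw hw'.2.2]
    exact hw'.2.1
  · obtain ⟨w', hw'⟩ := Finset.card_pos.1 (show 0 < (Finset.univ.filter
      (fun w => (G b).Adj (u (m - 1)) w ∧ ∀ i, i < m → u i ≠ w)).card by omega)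
    rw [Finset.mem_filter] at hw'
    rw [huniq w w' hw hw'.2.2]
    exact hw'.2.1
  · have e := Finset.eq_of_subset_of_card_le hsub (by rw [Finset.card_range]; omega)
    have : k ∈ Finset.range (m - 1) := by rw [Finset.mem_range]; omega
    rw [← e, Finset.mem_union, Finset.mem_filter, Finset.mem_filter] at this
    rcases this with h | h
    · exact h.2
    · exact absurd h.2 hB

/-- key lemma for a rainbow Hamilton cycle, at the vertex `v i ≠ x` -/
lemma keyC {m : ℕ} (hm : 2 ≤ m) (hV : Fintype.card V = m + 1)
    (hσ : ∀ u v : V, u ≠ v → (∃ i, ¬ (G i).Adj u v) →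
      ∀ p q, m + 1 ≤ (G p).degree u + (G q).degree v) {x : V}
    (hno : ∀ v c, RC G m v c → ∀ i, v i ≠ x)
    {v : ℕ → V} {c : ℕ → ι} (h : RC G (m + 1) v c) (hx : v 0 = x) {i : ℕ} (hi : 1 ≤ i)
    (him : i ≤ m) {a b : ι} (hab : (a = c i ∧ b = c (i + m)) ∨ (b = c i ∧ a = c (i + m))) :
    (G a).Adj (v (i + 1)) (v i) ∧ (G b).Adj (v (i + m)) (v i) ∧
    (¬ (G a).Adj (v (i + 1)) (v (i + m))) ∧
    ∀ k, k + 1 < m → ((G a).Adj (v (i + 1)) (v (i + 1 + (k + 1))) ↔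
      ¬ (G b).Adj (v (i + 1 + k)) (v (i + m))) := by
  have hc : ∀ k l, k ≤ m → l ≤ m → c (i + k) = c (i + l) → k = l := by
    intro k l hk hl e
    rw [h.cinj, add_mod_cancel, Nat.mod_eq_of_lt (by omega), Nat.mod_eq_of_lt (by omega)] at e
    exact e
  have hv : ∀ k l, k ≤ m → l ≤ m → v (i + k) = v (i + l) → k = l := by
    intro k l hk hl e
    rw [h.vinj, add_mod_cancel, Nat.mod_eq_of_lt (by omega), Nat.mod_eq_of_lt (by omega)] at e
    exact e
  have n1 : c i ≠ c (i + m) := fun e => by have := hc 0 m (by omega) le_rfl e; omega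
  have n2 : ∀ k, k + 1 < m → c (i + 1 + k) ≠ c i := fun k hk e => by
    have := hc (1 + k) 0 (by omega) (by omega) (by rw [← add_assoc]; exact e); omega
  have n3 : ∀ k, k + 1 < m → c (i + 1 + k) ≠ c (i + m) := fun k hk e => by
    have := hc (1 + k) m (by omega) (by omega) (by rw [← add_assoc]; exact e); omega
  have n4 : ∀ k, k < m → v (i + 1 + k) ≠ v i := fun k hk e => by
    have := hv (1 + k) 0 (by omega) (by omega) (by rw [← add_assoc]; exact e); omega
  have hp := (h.rot (i + 1)).path (l := m) (by omega)
  have hxx : v (i + 1 + (m - i)) = x := by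
    rw [← hx, h.vinj]
    have : i + 1 + (m - i) = m + 1 := by omega
    rw [this]; simp
  have e1 : i + 1 + (m - 1) = i + m := by omega
  have hk : a ≠ b ∧ (∀ k, k + 1 < m → c (i + 1 + k) ≠ a) ∧ (∀ k, k + 1 < m → c (i + 1 + k) ≠ b) := by
    rcases hab with ⟨rfl, rfl⟩ | ⟨rfl, rfl⟩
    · exact ⟨n1, n2, n3⟩
    · exact ⟨n1.symm, n3, n2⟩
  have := key hm hV hσ hno hp (j := m - i) (by omega) hxx hk.1 hk.2.1 hk.2.2
  simp only [e1, add_zero] at this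
  exact ⟨(this.1 _ n4).1, (this.1 _ n4).2, this.2.1, this.2.2⟩

lemma exists_ham {m : ℕ} (hm : 2 ≤ m) [Fintype ι] (hι : Fintype.card ι = m + 1)
    (hV : Fintype.card V = m + 1)
    (hσ : ∀ u v : V, u ≠ v → (∃ i, ¬ (G i).Adj u v) →
      ∀ p q, m + 1 ≤ (G p).degree u + (G q).degree v) {x : V}
    (hno : ∀ v c, RC G m v c → ∀ i, v i ≠ x) :
    ∃ v c, RC G (m + 1) v c ∧ v 0 = x := by
  classical
  obtain ⟨m, rfl⟩ := Nat.exists_eq_add_of_le' hm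
  obtain ⟨u, c, h, j, hj, hx⟩ := exists_path hι hV hσ x m (by omega)
  obtain ⟨a, b, hab, ha, hb⟩ := h.two_spare (by omega) (by omega)
  obtain ⟨w, hw⟩ := exists_spare ((Finset.range (m + 2)).image u)
    (lt_of_le_of_lt Finset.card_image_le (by simp; omega))
  have hw' : ∀ i, i < m + 2 → u i ≠ w := fun i hi e =>
    hw (Finset.mem_image.2 ⟨i, Finset.mem_range.2 hi, e⟩)
  obtain ⟨h1, h2⟩ := (key hm hV hσ hno h hj hx hab ha hb).1 w hw'
  have h3 := (h.append (by omega) hb hw' h2).close (a := a) (by omega) (by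
    intro i hi
    try simp only
    split_ifs with h4
    · exact ha _ h4
    · exact hab.symm) (by
    try simp only
    rw [if_neg (by omega), if_pos (by omega)]
    exact h1.symm)
  refine ⟨_, _, h3.rot j, ?_⟩
  try simp only
  rw [add_zero, Nat.mod_eq_of_lt (by omega), if_pos hj, hx]

lemma RC.swap {n : ℕ} {v : ℕ → V} {c : ℕ → ι} (h : RC G (n + 1) v c) {i : ℕ} (hi : i + 1 ≤ n)
    (h1 : (G (c i)).Adj (v (i + 1)) (v (i + 2))) (h2 : (G (c (i + 1))).Adj (v i) (v (i + 1))) :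
    RC G (n + 1) v (fun j => c (Equiv.swap i (i + 1) (j % (n + 1)))) where
  vinj := h.vinj
  cinj j k := by
    have hlt : ∀ j, j < n + 1 → Equiv.swap i (i + 1) j < n + 1 := by
      intro j hj
      rw [Equiv.swap_apply_def]
      split_ifs <;> omega
    rw [h.cinj, Nat.mod_eq_of_lt (hlt _ (Nat.mod_lt _ (by omega))),
      Nat.mod_eq_of_lt (hlt _ (Nat.mod_lt _ (by omega)))]
    exact (Equiv.swap i (i + 1)).injective.eq_iff
  adj j := by
    have e1 : v j = v (j % (n + 1)) := by rw [h.vinj]; simp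
    have e2 : v (j + 1) = v (j % (n + 1) + 1) := by rw [h.vinj]; simp
    try simp only
    rw [e1, e2]
    generalize j % (n + 1) = r
    rw [Equiv.swap_apply_def]
    split_ifs with h3 h4
    · rw [h3]; exact h2
    · rw [h4]; exact h1
    · exact h.adj r

lemma all_edges {m : ℕ} (hm : 2 ≤ m) [Fintype ι] (hι : Fintype.card ι = m + 1)
    (hV : Fintype.card V = m + 1)
    (hσ : ∀ u v : V, u ≠ v → (∃ i, ¬ (G i).Adj u v) →
      ∀ p q, m + 1 ≤ (G p).degree u + (G q).degree v) {x : V}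
    (hno : ∀ v c, RC G m v c → ∀ i, v i ≠ x)
    {v : ℕ → V} {c : ℕ → ι} (h : RC G (m + 1) v c) (hx : v 0 = x) (q : ι) (j : ℕ) :
    (G q).Adj (v j) (v (j + 1)) := by
  classical
  have hsw : ∀ c : ℕ → ι, RC G (m + 1) v c → ∀ i, i + 1 ≤ m →
      RC G (m + 1) v (fun j => c (Equiv.swap i (i + 1) (j % (m + 1)))) := by
    intro c h i hi
    have e1 : v (i + 1 + m) = v i := by
      rw [h.vinj, show i + 1 + m = i + (m + 1) by ring]; simp
    have e2 : c (i + 1 + m) = c i := by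
      rw [h.cinj, show i + 1 + m = i + (m + 1) by ring]; simp
    have h1 := keyC hm hV hσ hno h hx (i := i + 1) (by omega) hi (Or.inr ⟨rfl, rfl⟩)
    rw [e1, e2] at h1
    exact h.swap hi h1.1.symm h1.2.1
  have hstep : ∀ i, i + 1 ≤ m →
      ((∃ c, RC G (m + 1) v c ∧ c i = q) ↔ (∃ c, RC G (m + 1) v c ∧ c (i + 1) = q)) := by
    intro i hi
    constructor
    · rintro ⟨c, hc, e⟩
      refine ⟨_, hsw c hc i hi, ?_⟩
      try simp only
      rw [Nat.mod_eq_of_lt (by omega), Equiv.swap_apply_right, e]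
    · rintro ⟨c, hc, e⟩
      refine ⟨_, hsw c hc i hi, ?_⟩
      try simp only
      rw [Nat.mod_eq_of_lt (by omega), Equiv.swap_apply_left, e]
  have hall : ∀ i, i ≤ m →
      ((∃ c, RC G (m + 1) v c ∧ c 0 = q) ↔ (∃ c, RC G (m + 1) v c ∧ c i = q)) := by
    intro i
    induction i with
    | zero => intro _; rfl
    | succ i ih => intro hi; rw [ih (by omega), hstep i hi]
  have hq : ∃ i, i ≤ m ∧ c i = q := by
    have e1 : ((Finset.range (m + 1)).image c) = Finset.univ := by
      apply Finset.eq_univ_of_card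
      rw [Finset.card_image_of_injOn, Finset.card_range, hι]
      intro i hi j hj e
      rw [h.cinj, Nat.mod_eq_of_lt (by simpa using hi), Nat.mod_eq_of_lt (by simpa using hj)] at e
      exact e
    have := Finset.mem_univ q
    rw [← e1, Finset.mem_image] at this
    obtain ⟨i, hi, e⟩ := this
    exact ⟨i, by rw [Finset.mem_range] at hi; omega, e⟩
  obtain ⟨i, hi, e⟩ := hq
  have h0 := (hall i hi).2 ⟨c, h, e⟩
  obtain ⟨c', hc', e'⟩ := (hall (j % (m + 1))
    (Nat.le_of_lt_succ (Nat.mod_lt _ (by omega)))).1 h0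
  have := hc'.adj (j % (m + 1))
  rw [e'] at this
  have e1 : v j = v (j % (m + 1)) := by rw [h.vinj]; simp
  have e2 : v (j + 1) = v (j % (m + 1) + 1) := by rw [h.vinj]; simp
  rw [e1, e2]; exact this

lemma rel {m : ℕ} (hm : 2 ≤ m) [Fintype ι] (hι : Fintype.card ι = m + 1)
    (hV : Fintype.card V = m + 1)
    (hσ : ∀ u v : V, u ≠ v → (∃ i, ¬ (G i).Adj u v) →
      ∀ p q, m + 1 ≤ (G p).degree u + (G q).degree v) {x : V}
    (hno : ∀ v c, RC G m v c → ∀ i, v i ≠ x)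
    {v : ℕ → V} {c : ℕ → ι} (h : RC G (m + 1) v c) (hx : v 0 = x) {a b : ι} (hab : a ≠ b)
    {i : ℕ} (hi : 1 ≤ i) (him : i ≤ m) :
    (¬ (G a).Adj (v (i + 1)) (v (i + m))) ∧
    ∀ k, k + 1 < m → ((G a).Adj (v (i + 1)) (v (i + 1 + (k + 1))) ↔
      ¬ (G b).Adj (v (i + 1 + k)) (v (i + m))) := by
  classical
  have hne : c i ≠ c (i + m) := by
    intro e
    have : (i + 0) % (m + 1) = (i + m) % (m + 1) := (h.cinj _ _).1 e
    rw [add_mod_cancel, Nat.mod_eq_of_lt (by omega), Nat.mod_eq_of_lt (by omega)] at this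
    omega
  set p1 := Equiv.swap (c i) a with hp1
  set p2 := Equiv.swap (p1 (c (i + m))) b with hp2
  have e1 : p1 (c i) = a := Equiv.swap_apply_left _ _
  have e2 : p2 (p1 (c (i + m))) = b := Equiv.swap_apply_left _ _
  have e3 : p2 a = a := by
    apply Equiv.swap_apply_of_ne_of_ne
    · rw [← e1]; exact fun e => hne (p1.injective e)
    · exact hab
  have h' : RC G (m + 1) v (fun j => p2 (p1 (c j))) :=
    ⟨h.vinj, fun i j => by
      rw [p2.injective.eq_iff, p1.injective.eq_iff]; exact h.cinj i j,
      fun j => all_edges hm hι hV hσ hno h hx _ j⟩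
  have := keyC hm hV hσ hno h' hx hi him (a := a) (b := b) (Or.inl ⟨by simp [e1, e3], by simp [e2]⟩)
  exact this.2.2

lemma parity {m : ℕ} (hm : 2 ≤ m) [Fintype ι] (hι : Fintype.card ι = m + 1)
    (hV : Fintype.card V = m + 1)
    (hσ : ∀ u v : V, u ≠ v → (∃ i, ¬ (G i).Adj u v) →
      ∀ p q, m + 1 ≤ (G p).degree u + (G q).degree v) {x : V}
    (hno : ∀ v c, RC G m v c → ∀ i, v i ≠ x)
    {v : ℕ → V} {c : ℕ → ι} (h : RC G (m + 1) v c) (hx : v 0 = x) (a : ι) (d : ℕ) :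
    ∀ r, 1 ≤ r → r + (d + 1) ≤ m + 1 → ((G a).Adj (v r) (v (r + (d + 1))) ↔ Odd (d + 1)) := by
  classical
  have hper : ∀ j, v (j + (m + 1)) = v j := fun j => by rw [h.vinj]; simp
  obtain ⟨b, hb⟩ := exists_spare ({a} : Finset ι) (by simp; omega)
  rw [Finset.mem_singleton] at hb
  have hab : a ≠ b := fun e => hb e.symm
  induction d using Nat.strong_induction_on with
  | _ d ih =>
    intro r hr hrd
    match d, ih, hrd with
    | 0, _, hrd =>
      have := all_edges hm hι hV hσ hno h hx a r
      simpa using this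
    | 1, _, hrd =>
      have := (rel hm hι hV hσ hno h hx hab (i := r + 1) (by omega) (by omega)).1
      rw [show r + 1 + m = r + (m + 1) by ring, hper] at this
      constructor
      · intro e; exact absurd e.symm this
      · intro e; exact absurd e (by decide)
    | d + 2, ih, hrd =>
      have h1 := (rel hm hι hV hσ hno h hx hab (i := r) hr (by omega)).2 d (by omega)
      have h2 := (rel hm hι hV hσ hno h hx hab (i := r + d + 2) (by omega) (by omega)).2
        (m - d - 3) (by omega)
      have h3 := ih d (by omega) (r + 1) (by omega) (by omega)
      obtain ⟨r, rfl⟩ := Nat.exists_eq_add_of_le' hr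
      rw [show r + 1 + d + 2 + 1 + (m - d - 3 + 1) = (r + 1) + (m + 1) by omega, hper,
        show r + 1 + d + 2 + 1 + (m - d - 3) = r + (m + 1) by omega, hper,
        show r + 1 + d + 2 + m = r + 1 + 1 + d + (m + 1) by omega, hper,
        SimpleGraph.adj_comm, SimpleGraph.adj_comm (G b)] at h2
      rw [show r + 1 + m = r + (m + 1) by ring, hper] at h1
      rw [show r + 1 + (d + 2 + 1) = r + 1 + d + 2 + 1 by ring, h2, ← h1, h3]
      simp only [Nat.odd_iff]
      omega

lemma final {m : ℕ} (hm : 2 ≤ m) [Fintype ι] (hι : Fintype.card ι = m + 1)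
    (hV : Fintype.card V = m + 1)
    (hσ : ∀ u v : V, u ≠ v → (∃ i, ¬ (G i).Adj u v) →
      ∀ p q, m + 1 ≤ (G p).degree u + (G q).degree v) {x : V}
    (hno : ∀ v c, RC G m v c → ∀ i, v i ≠ x) :
    Even (m + 1) ∧ ∃ A : Finset V, 2 * A.card = m + 1 ∧
      ∀ (i : ι) (u v : V), (G i).Adj u v ↔
        ((u ∈ A ∧ v ∉ A) ∨ (u ∉ A ∧ v ∈ A)) := by
  classical
  obtain ⟨v, c, h, hx⟩ := exists_ham hm hι hV hσ hno
  have hper : ∀ j, v (j + (m + 1)) = v j := fun j => by rw [h.vinj]; simp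
  have hpar := parity hm hι hV hσ hno h hx
  obtain ⟨a, -⟩ := exists_spare (∅ : Finset ι) (by simp; omega)
  have hev : Even (m + 1) := by
    have h1 := hpar a (m - 1) 1 le_rfl (by omega)
    have h2 := all_edges hm hι hV hσ hno h hx a 0
    rw [show 1 + (m - 1 + 1) = 0 + (m + 1) by omega, hper] at h1
    have := h1.1 h2.symm
    rw [Nat.odd_iff] at this
    rw [Nat.even_iff]; omega
  refine ⟨hev, ?_⟩
  obtain ⟨t, ht⟩ := hev
  have hmem : ∀ s, v s ∈ (Finset.range t).image (fun i => v (2 * i)) ↔ Even s := by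
    intro s
    rw [Finset.mem_image]
    have hpm : s % (m + 1) % 2 = s % 2 := Nat.mod_mod_of_dvd _ ⟨t, by omega⟩
    constructor
    · rintro ⟨i, hi, e⟩
      rw [Finset.mem_range] at hi
      rw [h.vinj, Nat.mod_eq_of_lt (by omega)] at e
      rw [Nat.even_iff]; omega
    · intro hs
      rw [Nat.even_iff] at hs
      have := Nat.mod_lt s (show m + 1 > 0 by omega)
      refine ⟨s % (m + 1) / 2, by rw [Finset.mem_range]; omega, ?_⟩
      rw [show 2 * (s % (m + 1) / 2) = s % (m + 1) by omega, h.vinj]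
      simp
  have hsurj : ∀ z, ∃ r, 1 ≤ r ∧ r ≤ m + 1 ∧ v r = z := by
    intro z
    have e1 : ((Finset.range (m + 1)).image v) = Finset.univ := by
      apply Finset.eq_univ_of_card
      rw [Finset.card_image_of_injOn, Finset.card_range, hV]
      intro i hi j hj e
      rw [h.vinj, Nat.mod_eq_of_lt (by simpa using hi), Nat.mod_eq_of_lt (by simpa using hj)] at e
      exact e
    have := Finset.mem_univ z
    rw [← e1, Finset.mem_image] at this
    obtain ⟨i, hi, e⟩ := this
    rw [Finset.mem_range] at hi
    rcases Nat.eq_zero_or_pos i with rfl | h0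
    · exact ⟨m + 1, by omega, le_rfl, by rw [← e, ← hper 0, zero_add]⟩
    · exact ⟨i, h0, by omega, e⟩
  refine ⟨(Finset.range t).image (fun i => v (2 * i)), ?_, ?_⟩
  · rw [Finset.card_image_of_injOn, Finset.card_range]
    · omega
    · intro i hi j hj e
      have hi' : i < t := by simpa using hi
      have hj' : j < t := by simpa using hj
      try simp only at e
      rw [h.vinj, Nat.mod_eq_of_lt (by omega), Nat.mod_eq_of_lt (by omega)] at e
      omega
  · intro i y z
    obtain ⟨r, hr, hr', rfl⟩ := hsurj y
    obtain ⟨s, hs, hs', rfl⟩ := hsurj z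
    rw [hmem, hmem]
    simp only [Nat.even_iff]
    rcases lt_trichotomy r s with hlt | rfl | hlt
    · have := hpar i (s - r - 1) r hr (by omega)
      rw [show r + (s - r - 1 + 1) = s by omega, Nat.odd_iff] at this
      rw [this]; omega
    · have : ¬ (G i).Adj (v r) (v r) := (G i).loopless.irrefl _
      simp only [this, false_iff]; omega
    · have := hpar i (r - s - 1) s hs (by omega)
      rw [show s + (r - s - 1 + 1) = r by omega, Nat.odd_iff] at this
      rw [SimpleGraph.adj_comm, this]; omega

end helpers

lemma RC.through {V ι : Type*} {G : ι → SimpleGraph V} {m : ℕ} (hm : 2 ≤ m) {v : ℕ → V} {c : ℕ → ι} (h : RC G m v c) {x : V} {i : ℕ}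
    (hx : v i = x) : HasRainbowCycleThrough G m x := by
  have : NeZero m := ⟨by omega⟩
  have : Fact (1 < m) := ⟨hm⟩
  have hv : ∀ j : ZMod m, j.val % m = j.val := fun j => Nat.mod_eq_of_lt (ZMod.val_lt j)
  refine ⟨fun j => v j.val, fun j => c j.val, ⟨?_, ?_, ?_⟩, (i : ZMod m), ?_⟩
  · intro j k e
    have := (h.vinj _ _).1 e
    rw [hv, hv] at this
    exact ZMod.val_injective m this
  · intro j k e
    have := (h.cinj _ _).1 e
    rw [hv, hv] at this
    exact ZMod.val_injective m this
  · intro j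
    have : v (j + 1).val = v (j.val + 1) := by
      rw [h.vinj, ZMod.val_add, ZMod.val_one]; simp
    try simp only
    rw [this]; exact h.adj _
  · try simp only
    rw [← hx, h.vinj, ZMod.val_natCast]; simp


theorem stmt3 {V : Type*} [Fintype V] {n : ℕ} (hn : 3 ≤ n)
    (hV : Fintype.card V = n)
    (G : ZMod n → SimpleGraph V) [∀ i, DecidableRel (G i).Adj]
    (hσ : ∀ u v : V, u ≠ v → (∃ i, ¬ (G i).Adj u v) →
      ∀ p q, n ≤ (G p).degree u + (G q).degree v) :
    (∀ x : V, HasRainbowCycleThrough G (n - 1) x) ∨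
    (Even n ∧ ∃ A : Finset V, 2 * A.card = n ∧
      ∀ (i : ZMod n) (u v : V), (G i).Adj u v ↔
        ((u ∈ A ∧ v ∉ A) ∨ (u ∉ A ∧ v ∈ A))) := by
  obtain ⟨m, rfl⟩ := Nat.exists_eq_add_of_le' (show 1 ≤ n by omega)
  by_cases hall : ∀ x : V, HasRainbowCycleThrough G (m + 1 - 1) x
  · exact Or.inl hall
  · right
    push Not at hall
    obtain ⟨x, hx⟩ := hall
    exact final (by omega) (ZMod.card _) hV hσ (x := x)
      (fun v c h i e => hx (h.through (by omega) e))
end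

section
/- Let n ≥ 3 and let 𝒢 = {G_1, …, G_n} be a family of n graphs (not necessarily distinct) on a common vertex set V with |V| = n, and suppose σ(𝒢) ≥ n. If there exist vertices x, y ∈ V and indices a, b ∈ [n] such that xy ∈ E(G_b) but xy ∉ E(G_a), then 𝒢 contains a rainbow triangle containing both x and y. -/
theorem stmt4 {V : Type*} [Fintype V] {n : ℕ} (hn : 3 ≤ n)
    (hV : Fintype.card V = n)
    (G : ZMod n → SimpleGraph V) [∀ i, DecidableRel (G i).Adj]
    (hσ : ∀ u v : V, u ≠ v → (∃ i, ¬ (G i).Adj u v) →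
      ∀ p q, n ≤ (G p).degree u + (G q).degree v)
    (x y : V) (a b : ZMod n)
    (hxy : (G b).Adj x y) (hxy' : ¬ (G a).Adj x y) :
    ∃ (c : ZMod 3 → V) (φ : ZMod 3 → ZMod n),
      IsRainbowCycle G c φ ∧ (∃ i, c i = x) ∧ (∃ j, c j = y) := by
  classical
  have : NeZero n := ⟨by omega⟩
  have hab : a ≠ b := by
    rintro rfl
    exact hxy' hxy
  obtain ⟨d, hd⟩ : ∃ d : ZMod n, d ∉ ({a, b} : Finset (ZMod n)) := by
    by_contra! h
    have h1 : Fintype.card (ZMod n) ≤ ({a, b} : Finset (ZMod n)).card := by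
      rw [← Finset.card_univ]
      exact Finset.card_le_card fun z _ => h z
    have h2 : ({a, b} : Finset (ZMod n)).card ≤ 2 := Finset.card_le_two
    rw [ZMod.card] at h1
    omega
  simp only [Finset.mem_insert, Finset.mem_singleton, not_or] at hd
  have hne : x ≠ y := hxy.ne
  have hdeg := hσ x y hne ⟨a, hxy'⟩ a d
  obtain ⟨z, hz⟩ : ((G a).neighborFinset x ∩ (G d).neighborFinset y).Nonempty := by
    rw [← Finset.card_pos]
    have h1 := Finset.card_union_add_card_inter ((G a).neighborFinset x) ((G d).neighborFinset y)
    have h2 : ((G a).neighborFinset x ∪ (G d).neighborFinset y).card ≤ 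
        (Finset.univ.erase y).card := by
      apply Finset.card_le_card
      intro z hz
      simp only [Finset.mem_union, SimpleGraph.mem_neighborFinset] at hz
      simp only [Finset.mem_erase, Finset.mem_univ, and_true]
      rintro rfl
      rcases hz with hz | hz
      · exact hxy' hz
      · exact hz.ne rfl
    rw [Finset.card_erase_of_mem (Finset.mem_univ y), Finset.card_univ, hV] at h2
    simp only [SimpleGraph.card_neighborFinset_eq_degree] at h1
    omega
  simp only [Finset.mem_inter, SimpleGraph.mem_neighborFinset] at hz
  obtain ⟨hxz, hyz⟩ := hz
  have hxz' := hxz.ne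
  have hyz' := hyz.ne
  have key : ∀ {α : Type _} (p q r : α), p ≠ q → q ≠ r → p ≠ r →
      Function.Injective (![p, q, r] : Fin 3 → α) := by
    intro α p q r h1 h2 h3 i j hij
    fin_cases i <;> fin_cases j <;> simp_all
  have key' : ∀ {α : Type} (p q r : α), p ≠ q → q ≠ r → p ≠ r →
      Function.Injective (![p, q, r] : Fin 3 → α) := by
    intro α p q r h1 h2 h3 i j hij
    fin_cases i <;> fin_cases j <;> simp_all
  refine ⟨(![x, y, z] : Fin 3 → V), (![b, d, a] : Fin 3 → ZMod n),
    ⟨key x y z hne hyz' hxz', key' b d a (Ne.symm hd.2) hd.1 hab.symm, ?_⟩,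
    ⟨(0 : Fin 3), rfl⟩, ⟨(1 : Fin 3), rfl⟩⟩
  intro i
  change Fin 3 at i
  fin_cases i
  · exact hxy
  · exact hyz
  · exact hxz.symm
end

section
/- Let n ≥ 3 and let 𝒢 = {G_1, …, G_n} be a family of n graphs (not necessarily distinct) on a common vertex set V with |V| = n, with σ(𝒢) ≥ n. Let C_n = x_1 x_2 ⋯ x_n x_1 be a rainbow Hamiltonian cycle with x_i x_{i+1} ∈ E(G_i) for each i ∈ [n] (indices modulo n). If there is no rainbow cycle of length n − 1 in 𝒢 containing x_1, then every edge x_i x_{i+1} of C_n is a strong edge, i.e., x_i x_{i+1} ∈ E(G_j) for every j ∈ [n]. -/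
theorem hasRainbow_of_seq {V ι : Type*} (G : ι → SimpleGraph V) (m : ℕ) (y : ℕ → V) (f : ℕ → ι)
    (hy : ∀ s t, s ≤ m → t ≤ m → y s = y t → s = t)
    (hf : ∀ s t, s ≤ m → t ≤ m → f s = f t → s = t)
    (hadj : ∀ t, t < m → (G (f t)).Adj (y t) (y (t + 1)))
    (hlast : (G (f m)).Adj (y m) (y 0)) (v : V) (hv : ∃ t, t ≤ m ∧ y t = v) :
    HasRainbowCycleThrough G (m + 1) v := by
  refine ⟨fun t : Fin (m + 1) => y t.val, fun t : Fin (m + 1) => f t.val, ⟨?_, ?_, ?_⟩, ?_⟩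
  · intro s t h
    exact Fin.ext (hy _ _ (Nat.le_of_lt_succ (Fin.is_lt s)) (Nat.le_of_lt_succ (Fin.is_lt t)) h)
  · intro s t h
    exact Fin.ext (hf _ _ (Nat.le_of_lt_succ (Fin.is_lt s)) (Nat.le_of_lt_succ (Fin.is_lt t)) h)
  · have key : ∀ t : Fin (m + 1), (G (f t.val)).Adj (y t.val) (y (t + 1).val) := by
      intro t
      rw [Fin.val_add_one]
      split_ifs with h
      · subst h
        simpa using hlast
      · exact hadj _ (Fin.val_lt_last h)
    exact key
  · obtain ⟨t, ht, rfl⟩ := hv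
    exact ⟨(⟨t, Nat.lt_succ_of_le ht⟩ : Fin (m + 1)), rfl⟩

theorem key_lemma {V : Type*} [Fintype V] {m : ℕ}
    (G : ZMod (m + 2) → SimpleGraph V) [∀ i, DecidableRel (G i).Adj]
    (hσ : ∀ u v : V, u ≠ v → (∃ i, ¬ (G i).Adj u v) →
      ∀ p q, m + 2 ≤ (G p).degree u + (G q).degree v)
    (hm : 1 ≤ m)
    (c : ZMod (m + 2) → V) (hc : Function.Bijective c)
    (hCn : ∀ i : ZMod (m + 2), (G i).Adj (c i) (c (i + 1)))
    (hno : ¬ HasRainbowCycleThrough G (m + 1) (c 1)) (i : ZMod (m + 2)) (hi : i ≠ 1) :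
    (G i).Adj (c (i - 1)) (c i) ∧ (G (i - 1)).Adj (c i) (c (i + 1)) := by
  classical
  have hcast : ∀ s t : ℕ, s < m + 2 → t < m + 2 →
      i + (s : ZMod (m + 2)) = i + (t : ZMod (m + 2)) → s = t := by
    intro s t hs ht h
    have h2 := add_left_cancel h
    rw [ZMod.natCast_eq_natCast_iff'] at h2
    rwa [Nat.mod_eq_of_lt hs, Nat.mod_eq_of_lt ht] at h2
  have hval : ∀ z : ZMod (m + 2), ∃ t : ℕ, t < m + 2 ∧ i + (t : ZMod (m + 2)) = z := by
    intro z
    refine ⟨(z - i).val, ZMod.val_lt _, ?_⟩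
    simp
  have hm1 : i + ((m + 1 : ℕ) : ZMod (m + 2)) = i - 1 := by
    have : ((m + 2 : ℕ) : ZMod (m + 2)) = 0 := ZMod.natCast_self _
    push_cast at this ⊢
    linear_combination this
  obtain ⟨x, hx⟩ : ∃ x : ℕ → V, ∀ k, x k = c (i + (k : ZMod (m + 2))) := ⟨_, fun _ => rfl⟩
  have hxinj : ∀ s t : ℕ, s < m + 2 → t < m + 2 → x s = x t → s = t := by
    intro s t hs ht h
    rw [hx, hx] at h
    exact hcast s t hs ht (hc.1 h)
  have hxadj : ∀ k : ℕ, (G (i + (k : ZMod (m + 2)))).Adj (x k) (x (k + 1)) := by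
    intro k
    have := hCn (i + (k : ZMod (m + 2)))
    rw [hx, hx]
    push_cast
    rwa [← add_assoc]
  obtain ⟨k1, hk1, hk1e⟩ := hval 1
  have hk1x : x k1 = c 1 := by rw [hx, hk1e]
  have hk10 : k1 ≠ 0 := by
    rintro rfl
    apply hi
    simpa using hk1e
  -- the chord
  have hchord : ¬ (G i).Adj (x (m + 1)) (x 1) := by
    intro h
    apply hno
    refine hasRainbow_of_seq G m (fun t => x (t + 1))
      (fun t => i + ((if t < m then t + 1 else 0 : ℕ) : ZMod (m + 2))) ?_ ?_ ?_ ?_ _ ?_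
    · intro s t hs ht h
      have := hxinj _ _ (by omega) (by omega) h
      omega
    · intro s t hs ht h
      have := hcast _ _ (by split_ifs <;> omega) (by split_ifs <;> omega) h
      split_ifs at this <;> omega
    · intro t ht
      simp only [ht, if_true]
      exact hxadj (t + 1)
    · simpa using h
    · exact ⟨k1 - 1, by omega, by rw [← hk1x]; congr 1; omega⟩
  have hcross : ∀ k, k < m → ¬ ((G i).Adj (x (m + 1)) (x (k + 1)) ∧
      (G (i - 1)).Adj (x 1) (x (k + 2))) := by
    rintro k hk ⟨h1, h2⟩
    apply hno
    refine hasRainbow_of_seq G m (fun t => x (if t ≤ k then t + 1 else m + k + 2 - t))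
      (fun t => i + ((if t < k then t + 1 else if t = k then 0 else
        if t < m then m + k + 1 - t else m + 1 : ℕ) : ZMod (m + 2))) ?_ ?_ ?_ ?_ _ ?_
    · intro s t hs ht h
      have := hxinj _ _ (by split_ifs <;> omega) (by split_ifs <;> omega) h
      split_ifs at this <;> omega
    · intro s t hs ht h
      have := hcast _ _ (by split_ifs <;> omega) (by split_ifs <;> omega) h
      split_ifs at this <;> omega
    · intro t ht
      rcases lt_trichotomy t k with h | h | h
      · have e1 : t ≤ k := by omega
        have e2 : t + 1 ≤ k := by omega
        simp only [h, e1, e2, if_true]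
        exact hxadj (t + 1)
      · subst h
        have e2 : ¬ (t + 1 ≤ t) := by omega
        have e3 : m + t + 2 - (t + 1) = m + 1 := by omega
        simp only [lt_irrefl, le_refl, e2, e3, if_true, if_false, Nat.cast_zero, add_zero]
        exact h1.symm
      · have e0 : ¬ t < k := by omega
        have e1 : ¬ t ≤ k := by omega
        have e2 : ¬ (t + 1 ≤ k) := by omega
        have e3 : t ≠ k := by omega
        simp only [e0, e1, e2, e3, ht, if_true, if_false]
        have e4 : m + k + 2 - (t + 1) = m + k + 1 - t := by omega
        have e5 : m + k + 2 - t = (m + k + 1 - t) + 1 := by omega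
        rw [e4, e5]
        exact (hxadj _).symm
    · have e0 : ¬ m < k := by omega
      have e1 : ¬ m ≤ k := by omega
      have e3 : m ≠ k := by omega
      have e5 : m + k + 2 - m = k + 2 := by omega
      simp only [e0, e1, e3, e5, lt_irrefl, if_false, Nat.zero_le, if_true, hm1]
      exact h2.symm
    · rw [← hk1x]
      by_cases h : k1 ≤ k + 1
      · refine ⟨k1 - 1, by omega, ?_⟩
        congr 1
        split_ifs <;> omega
      · refine ⟨m + k + 2 - k1, by omega, ?_⟩
        congr 1
        split_ifs <;> omega
  have hdeg : ∀ (p : ZMod (m + 2)) (v : V), (G p).degree v =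
      ∑ k ∈ Finset.range (m + 2), if (G p).Adj v (x k) then 1 else 0 := by
    intro p v
    rw [← Finset.card_filter, ← SimpleGraph.card_neighborFinset_eq_degree]
    symm
    apply Finset.card_bij (fun k _ => x k)
    · intro k hk
      simpa using (Finset.mem_filter.1 hk).2
    · intro s hs t ht h
      exact hxinj s t (by simpa using (Finset.mem_filter.1 hs).1)
        (by simpa using (Finset.mem_filter.1 ht).1) h
    · intro w hw
      obtain ⟨z, rfl⟩ := hc.2 w
      obtain ⟨t, ht, rfl⟩ := hval z
      refine ⟨t, ?_, hx t⟩
      simp only [Finset.mem_filter, Finset.mem_range]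
      refine ⟨ht, ?_⟩
      rw [hx]
      simpa using hw
  have hne : x (m + 1) ≠ x 1 := fun h => by
    have := hxinj _ _ (by omega) (by omega) h
    omega
  have hsum := hσ _ _ hne ⟨i, hchord⟩ i (i - 1)
  rw [hdeg, hdeg, Finset.sum_range_succ, Finset.sum_range_succ', Finset.sum_range_succ',
    Finset.sum_range_succ'] at hsum
  simp only [SimpleGraph.irrefl, if_false, zero_add] at hsum
  have hle : ∑ k ∈ Finset.range m, (if (G i).Adj (x (m + 1)) (x (k + 1)) then 1 else 0) +
      ∑ k ∈ Finset.range m, (if (G (i - 1)).Adj (x 1) (x (k + 1 + 1)) then 1 else 0) ≤ m := by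
    rw [← Finset.sum_add_distrib]
    calc _ ≤ ∑ k ∈ Finset.range m, 1 := by
          apply Finset.sum_le_sum
          intro k hk
          have := hcross k (Finset.mem_range.1 hk)
          split_ifs with h1 h2
          · exact absurd ⟨h1, h2⟩ this
          all_goals omega
      _ = m := by simp
  have e0 : x 0 = c i := by rw [hx]; simp
  have e1 : x 1 = c (i + 1) := by rw [hx]; simp
  have em : x (m + 1) = c (i - 1) := by rw [hx, hm1]
  rw [← e0, ← e1, ← em]
  have hA : (G i).Adj (x (m + 1)) (x 0) := by
    by_contra h
    simp only [h, if_false] at hsum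
    split_ifs at hsum <;> omega
  have hB : (G (i - 1)).Adj (x 1) (x 0) := by
    by_contra h
    simp only [h, if_false] at hsum
    split_ifs at hsum <;> omega
  exact ⟨hA, hB.symm⟩

theorem hasRainbow_comp {V ι : Type*} (G : ι → SimpleGraph V) (π : Equiv.Perm ι) (l : ℕ) (v : V)
    (h : HasRainbowCycleThrough (fun i => G (π i)) l v) : HasRainbowCycleThrough G l v := by
  obtain ⟨c, f, ⟨h1, h2, h3⟩, h4⟩ := h
  exact ⟨c, fun t => π (f t), ⟨h1, π.injective.comp h2, h3⟩, h4⟩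

theorem stmt5 {V : Type*} [Fintype V] {n : ℕ} (hn : 3 ≤ n)
    (hV : Fintype.card V = n)
    (G : ZMod n → SimpleGraph V) [∀ i, DecidableRel (G i).Adj]
    (hσ : ∀ u v : V, u ≠ v → (∃ i, ¬ (G i).Adj u v) →
      ∀ p q, n ≤ (G p).degree u + (G q).degree v)
    (c : ZMod n → V) (hc : Function.Bijective c)
    (hCn : ∀ i : ZMod n, (G i).Adj (c i) (c (i + 1)))
    (hno : ¬ HasRainbowCycleThrough G (n - 1) (c 1)) :
    ∀ i j : ZMod n, (G j).Adj (c i) (c (i + 1)) := by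
  obtain ⟨m, rfl⟩ : ∃ m, n = m + 2 := ⟨n - 2, by omega⟩
  -- swapping two consecutive colours
  have step : ∀ π : Equiv.Perm (ZMod (m + 2)),
      (∀ i, (G (π i)).Adj (c i) (c (i + 1))) → ∀ i : ZMod (m + 2), i ≠ 1 →
      ∀ k, (G ((π * Equiv.swap (i - 1) i) k)).Adj (c k) (c (k + 1)) := by
    intro π hπ i hi k
    obtain ⟨h1, h2⟩ := key_lemma (fun i => G (π i))
      (fun u v huv ⟨i, h⟩ p q => hσ u v huv ⟨π i, h⟩ (π p) (π q)) (by omega) c hc hπ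
      (fun h => hno (hasRainbow_comp G π _ _ h)) i hi
    rw [Equiv.Perm.mul_apply, Equiv.swap_apply_def]
    split_ifs with e1 e2
    · subst e1
      simpa using h1
    · subst e2
      exact h2
    · exact hπ k
  -- all permutations
  obtain ⟨e, he1, he2⟩ : ∃ e : Fin (m + 2) ≃ ZMod (m + 2),
      (∀ i : Fin (m + 1), e i.castSucc = e i.succ - 1) ∧ ∀ i : Fin (m + 1), e i.succ ≠ 1 := by
    refine ⟨(ZMod.finEquiv (m + 2)).toEquiv.trans (Equiv.addRight 1), ?_, ?_⟩
    · intro i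
      have h := congrArg (ZMod.finEquiv (m + 2)) (Fin.coeSucc_eq_succ (a := i))
      rw [map_add, map_one] at h
      simpa using h
    · intro i h
      simp [Fin.succ_ne_zero] at h
  have all : ∀ σ : Equiv.Perm (Fin (m + 2)), ∀ k : Fin (m + 2),
      (G (e (σ k))).Adj (c (e k)) (c (e k + 1)) := by
    intro σ
    have hmem : σ ∈ Submonoid.closure (Set.range fun i : Fin (m + 1) =>
        Equiv.swap i.castSucc i.succ) := by
      rw [Equiv.Perm.mclosure_swap_castSucc_succ]
      trivial
    induction hmem using Submonoid.closure_induction_right with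
    | one => intro k; exact hCn _
    | mul_right σ hσ' τ hτ ih =>
      obtain ⟨i, rfl⟩ := hτ
      intro k
      have := step ((e.symm.trans σ).trans e) (by
        intro j
        obtain ⟨k, rfl⟩ := e.surjective j
        simpa using ih k) (e i.succ) (he2 i) (e k)
      rw [← he1] at this
      have hs : Equiv.swap (e i.castSucc) (e i.succ) (e k) =
          e (Equiv.swap i.castSucc i.succ k) := by
        rw [Equiv.swap_apply_def, Equiv.swap_apply_def]
        simp only [e.injective.eq_iff]
        split_ifs <;> rfl
      rw [Equiv.Perm.mul_apply, hs] at this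
      simpa using this
  intro i j
  have := all (Equiv.swap (e.symm i) (e.symm j)) (e.symm i)
  rw [Equiv.swap_apply_left] at this
  simpa using this
end

section
/- Let n ≥ 3 and let 𝒢 = {G_1, …, G_n} be a family of n graphs (not necessarily distinct) on a common vertex set V with |V| = n, with σ(𝒢) ≥ n. Let C_n = x_1 x_2 ⋯ x_n x_1 be a rainbow Hamiltonian cycle with x_i x_{i+1} ∈ E(G_i) for each i ∈ [n] (indices modulo n), and suppose there is no rainbow cycle of length n − 1 in 𝒢 containing x_1. Then for any three indices i, s, t ∈ [n], there exists a rainbow cycle of length n − 2 whose vertex set is V ∖ {x_{i+1}, x_{i+2}} (indices modulo n) and whose rainbow injection φ : E(C) → [n] uses no value in {s, t}. -/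
theorem rc_val_succ {m : ℕ} (hm : 1 ≤ m) (a : ZMod m) :
    (a + 1).val = if a.val + 1 = m then 0 else a.val + 1 := by
  have : NeZero m := ⟨by omega⟩
  have h1 := ZMod.val_lt a
  rw [ZMod.val_add, ZMod.val_one_eq_one_mod, Nat.add_mod_mod]
  split_ifs with h
  · rw [h, Nat.mod_self]
  · exact Nat.mod_eq_of_lt (by omega)

/-- build a rainbow cycle from sequences indexed by naturals -/
theorem rc_mk {V ι : Type*} {m : ℕ} (hm : 1 ≤ m) (G : ι → SimpleGraph V)
    (f : ℕ → V) (g : ℕ → ι)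
    (hf : ∀ a < m, ∀ b < m, f a = f b → a = b)
    (hg : ∀ a < m, ∀ b < m, g a = g b → a = b)
    (h : ∀ a, a + 1 < m → (G (g a)).Adj (f a) (f (a + 1)))
    (h0 : (G (g (m - 1))).Adj (f (m - 1)) (f 0)) :
    IsRainbowCycle G (fun a : ZMod m => f a.val) (fun a : ZMod m => g a.val) := by
  have : NeZero m := ⟨by omega⟩
  refine ⟨?_, ?_, ?_⟩
  · intro a b hab
    exact ZMod.val_injective m (hf _ (ZMod.val_lt a) _ (ZMod.val_lt b) hab)
  · intro a b hab
    exact ZMod.val_injective m (hg _ (ZMod.val_lt a) _ (ZMod.val_lt b) hab)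
  · intro a
    have h1 := ZMod.val_lt a
    show (G (g a.val)).Adj (f a.val) (f (a + 1).val)
    rw [rc_val_succ hm]
    split_ifs with h2
    · have : a.val = m - 1 := by omega
      rw [this]; exact h0
    · exact h _ (by omega)

/-- closing up a path directly -/
theorem rc_close {V ι : Type*} {m : ℕ} (hm : 2 ≤ m) (G : ι → SimpleGraph V) (x : V)
    (y : ℕ → V) (k : ℕ → ι) (p : ι)
    (hy : ∀ a < m, ∀ b < m, y a = y b → a = b)
    (hk : ∀ a < m - 1, ∀ b < m - 1, k a = k b → a = b)
    (hp : ∀ a < m - 1, k a ≠ p)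
    (hpath : ∀ a < m - 1, (G (k a)).Adj (y a) (y (a + 1)))
    (hx : ∃ a < m, y a = x)
    (hno : ¬ HasRainbowCycleThrough G m x) :
    ¬ (G p).Adj (y 0) (y (m - 1)) := by
  intro h
  apply hno
  refine ⟨_, _, rc_mk (by omega) G y (fun a => if a < m - 1 then k a else p) hy ?_ ?_ ?_, ?_⟩
  · intro a ha b hb hab
    try dsimp only at hab
    split_ifs at hab with h1 h2 h2
    · exact hk _ h1 _ h2 hab
    · exact absurd hab (hp _ h1)
    · exact absurd hab.symm (hp _ h2)
    · omega
  · intro a ha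
    rw [if_pos (by omega)]
    exact hpath a (by omega)
  · rw [if_neg (by omega)]
    exact h.symm
  · obtain ⟨a, ha, hax⟩ := hx
    exact ⟨(a : ZMod m), by simp only [ZMod.val_natCast, Nat.mod_eq_of_lt ha, hax]⟩

/-- crossing argument -/
theorem rc_cross {V ι : Type*} {m : ℕ} (hm : 2 ≤ m) (G : ι → SimpleGraph V) (x : V)
    (y : ℕ → V) (k : ℕ → ι) (p q : ι) (hpq : p ≠ q)
    (hy : ∀ a < m, ∀ b < m, y a = y b → a = b)
    (hk : ∀ a < m - 1, ∀ b < m - 1, k a = k b → a = b)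
    (hp : ∀ a < m - 1, k a ≠ p) (hq : ∀ a < m - 1, k a ≠ q)
    (hpath : ∀ a < m - 1, (G (k a)).Adj (y a) (y (a + 1)))
    (hx : ∃ a < m, y a = x)
    (hno : ¬ HasRainbowCycleThrough G m x) (a : ℕ) (ha : a < m - 1)
    (h1 : (G p).Adj (y 0) (y (a + 1))) (h2 : (G q).Adj (y (m - 1)) (y a)) : False := by
  apply hno
  refine ⟨_, _, rc_mk (by omega) G (fun t => if t ≤ a then y t else y (m + a - t))
    (fun t => if t < a then k t else if t = a then q else if t < m - 1 then k (m + a - t - 1)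
      else p) ?_ ?_ ?_ ?_, ?_⟩
  · intro s hs t ht hst
    try dsimp only at hst
    split_ifs at hst
    all_goals
      have := hy _ (by omega) _ (by omega) hst
      omega
  · intro s hs t ht hst
    try dsimp only at hst
    split_ifs at hst
    all_goals first
      | omega
      | exact absurd hst (hp _ (by omega))
      | exact absurd hst (hq _ (by omega))
      | exact absurd hst.symm (hp _ (by omega))
      | exact absurd hst.symm (hq _ (by omega))
      | exact absurd hst hpq
      | exact absurd hst.symm hpq
      | (have := hk _ (by omega) _ (by omega) hst
         omega)
  · intro t ht
    try dsimp only
    rcases lt_trichotomy t a with h | h | h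
    · rw [if_pos h, if_pos (by omega), if_pos (by omega)]
      exact hpath t (by omega)
    · subst h
      rw [if_neg (by omega), if_pos rfl, if_pos le_rfl, if_neg (by omega)]
      rw [show m + t - (t + 1) = m - 1 by omega]
      exact h2.symm
    · rw [if_neg (by omega), if_neg (by omega), if_pos (by omega), if_neg (by omega),
        if_neg (by omega)]
      have := hpath (m + a - t - 1) (by omega)
      rw [show m + a - t - 1 + 1 = m + a - t by omega] at this
      rw [show m + a - (t + 1) = m + a - t - 1 by omega]
      exact this.symm
  · try dsimp only
    rw [if_pos (Nat.zero_le a)]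
    by_cases h : m - 1 ≤ a
    · omega
    · rw [if_neg (by omega), if_neg (by omega), if_neg (by omega), if_neg (by omega),
        show m + a - (m - 1) = a + 1 by omega]
      exact h1.symm
  · obtain ⟨b, hb, hbx⟩ := hx
    by_cases hba : b ≤ a
    · exact ⟨(b : ZMod m), by
        simp only [ZMod.val_natCast, Nat.mod_eq_of_lt hb, hbx, if_pos hba]⟩
    · refine ⟨((m + a - b : ℕ) : ZMod m), ?_⟩
      have : m + a - b < m := by omega
      simp only [ZMod.val_natCast, Nat.mod_eq_of_lt this]
      rw [if_neg (by omega), show m + a - (m + a - b) = b by omega, hbx]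

theorem rc_key {V ι : Type*} [Fintype V] {m : ℕ} (hm : 2 ≤ m) (G : ι → SimpleGraph V)
    [∀ i, DecidableRel (G i).Adj] (x : V)
    (y : ℕ → V) (z : V) (k : ℕ → ι) (p q : ι) (hpq : p ≠ q)
    (hσ : ∀ u v : V, u ≠ v → (∃ i, ¬ (G i).Adj u v) →
      ∀ p q, m + 1 ≤ (G p).degree u + (G q).degree v)
    (hy : ∀ a < m, ∀ b < m, y a = y b → a = b)
    (hk : ∀ a < m - 1, ∀ b < m - 1, k a = k b → a = b)
    (hp : ∀ a < m - 1, k a ≠ p) (hq : ∀ a < m - 1, k a ≠ q)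
    (hpath : ∀ a < m - 1, (G (k a)).Adj (y a) (y (a + 1)))
    (hall : ∀ v, v = z ∨ ∃ a < m, y a = v)
    (hx : ∃ a < m, y a = x)
    (hno : ¬ HasRainbowCycleThrough G m x) :
    (G p).Adj (y 0) z ∧ (G q).Adj (y (m - 1)) z ∧
      ∀ a < m - 1, (G p).Adj (y 0) (y (a + 1)) ∨ (G q).Adj (y (m - 1)) (y a) := by
  classical
  have hnp := rc_close hm G x y k p hy hk hp hpath hx hno
  have hnq := rc_close hm G x y k q hy hk hq hpath hx hno
  have hcr := rc_cross hm G x y k p q hpq hy hk hp hq hpath hx hno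
  have hne : y 0 ≠ y (m - 1) := fun h => by
    have := hy _ (by omega) _ (by omega) h
    omega
  have hdeg := hσ _ _ hne ⟨p, hnp⟩ p q
  set A := (Finset.range (m - 1)).filter (fun a => (G p).Adj (y 0) (y (a + 1))) with hA
  set B := (Finset.range (m - 1)).filter (fun a => (G q).Adj (y (m - 1)) (y a)) with hB
  have hAB : Disjoint A B := by
    rw [Finset.disjoint_left]
    intro a ha hb
    rw [hA, Finset.mem_filter, Finset.mem_range] at ha
    rw [hB, Finset.mem_filter] at hb
    exact hcr a ha.1 ha.2 hb.2
  have hU : A ∪ B ⊆ Finset.range (m - 1) :=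
    Finset.union_subset (Finset.filter_subset _ _) (Finset.filter_subset _ _)
  have hcard : A.card + B.card = (A ∪ B).card := (Finset.card_union_of_disjoint hAB).symm
  have hle : (A ∪ B).card ≤ m - 1 := by simpa using Finset.card_le_card hU
  have dp : (G p).degree (y 0) ≤ A.card + if (G p).Adj (y 0) z then 1 else 0 := by
    have hs : (G p).neighborFinset (y 0) ⊆
        A.image (fun a => y (a + 1)) ∪ if (G p).Adj (y 0) z then {z} else ∅ := by
      intro v hv
      rw [SimpleGraph.mem_neighborFinset] at hv
      rw [Finset.mem_union]
      rcases hall v with rfl | ⟨a, ha, rfl⟩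
      · right; rw [if_pos hv]; simp
      · left
        have ha0 : a ≠ 0 := by
          rintro rfl
          exact (G p).loopless.irrefl _ hv
        rw [Finset.mem_image]
        refine ⟨a - 1, ?_, by rw [show a - 1 + 1 = a by omega]⟩
        rw [hA, Finset.mem_filter, Finset.mem_range, show a - 1 + 1 = a by omega]
        exact ⟨by omega, hv⟩
    have h := (Finset.card_le_card hs).trans (Finset.card_union_le _ _)
    rw [SimpleGraph.card_neighborFinset_eq_degree] at h
    have h' : (A.image (fun a => y (a + 1))).card ≤ A.card := Finset.card_image_le
    split_ifs at h ⊢ <;> simp at h <;> omega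
  have dq : (G q).degree (y (m - 1)) ≤ B.card + if (G q).Adj (y (m - 1)) z then 1 else 0 := by
    have hs : (G q).neighborFinset (y (m - 1)) ⊆
        B.image y ∪ if (G q).Adj (y (m - 1)) z then {z} else ∅ := by
      intro v hv
      rw [SimpleGraph.mem_neighborFinset] at hv
      rw [Finset.mem_union]
      rcases hall v with rfl | ⟨a, ha, rfl⟩
      · right; rw [if_pos hv]; simp
      · left
        have ha0 : a ≠ m - 1 := by
          rintro rfl
          exact (G q).loopless.irrefl _ hv
        rw [Finset.mem_image]
        refine ⟨a, ?_, rfl⟩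
        rw [hB, Finset.mem_filter, Finset.mem_range]
        exact ⟨by omega, hv⟩
    have h := (Finset.card_le_card hs).trans (Finset.card_union_le _ _)
    rw [SimpleGraph.card_neighborFinset_eq_degree] at h
    have h' : (B.image y).card ≤ B.card := Finset.card_image_le
    split_ifs at h ⊢ <;> simp at h <;> omega
  refine ⟨?_, ?_, ?_⟩
  · by_contra h
    rw [if_neg h] at dp
    split_ifs at dq <;> omega
  · by_contra h
    rw [if_neg h] at dq
    split_ifs at dp <;> omega
  · have hfull : A ∪ B = Finset.range (m - 1) := by
      apply Finset.eq_of_subset_of_card_le hU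
      rw [Finset.card_range]
      split_ifs at dp dq <;> omega
    intro a ha
    have : a ∈ A ∪ B := by rw [hfull]; exact Finset.mem_range.2 ha
    rw [Finset.mem_union, hA, hB, Finset.mem_filter, Finset.mem_filter] at this
    rcases this with h | h
    · exact Or.inl h.2
    · exact Or.inr h.2

theorem rc_cast_inj {n : ℕ} {a b : ℕ} (ha : a < n) (hb : b < n)
    (h : (a : ZMod n) = b) : a = b := by
  rw [ZMod.natCast_eq_natCast_iff'] at h
  rwa [Nat.mod_eq_of_lt ha, Nat.mod_eq_of_lt hb] at h

/-- the key lemma specialised to a recoloured Hamiltonian cycle -/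
theorem rc_ham {V : Type*} [Fintype V] {n : ℕ} (hn : 3 ≤ n)
    (G : ZMod n → SimpleGraph V) [∀ i, DecidableRel (G i).Adj]
    (hσ : ∀ u v : V, u ≠ v → (∃ i, ¬ (G i).Adj u v) →
      ∀ p q, n ≤ (G p).degree u + (G q).degree v)
    (c : ZMod n → V) (hc : Function.Bijective c) (π : Equiv.Perm (ZMod n))
    (hCn : ∀ i : ZMod n, (G (π i)).Adj (c i) (c (i + 1)))
    (hno : ¬ HasRainbowCycleThrough G (n - 1) (c 1)) (j : ZMod n) (hj : j ≠ 0) (p q : ZMod n)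
    (hpq : p ≠ q) (hP : p = π j ∨ p = π (j + 1)) (hQ : q = π j ∨ q = π (j + 1)) :
    (G p).Adj (c (j + 2)) (c (j + 1)) ∧ (G q).Adj (c j) (c (j + 1)) ∧
      ¬ (G p).Adj (c j) (c (j + 2)) ∧
      ∀ a : ℕ, a < n - 2 → (G p).Adj (c (j + 2)) (c (j + 2 + a + 1)) ∨
        (G q).Adj (c j) (c (j + 2 + a)) := by
  have : NeZero n := ⟨by omega⟩
  have hlast : j + 2 + ((n - 1 - 1 : ℕ) : ZMod n) = j := by
    have : ((n - 1 - 1 + 2 : ℕ) : ZMod n) = 0 := by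
      rw [show n - 1 - 1 + 2 = n by omega, ZMod.natCast_self]
    push_cast at this
    linear_combination this
  have hsurj : ∀ w : ZMod n, w = j + 1 ∨ ∃ a < n - 1, j + 2 + ((a : ℕ) : ZMod n) = w := by
    intro w
    by_cases h : (w - j - 2).val < n - 1
    · right
      exact ⟨_, h, by rw [ZMod.natCast_zmod_val]; ring⟩
    · left
      have h1 := ZMod.val_lt (w - j - 2)
      have h2 : ((w - j - 2).val + 1 : ℕ) = n := by omega
      have h3 : (((w - j - 2).val + 1 : ℕ) : ZMod n) = 0 := by rw [h2, ZMod.natCast_self]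
      push_cast at h3
      rw [ZMod.natCast_zmod_val] at h3
      linear_combination h3
  have hy : ∀ a < n - 1, ∀ b < n - 1, c (j + 2 + ((a : ℕ) : ZMod n)) = c (j + 2 + ((b : ℕ) : ZMod n)) → a = b := by
    intro a ha b hb h
    exact rc_cast_inj (by omega) (by omega) (add_left_cancel (hc.1 h))
  have hk : ∀ a < n - 1 - 1, ∀ b < n - 1 - 1, π (j + 2 + ((a : ℕ) : ZMod n)) = π (j + 2 + ((b : ℕ) : ZMod n)) → a = b := by
    intro a ha b hb h
    exact rc_cast_inj (by omega) (by omega) (add_left_cancel (π.injective h))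
  have hav : ∀ p, (p = π j ∨ p = π (j + 1)) →
      ∀ a < n - 1 - 1, π (j + 2 + ((a : ℕ) : ZMod n)) ≠ p := by
    rintro p (rfl | rfl) a ha h
    · have h1 := π.injective h
      have h2 : ((a + 2 : ℕ) : ZMod n) = ((0 : ℕ) : ZMod n) := by
        push_cast
        linear_combination h1
      have := rc_cast_inj (by omega) (by omega) h2
      omega
    · have h1 := π.injective h
      have h2 : ((a + 1 : ℕ) : ZMod n) = ((0 : ℕ) : ZMod n) := by
        push_cast
        linear_combination h1
      have := rc_cast_inj (by omega) (by omega) h2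
      omega
  have hpath : ∀ a < n - 1 - 1, (G (π (j + 2 + ((a : ℕ) : ZMod n)))).Adj
      (c (j + 2 + ((a : ℕ) : ZMod n))) (c (j + 2 + ((a + 1 : ℕ) : ZMod n))) := by
    intro a _
    have := hCn (j + 2 + a)
    rw [Nat.cast_add, Nat.cast_one, ← add_assoc]
    exact this
  have hx : ∃ a < n - 1, c (j + 2 + ((a : ℕ) : ZMod n)) = c 1 := by
    rcases hsurj 1 with h | ⟨a, ha, h⟩
    · exact absurd (by linear_combination -h) hj
    · exact ⟨a, ha, by rw [h]⟩
  have hall : ∀ v, v = c (j + 1) ∨ ∃ a < n - 1, c (j + 2 + ((a : ℕ) : ZMod n)) = v := by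
    intro v
    obtain ⟨w, rfl⟩ := hc.2 v
    rcases hsurj w with h | ⟨a, ha, h⟩
    · left; rw [h]
    · right; exact ⟨a, ha, by rw [h]⟩
  have hσ' : ∀ u v : V, u ≠ v → (∃ i, ¬ (G i).Adj u v) →
      ∀ p q, n - 1 + 1 ≤ (G p).degree u + (G q).degree v := by
    rw [show n - 1 + 1 = n by omega]; exact hσ
  have key := rc_key (m := n - 1) (by omega) G (c 1) (fun a => c (j + 2 + ((a : ℕ) : ZMod n)))
    (c (j + 1)) (fun a => π (j + 2 + ((a : ℕ) : ZMod n))) p q hpq hσ' hy hk (hav p hP) (hav q hQ)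
    hpath hall hx hno
  have key2 := rc_close (m := n - 1) (by omega) G (c 1) (fun a => c (j + 2 + ((a : ℕ) : ZMod n)))
    (fun a => π (j + 2 + ((a : ℕ) : ZMod n))) p hy hk (hav p hP) hpath hx hno
  try dsimp only at key key2
  rw [hlast] at key key2
  rw [Nat.cast_zero, add_zero] at key key2
  refine ⟨key.1, key.2.1, fun h => key2 h.symm, ?_⟩
  intro a ha
  have := key.2.2 a (by omega)
  rwa [Nat.cast_add, Nat.cast_one, ← add_assoc] at this

/-- every edge of the cycle is in every graph: all recolourings are allowed -/
theorem rc_all {V : Type*} [Fintype V] {n : ℕ} (hn : 3 ≤ n)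
    (G : ZMod n → SimpleGraph V) [∀ i, DecidableRel (G i).Adj]
    (hσ : ∀ u v : V, u ≠ v → (∃ i, ¬ (G i).Adj u v) →
      ∀ p q, n ≤ (G p).degree u + (G q).degree v)
    (c : ZMod n → V) (hc : Function.Bijective c)
    (hCn : ∀ i : ZMod n, (G i).Adj (c i) (c (i + 1)))
    (hno : ¬ HasRainbowCycleThrough G (n - 1) (c 1)) (i k : ZMod n) :
    (G k).Adj (c i) (c (i + 1)) := by
  obtain ⟨m, rfl⟩ : ∃ m, n = m + 1 := ⟨n - 1, by omega⟩
  have h10 : (1 : ZMod (m + 1)) ≠ 0 := by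
    intro h
    have := rc_cast_inj (n := m + 1) (a := 1) (b := 0) (by omega) (by omega) (by simpa using h)
    omega
  -- one adjacent swap
  have step : ∀ (π : Equiv.Perm (ZMod (m + 1))) (j : ZMod (m + 1)), j ≠ 0 →
      (∀ i, (G (π i)).Adj (c i) (c (i + 1))) →
      ∀ i, (G ((π * Equiv.swap j (j + 1)) i)).Adj (c i) (c (i + 1)) := by
    intro π j hj hπ i
    have hne : j ≠ j + 1 := fun h => h10 (by linear_combination -h)
    have := rc_ham hn G hσ c hc π hπ hno j hj (π j) (π (j + 1))
      (fun h => hne (π.injective h)) (Or.inl rfl) (Or.inr rfl)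
    rw [Equiv.Perm.mul_apply]
    by_cases h1 : i = j
    · subst h1
      rw [Equiv.swap_apply_left]
      exact this.2.1
    by_cases h2 : i = j + 1
    · subst h2
      rw [Equiv.swap_apply_right, show j + 1 + 1 = j + 2 by ring]
      exact this.1.symm
    · rw [Equiv.swap_apply_of_ne_of_ne h1 h2]
      exact hπ i
  let e : Fin (m + 1) ≃ ZMod (m + 1) := Equiv.addRight (1 : Fin (m + 1))
  have he : ∀ a : Fin m, e a.castSucc = (a.succ : Fin (m + 1)) := fun a =>
    (Fin.coeSucc_eq_succ : a.castSucc + 1 = a.succ)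
  have hs : ∀ a : Fin m, e a.succ = e a.castSucc + 1 := fun a => by
    rw [he]; rfl
  have all : ∀ τ : Equiv.Perm (Fin (m + 1)), ∀ i : ZMod (m + 1),
      (G (e.permCongr τ i)).Adj (c i) (c (i + 1)) := by
    intro τ
    have hτ : τ ∈ Submonoid.closure
        (Set.range fun i : Fin m => Equiv.swap i.castSucc i.succ) := by
      rw [Equiv.Perm.mclosure_swap_castSucc_succ]; trivial
    induction hτ using Submonoid.closure_induction_right with
    | one => intro i; simpa [Equiv.permCongr_apply] using hCn i
    | mul_right τ _ s hs' ih =>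
      obtain ⟨a, rfl⟩ := hs'
      have hconj : e.permCongr (τ * Equiv.swap a.castSucc a.succ) =
          e.permCongr τ * Equiv.swap (e a.castSucc) (e a.castSucc + 1) := by
        rw [← hs, ← Equiv.symm_trans_swap_trans]
        apply Equiv.ext
        intro x
        simp only [Equiv.permCongr_apply, Equiv.Perm.mul_apply, Equiv.trans_apply,
          Equiv.symm_apply_apply]
      try dsimp only
      rw [hconj]
      apply step _ _ _ ih
      rw [he]
      exact Fin.succ_ne_zero a
  have := all (e.symm.permCongr (Equiv.swap i k)) i
  have h3 : e.permCongr (e.symm.permCongr (Equiv.swap i k)) i = k := by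
    simp [Equiv.permCongr_apply]
  rw [h3] at this
  exact this

theorem rc_perm {α : Type*} [DecidableEq α] (j j' p q : α) (hj : j ≠ j') (hpq : p ≠ q) :
    ∃ π : Equiv.Perm α, π j = p ∧ π j' = q := by
  refine ⟨Equiv.swap (Equiv.swap j p j') q * Equiv.swap j p, ?_, ?_⟩
  · rw [Equiv.Perm.mul_apply, Equiv.swap_apply_left]
    apply Equiv.swap_apply_of_ne_of_ne _ hpq
    intro h
    apply hj
    apply (Equiv.swap j p).injective
    rw [Equiv.swap_apply_left]; exact h
  · rw [Equiv.Perm.mul_apply, Equiv.swap_apply_left]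

theorem stmt7 {V : Type*} [Fintype V] {n : ℕ} (hn : 3 ≤ n)
    (hV : Fintype.card V = n)
    (G : ZMod n → SimpleGraph V) [∀ i, DecidableRel (G i).Adj]
    (hσ : ∀ u v : V, u ≠ v → (∃ i, ¬ (G i).Adj u v) →
      ∀ p q, n ≤ (G p).degree u + (G q).degree v)
    (c : ZMod n → V) (hc : Function.Bijective c)
    (hCn : ∀ i : ZMod n, (G i).Adj (c i) (c (i + 1)))
    (hno : ¬ HasRainbowCycleThrough G (n - 1) (c 1)) :
    ∀ i s t : ZMod n, ∃ (y : ZMod (n - 2) → V) (ψ : ZMod (n - 2) → ZMod n),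
      IsRainbowCycle G y ψ ∧
      Set.range y = {v : V | v ≠ c (i + 1) ∧ v ≠ c (i + 2)} ∧
      ∀ j, ψ j ≠ s ∧ ψ j ≠ t := by
  intro i s t
  have : NeZero n := ⟨by omega⟩
  have hC := rc_all hn G hσ c hc hCn hno
  have hsmall : ∀ a : ℕ, 0 < a → a < n → ((a : ℕ) : ZMod n) ≠ 0 := by
    intro a h0 h1 h
    have := rc_cast_inj (n := n) (a := a) (b := 0) h1 (by omega) (by simpa using h)
    omega
  have h1 : (1 : ZMod n) ≠ 0 := by simpa using hsmall 1 (by omega) (by omega)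
  have h2 : (2 : ZMod n) ≠ 0 := by simpa using hsmall 2 (by omega) (by omega)
  have hH : ∀ j p q : ZMod n, j ≠ 0 → p ≠ q → ¬ (G p).Adj (c j) (c (j + 2)) ∧
      ∀ a : ℕ, a < n - 2 → (G p).Adj (c (j + 2)) (c (j + 2 + a + 1)) ∨
        (G q).Adj (c j) (c (j + 2 + a)) := by
    intro j p q hj hpq
    obtain ⟨π, hp, hq⟩ := rc_perm j (j + 1) p q (fun h => h1 (by linear_combination -h)) hpq
    exact (rc_ham hn G hσ c hc π (fun i => hC i _) hno j hj p q hpq (Or.inl hp.symm)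
      (Or.inr hq.symm)).2.2
  have hnon : ∀ j p : ZMod n, j ≠ 0 → ¬ (G p).Adj (c j) (c (j + 2)) := by
    intro j p hj
    exact (hH j p (p + 1) hj (fun h => h1 (by linear_combination -h))).1
  have hn4 : 4 ≤ n := by
    by_contra hlt
    have h3 : (3 : ZMod n) = 0 := by
      have : n = 3 := by omega
      have h := ZMod.natCast_self n
      rw [this] at h ⊢
      exact h
    apply hnon 1 0 h1
    have := hC 0 0
    rw [show (1 : ZMod n) + 2 = 0 by linear_combination h3]
    rw [zero_add] at this
    exact this.symm
  have h3 : (3 : ZMod n) ≠ 0 := by simpa using hsmall 3 (by omega) (by omega)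
  have hchord : ∀ k, (G k).Adj (c i) (c (i + 3)) := by
    intro k
    have hk : k + 1 ≠ k := fun h => h1 (by linear_combination h)
    by_cases hi : i ≠ 0 ∧ i + 2 ≠ 0
    · have := (hH i (k + 1) k hi.1 hk).2 1 (by omega)
      rw [Nat.cast_one] at this
      rcases this with h | h
      · exfalso
        apply hnon (i + 2) (k + 1) hi.2
        rwa [show i + 2 + 2 = i + 2 + 1 + 1 by ring]
      · rwa [show i + 3 = i + 2 + 1 by ring]
    · have hi' : i = 0 ∨ i = -2 := by
        by_cases h0 : i = 0
        · exact Or.inl h0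
        · right
          by_contra h4
          exact hi ⟨h0, fun h => h4 (by linear_combination h)⟩
      have ha : i + 1 ≠ 0 := by
        rcases hi' with rfl | rfl
        · simpa using h1
        · intro h; exact h1 (by linear_combination -h)
      have hb : i - 1 ≠ 0 := by
        rcases hi' with rfl | rfl
        · intro h; exact h1 (by linear_combination -h)
        · intro h; exact h3 (by linear_combination -h)
      have hcast : ((n - 4 : ℕ) : ZMod n) = -4 := by
        have : ((n - 4 + 4 : ℕ) : ZMod n) = 0 := by
          rw [show n - 4 + 4 = n by omega, ZMod.natCast_self]
        push_cast at this
        linear_combination this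
      have := (hH (i + 1) k (k + 1) ha hk.symm).2 (n - 4) (by omega)
      rw [hcast] at this
      rcases this with h | h
      · rw [show i + 1 + 2 = i + 3 by ring, show i + 3 + -4 + 1 = i by ring] at h
        exact h.symm
      · exfalso
        apply hnon (i - 1) (k + 1) hb
        rw [show i - 1 + 2 = i + 1 by ring]
        rw [show i + 1 + 2 + -4 = i - 1 by ring] at h
        exact h.symm
  have : NeZero (n - 2) := ⟨by omega⟩
  classical
  have hcol : ∃ ψ : ZMod (n - 2) → ZMod n, Function.Injective ψ ∧ ∀ j, ψ j ≠ s ∧ ψ j ≠ t := by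
    have hcard : Fintype.card (ZMod (n - 2)) ≤ Fintype.card {x : ZMod n // x ∉ ({s, t} : Finset (ZMod n))} := by
      rw [Fintype.card_subtype_compl, ZMod.card, ZMod.card]
      have : Fintype.card {x : ZMod n // x ∈ ({s, t} : Finset (ZMod n))} ≤ 2 := by
        rw [Fintype.card_coe]; exact Finset.card_le_two
      omega
    obtain ⟨f⟩ := Function.Embedding.nonempty_of_card_le hcard
    refine ⟨fun j => (f j).1, fun a b h => f.injective (Subtype.ext h), fun j => ?_⟩
    have := (f j).2
    simpa [not_or] using this
  obtain ⟨ψ, hψ, hψ'⟩ := hcol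
  refine ⟨fun a => c (i + 3 + (a.val : ZMod n)), ψ, ⟨?_, hψ, ?_⟩, ?_, hψ'⟩
  · intro a b h
    have ha := ZMod.val_lt a
    have hb := ZMod.val_lt b
    exact ZMod.val_injective _ (rc_cast_inj (by omega) (by omega) (add_left_cancel (hc.1 h)))
  · intro a
    have ha := ZMod.val_lt a
    try dsimp only
    rw [rc_val_succ (by omega)]
    split_ifs with h
    · have h5 : ((a.val + 1 + 2 : ℕ) : ZMod n) = 0 := by
        rw [h, show n - 2 + 2 = n by omega, ZMod.natCast_self]
      push_cast at h5
      rw [Nat.cast_zero, add_zero, show i + 3 + (a.val : ZMod n) = i by linear_combination h5]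
      exact hchord _
    · rw [Nat.cast_add, Nat.cast_one, ← add_assoc]
      exact hC _ _
  · ext v
    simp only [Set.mem_range, Set.mem_ofPred_eq]
    constructor
    · rintro ⟨a, rfl⟩
      have ha := ZMod.val_lt a
      constructor
      · intro h
        refine hsmall (a.val + 2) (by omega) (by omega) ?_
        push_cast
        linear_combination hc.1 h
      · intro h
        refine hsmall (a.val + 1) (by omega) (by omega) ?_
        push_cast
        linear_combination hc.1 h
    · rintro ⟨hv1, hv2⟩
      obtain ⟨w, rfl⟩ := hc.2 v
      have hlt := ZMod.val_lt (w - i - 3)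
      have hw : (((w - i - 3).val : ℕ) : ZMod n) = w - i - 3 := ZMod.natCast_zmod_val _
      have hlt2 : (w - i - 3).val < n - 2 := by
        by_contra hge
        rcases (by omega : (w - i - 3).val + 1 = n ∨ (w - i - 3).val + 2 = n) with h | h
        · have h5 : (((w - i - 3).val + 1 : ℕ) : ZMod n) = 0 := by rw [h, ZMod.natCast_self]
          push_cast at h5
          rw [hw] at h5
          exact hv2 (congrArg c (by linear_combination h5))
        · have h5 : (((w - i - 3).val + 2 : ℕ) : ZMod n) = 0 := by rw [h, ZMod.natCast_self]
          push_cast at h5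
          rw [hw] at h5
          exact hv1 (congrArg c (by linear_combination h5))
      refine ⟨(((w - i - 3).val : ℕ) : ZMod (n - 2)), ?_⟩
      rw [ZMod.val_natCast, Nat.mod_eq_of_lt hlt2, hw]
      congr 1
      ring
end

section
/- Let n ≥ 3 and let 𝒢 = {G_1, …, G_n} be a family of n graphs (not necessarily distinct) on a common vertex set V with |V| = n, with σ(𝒢) ≥ n. Let C_n = x_1 x_2 ⋯ x_n x_1 be a rainbow Hamiltonian cycle with x_i x_{i+1} ∈ E(G_i) for each i ∈ [n] (indices modulo n), and suppose there is no rainbow cycle of length n − 1 in 𝒢 containing x_1. Then for all distinct a, b ∈ [n] and every i ∈ [n], d_a(x_i) + d_b(x_i) ≥ n. -/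
lemma natCast_inj_lt {n a b : ℕ} (ha : a < n) (hb : b < n)
    (h : (a : ZMod n) = (b : ZMod n)) : a = b := by
  rw [ZMod.natCast_eq_natCast_iff'] at h
  rwa [Nat.mod_eq_of_lt ha, Nat.mod_eq_of_lt hb] at h

/-- Build a rainbow cycle from a sequence indexed by naturals. -/
lemma rainbow_of_seq {V ι : Type*} (G : ι → SimpleGraph V) (m : ℕ) (hm : 1 ≤ m) (x : V)
    (v : ℕ → V) (f : ℕ → ι)
    (hv : ∀ k l, k < m → l < m → v k = v l → k = l)
    (hf : ∀ k l, k < m → l < m → f k = f l → k = l)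
    (hadj : ∀ k, k + 1 < m → (G (f k)).Adj (v k) (v (k + 1)))
    (hlast : (G (f (m - 1))).Adj (v (m - 1)) (v 0))
    (hx : ∃ k, k < m ∧ v k = x) : HasRainbowCycleThrough G m x := by
  have : NeZero m := ⟨by omega⟩
  refine ⟨fun i => v i.val, fun i => f i.val, ⟨?_, ?_, ?_⟩, ?_⟩
  · intro a b h
    exact ZMod.val_injective m (hv _ _ (ZMod.val_lt a) (ZMod.val_lt b) h)
  · intro a b h
    exact ZMod.val_injective m (hf _ _ (ZMod.val_lt a) (ZMod.val_lt b) h)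
  · intro i
    have hi := ZMod.val_lt i
    have e : i + 1 = ((i.val + 1 : ℕ) : ZMod m) := by
      push_cast
      rw [ZMod.natCast_zmod_val]
    by_cases h : i.val + 1 < m
    · have : (i + 1).val = i.val + 1 := by
        rw [e, ZMod.val_natCast, Nat.mod_eq_of_lt h]
      simp only [this]
      exact hadj _ h
    · have h1 : i.val = m - 1 := by omega
      have : (i + 1).val = 0 := by
        rw [e, ZMod.val_natCast]
        have : i.val + 1 = m := by omega
        rw [this, Nat.mod_self]
      simp only [this, h1]
      exact hlast
  · obtain ⟨k, hk, rfl⟩ := hx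
    exact ⟨(k : ZMod m), by simp only [ZMod.val_natCast, Nat.mod_eq_of_lt hk]⟩

section
variable {V : Type*} [Fintype V] {n : ℕ}

lemma exists_rep (hn : 3 ≤ n) (i t : ZMod n) (h : t ≠ i) :
    ∃ s : ℕ, s < n - 1 ∧ t = i + 1 + s := by
  have : NeZero n := ⟨by omega⟩
  refine ⟨(t - i - 1).val, ?_, ?_⟩
  · have h1 := ZMod.val_lt (t - i - 1)
    by_contra h2
    have h3 : (t - i - 1).val + 1 = n := by omega
    have h4 : (((t - i - 1).val + 1 : ℕ) : ZMod n) = 0 := by rw [h3]; simp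
    push_cast at h4
    rw [ZMod.natCast_zmod_val] at h4
    apply h
    linear_combination h4
  · rw [ZMod.natCast_zmod_val]; ring

lemma plain_cycle (hn : 3 ≤ n) (G : ZMod n → SimpleGraph V)
    (c : ZMod n → V) (hc : Function.Bijective c)
    (hno : ¬ HasRainbowCycleThrough G (n - 1) (c 1))
    (i : ZMod n) (hi : i ≠ 1) (π : Equiv.Perm (ZMod n))
    (hπ : ∀ j, j ≠ i → j ≠ i - 1 → (G (π j)).Adj (c j) (c (j + 1))) :
    ¬ (G (π (i - 1))).Adj (c (i - 1)) (c (i + 1)) := by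
  intro hadj
  have key : ∀ k : ℕ, k < n - 1 → k + 1 < n - 1 → i + 1 + (k : ZMod n) ≠ i ∧
      i + 1 + (k : ZMod n) ≠ i - 1 := by
    intro k _ hk
    constructor
    · intro h
      have : ((k + 1 : ℕ) : ZMod n) = ((0 : ℕ) : ZMod n) := by
        push_cast; linear_combination h
      have := natCast_inj_lt (by omega) (by omega) this
      omega
    · intro h
      have : ((k + 2 : ℕ) : ZMod n) = ((0 : ℕ) : ZMod n) := by
        push_cast; linear_combination h
      have := natCast_inj_lt (by omega) (by omega) this
      omega
  have elast : i + 1 + ((n - 1 - 1 : ℕ) : ZMod n) = i - 1 := by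
    have : ((n - 1 - 1 + 2 : ℕ) : ZMod n) = 0 := by
      rw [show n - 1 - 1 + 2 = n by omega]; simp
    push_cast at this
    linear_combination this
  apply hno
  apply rainbow_of_seq G (n - 1) (by omega) (c 1) (fun k => c (i + 1 + k))
    (fun k => π (i + 1 + k))
  · intro k l hk hl h
    have := hc.1 h
    exact natCast_inj_lt (by omega) (by omega) (add_left_cancel this)
  · intro k l hk hl h
    have := π.injective h
    exact natCast_inj_lt (by omega) (by omega) (add_left_cancel this)
  · intro k hk
    have := hπ (i + 1 + k) (key k (by omega) hk).1 (key k (by omega) hk).2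
    push_cast
    rwa [← add_assoc]
  · simp only [elast]
    simpa using hadj
  · obtain ⟨s, hs, h⟩ := exists_rep hn i 1 hi.symm
    exact ⟨s, hs, by rw [← h]⟩

lemma cross_cycle (hn : 3 ≤ n) (G : ZMod n → SimpleGraph V)
    (c : ZMod n → V) (hc : Function.Bijective c)
    (hno : ¬ HasRainbowCycleThrough G (n - 1) (c 1))
    (i : ZMod n) (hi : i ≠ 1) (π : Equiv.Perm (ZMod n))
    (hπ : ∀ j, j ≠ i → j ≠ i - 1 → (G (π j)).Adj (c j) (c (j + 1)))
    (j : ZMod n)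
    (h1 : (G (π i)).Adj (c (i + 1)) (c (j + 1)))
    (h2 : (G (π (i - 1))).Adj (c (i - 1)) (c j)) : False := by
  have hji : j ≠ i := by rintro rfl; exact h1.ne rfl
  have hji1 : j ≠ i - 1 := by rintro rfl; exact h2.ne rfl
  have elast : i + 1 + ((n - 1 - 1 : ℕ) : ZMod n) = i - 1 := by
    have : ((n - 1 - 1 + 2 : ℕ) : ZMod n) = 0 := by
      rw [show n - 1 - 1 + 2 = n by omega]; simp
    push_cast at this
    linear_combination this
  obtain ⟨t, ht, rfl⟩ := exists_rep hn i j hji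
  have ht2 : t ≠ n - 1 - 1 := by
    rintro rfl
    exact hji1 elast
  have key : ∀ k : ℕ, k + 1 < n - 1 → 
      (G (π (i + 1 + k))).Adj (c (i + 1 + k)) (c (i + 1 + k + 1)) := by
    intro k hk
    apply hπ
    · intro h
      have : ((k + 1 : ℕ) : ZMod n) = ((0 : ℕ) : ZMod n) := by
        push_cast; linear_combination h
      have := natCast_inj_lt (by omega) (by omega) this
      omega
    · intro h
      have : ((k + 2 : ℕ) : ZMod n) = ((0 : ℕ) : ZMod n) := by
        push_cast; linear_combination h
      have := natCast_inj_lt (by omega) (by omega) this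
      omega
  apply hno
  apply rainbow_of_seq G (n - 1) (by omega) (c 1)
    (fun k => c (i + 1 + ((if k ≤ t then t - k else k : ℕ) : ZMod n)))
    (fun k => π (i + ((if k ≤ t then t - k else k + 1 : ℕ) : ZMod n)))
  · intro k l hk hl h
    have := natCast_inj_lt (by split_ifs <;> omega) (by split_ifs <;> omega)
      (add_left_cancel (hc.1 h))
    split_ifs at this <;> omega
  · intro k l hk hl h
    have := natCast_inj_lt (by split_ifs <;> omega) (by split_ifs <;> omega)
      (add_left_cancel (π.injective h))
    split_ifs at this <;> omega
  · intro k hk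
    rcases lt_trichotomy k t with hkt | hkt | hkt
    · have := key (t - (k + 1)) (by omega)
      simp only [if_pos hkt.le, if_pos (show k + 1 ≤ t by omega)]
      have e : t - k = t - (k + 1) + 1 := by omega
      rw [e]
      push_cast
      have e1 : i + ((t - (k + 1) : ℕ) + 1 : ZMod n) = i + 1 + (t - (k + 1) : ℕ) := by ring
      have e2 : i + 1 + ((t - (k + 1) : ℕ) + 1 : ZMod n) = i + 1 + (t - (k + 1) : ℕ) + 1 := by
        ring
      rw [e1, e2]
      exact this.symm
    · subst hkt
      simp only [le_refl, if_true, if_neg (show ¬ k + 1 ≤ k by omega)]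
      push_cast
      simp only [Nat.sub_self, Nat.cast_zero, add_zero]
      rwa [← add_assoc]
    · have := key k hk
      simp only [if_neg (show ¬ k ≤ t by omega), if_neg (show ¬ k + 1 ≤ t by omega)]
      push_cast
      have e1 : i + ((k : ZMod n) + 1) = i + 1 + k := by ring
      have e2 : i + 1 + ((k : ZMod n) + 1) = i + 1 + k + 1 := by ring
      rwa [e1, e2]
  · simp only [if_neg (show ¬ n - 1 - 1 ≤ t by omega), if_pos (Nat.zero_le t)]
    have e1 : i + ((n - 1 - 1 + 1 : ℕ) : ZMod n) = i + 1 + ((n - 1 - 1 : ℕ) : ZMod n) := by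
      push_cast; ring
    rw [e1, elast]
    simpa using h2
  · obtain ⟨s, hs, h⟩ := exists_rep hn i 1 hi.symm
    refine ⟨if s ≤ t then t - s else s, by split_ifs <;> omega, ?_⟩
    have : (if (if s ≤ t then t - s else s) ≤ t then t - (if s ≤ t then t - s else s)
      else (if s ≤ t then t - s else s)) = s := by
      split_ifs <;> omega
    simp only [this]
    rw [← h]

lemma degree_eq_card (H : SimpleGraph V) [DecidableRel H.Adj] [NeZero n]
    (c : ZMod n → V) (hc : Function.Bijective c) (u : V) (r : ZMod n) :
    H.degree u = (Finset.univ.filter (fun j : ZMod n => H.Adj u (c (j + r)))).card := by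
  rw [← SimpleGraph.card_neighborFinset_eq_degree]
  symm
  apply Finset.card_bij (fun j _ => c (j + r))
  · intro j hj
    simpa using hj
  · intro a _ b _ h
    exact add_right_cancel (hc.1 h)
  · intro v hv
    obtain ⟨j, rfl⟩ := hc.2 v
    refine ⟨j - r, ?_, by simp⟩
    simpa using hv

lemma exact_cross (hn : 3 ≤ n)
    (G : ZMod n → SimpleGraph V) [∀ i, DecidableRel (G i).Adj]
    (hσ : ∀ u v : V, u ≠ v → (∃ i, ¬ (G i).Adj u v) →
      ∀ p q, n ≤ (G p).degree u + (G q).degree v)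
    (c : ZMod n → V) (hc : Function.Bijective c)
    (hno : ¬ HasRainbowCycleThrough G (n - 1) (c 1))
    (i : ZMod n) (hi : i ≠ 1) (π : Equiv.Perm (ZMod n))
    (hπ : ∀ j, j ≠ i → j ≠ i - 1 → (G (π j)).Adj (c j) (c (j + 1)))
    (j : ZMod n) :
    (G (π i)).Adj (c (i + 1)) (c (j + 1)) ↔ ¬ (G (π (i - 1))).Adj (c (i - 1)) (c j) := by
  have : NeZero n := ⟨by omega⟩
  have hne : c (i + 1) ≠ c (i - 1) := by
    intro h
    have h := hc.1 h
    have : ((2 : ℕ) : ZMod n) = ((0 : ℕ) : ZMod n) := by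
      push_cast; linear_combination h
    have := natCast_inj_lt (by omega) (by omega) this
    omega
  have hd := hσ _ _ hne ⟨π (i - 1), fun h => plain_cycle hn G c hc hno i hi π hπ h.symm⟩
    (π i) (π (i - 1))
  rw [degree_eq_card _ c hc _ 1, degree_eq_card _ c hc _ 0] at hd
  simp only [add_zero] at hd
  have hx := cross_cycle hn G c hc hno i hi π hπ
  constructor
  · exact fun h1 h2 => hx j h1 h2
  · intro h2
    by_contra h1
    rw [← Finset.card_union_of_disjoint] at hd
    · have : (Finset.univ.filter (fun j : ZMod n => (G (π i)).Adj (c (i + 1)) (c (j + 1))) ∪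
        Finset.univ.filter (fun j : ZMod n => (G (π (i-1))).Adj (c (i - 1)) (c j))) ⊂
          Finset.univ := by
        rw [Finset.ssubset_univ_iff]
        intro h
        have := Finset.mem_univ j
        rw [← h] at this
        simp [h1, h2] at this
      have := Finset.card_lt_card this
      rw [Finset.card_univ, ZMod.card] at this
      omega
    · rw [Finset.disjoint_left]
      intro a ha hb
      simp at ha hb
      exact hx a ha hb

end

theorem stmt8 {V : Type*} [Fintype V] {n : ℕ} (hn : 3 ≤ n)
    (hV : Fintype.card V = n)
    (G : ZMod n → SimpleGraph V) [∀ i, DecidableRel (G i).Adj]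
    (hσ : ∀ u v : V, u ≠ v → (∃ i, ¬ (G i).Adj u v) →
      ∀ p q, n ≤ (G p).degree u + (G q).degree v)
    (c : ZMod n → V) (hc : Function.Bijective c)
    (hCn : ∀ i : ZMod n, (G i).Adj (c i) (c (i + 1)))
    (hno : ¬ HasRainbowCycleThrough G (n - 1) (c 1)) :
    ∀ a b : ZMod n, a ≠ b → ∀ i : ZMod n,
      n ≤ (G a).degree (c i) + (G b).degree (c i) := by
  have : NeZero n := ⟨by omega⟩
  have small : ∀ k : ℕ, 0 < k → k < n → (k : ZMod n) ≠ 0 := by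
    intro k h0 hk h
    have := natCast_inj_lt (b := 0) hk (by omega) (by simpa using h)
    omega
  have h10 : (1 : ZMod n) ≠ 0 := by simpa using small 1 (by omega) (by omega)
  have hpred : ∀ i : ZMod n, i ≠ i - 1 := by
    intro i h
    apply h10
    linear_combination h
  have X := exact_cross hn G hσ c hc hno
  let P : Equiv.Perm (ZMod n) → Prop := fun π => ∀ j, (G (π j)).Adj (c j) (c (j + 1))
  have P1 : P 1 := hCn
  have Padj : ∀ i, i ≠ 1 → ∀ π, P π → P (π * Equiv.swap (i - 1) i) := by
    intro i hi π hπ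
    have hw : ∀ j, j ≠ i → j ≠ i - 1 →
        (G ((π * Equiv.swap (i - 1) i) j)).Adj (c j) (c (j + 1)) := by
      intro j h1 h2
      rw [Equiv.Perm.mul_apply, Equiv.swap_apply_of_ne_of_ne h2 h1]
      exact hπ j
    have Y := X i hi _ hw
    intro j
    by_cases h1 : j = i
    · subst h1
      have := (Y (j - 1)).2 (fun h => h.ne rfl)
      rw [sub_add_cancel] at this
      exact this.symm
    by_cases h2 : j = i - 1
    · subst h2
      have := not_not.1 (fun h => ((Y i).2 h).ne rfl)
      rw [sub_add_cancel]
      exact this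
    exact hw j h1 h2
  have Pswap : ∀ k : ℕ, k < n → ∀ π, P π → P (π * Equiv.swap 1 (1 + (k : ZMod n))) := by
    intro k
    induction k with
    | zero => intro _ π h; simpa [← Equiv.Perm.one_def] using h
    | succ k ih =>
      intro hk π h
      rcases Nat.eq_zero_or_pos k with rfl | hk0
      · have := Padj (1 + 1) (by intro h; apply h10; linear_combination h) π h
        simpa using this
      have e : Equiv.swap (1 : ZMod n) (1 + ((k + 1 : ℕ) : ZMod n)) =
          Equiv.swap 1 (1 + (k : ZMod n)) *
            Equiv.swap (1 + (k : ZMod n)) (1 + ((k + 1 : ℕ) : ZMod n)) *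
            Equiv.swap 1 (1 + (k : ZMod n)) := by
        rw [Equiv.swap_comm (1 + (k : ZMod n)) (1 + ((k + 1 : ℕ) : ZMod n)),
          Equiv.swap_comm 1 (1 + (k : ZMod n)), Equiv.swap_mul_swap_mul_swap]
        · intro h
          apply h10
          push_cast at h
          linear_combination h
        · intro h
          exact small (k + 1) (by omega) hk (by linear_combination h)
      rw [e, ← mul_assoc, ← mul_assoc]
      apply ih (by omega)
      have := Padj (1 + ((k + 1 : ℕ) : ZMod n)) (by
        intro h
        exact small (k + 1) (by omega) hk (by linear_combination h)) _ (ih (by omega) π h)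
      have e2 : 1 + ((k + 1 : ℕ) : ZMod n) - 1 = 1 + (k : ZMod n) := by push_cast; ring
      rwa [e2] at this
  have Pswap' : ∀ e : ZMod n, ∀ π, P π → P (π * Equiv.swap 1 e) := by
    intro e π h
    have := Pswap (e - 1).val (ZMod.val_lt _) π h
    rw [ZMod.natCast_zmod_val] at this
    simpa using this
  have hall : ∀ p e : ZMod n, (G p).Adj (c e) (c (e + 1)) := by
    intro p e
    have := Pswap' e _ (Pswap' p 1 P1) e
    simpa using this
  -- all distinct colours
  have K : ∀ p q, p ≠ q → ∀ s, s ≠ 0 → ∀ t,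
      ((G p).Adj (c (s + 2)) (c (t + 1)) ↔ ¬ (G q).Adj (c s) (c t)) := by
    intro p q hpq s hs t
    set i := s + 1 with hi
    have hi1 : i ≠ 1 := by intro h; apply hs; linear_combination h
    let σ : Equiv.Perm (ZMod n) := Equiv.swap i p
    have hσq : i ≠ σ q := by
      intro h
      have h' : σ i = p := Equiv.swap_apply_left _ _
      have h'' : σ (σ q) = q := by simp [σ]
      rw [← h, h'] at h''
      exact hpq h''
    let π := σ * Equiv.swap (i - 1) (σ q)
    have hπ1 : π i = p := by
      change σ (Equiv.swap (i - 1) (σ q) i) = p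
      rw [Equiv.swap_apply_of_ne_of_ne (hpred i) hσq]
      exact Equiv.swap_apply_left _ _
    have hπ2 : π (i - 1) = q := by
      change σ (Equiv.swap (i - 1) (σ q) (i - 1)) = q
      rw [Equiv.swap_apply_left]
      simp [σ]
    have := X i hi1 π (fun j _ _ => hall _ _) t
    rw [hπ1, hπ2] at this
    have e1 : i + 1 = s + 2 := by rw [hi]; ring
    have e2 : i - 1 = s := by rw [hi]; ring
    rwa [e1, e2] at this
  have hthird : ∀ p p' : ZMod n, ∃ q, p ≠ q ∧ p' ≠ q := by
    intro p p'
    have : ∃ q, q ∉ ({p, p'} : Finset (ZMod n)) := by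
      by_contra! h
      have h1 : (Finset.univ : Finset (ZMod n)) ⊆ {p, p'} := fun q _ => h q
      have h2 := Finset.card_le_card h1
      have h3 := Finset.card_le_two (a := p) (b := p')
      rw [Finset.card_univ, ZMod.card] at h2
      omega
    obtain ⟨q, hq⟩ := this
    simp only [Finset.mem_insert, Finset.mem_singleton, not_or] at hq
    exact ⟨q, fun h => hq.1 h.symm, fun h => hq.2 h.symm⟩
  have step : ∀ p s t, s ≠ 0 → t ≠ 0 →
      ((G p).Adj (c (s + 1)) (c (t + 2)) ↔ (G p).Adj (c (s + 2)) (c (t + 1))) := by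
    intro p s t hs ht
    obtain ⟨q, hq, -⟩ := hthird p p
    rw [K p q hq s hs t, SimpleGraph.adj_comm, K p q hq t ht s, SimpleGraph.adj_comm]
  have par : ∀ p, ∀ d a : ℕ, 2 ≤ a → a + d ≤ n + 1 →
      ((G p).Adj (c (a : ZMod n)) (c ((a + d : ℕ) : ZMod n)) ↔ Odd d) := by
    intro p d
    induction d using Nat.twoStepInduction with
    | zero => intro a _ _; simp
    | one => intro a _ _; simpa using hall p a
    | more d ih _ =>
      intro a ha had
      have h1 := ih (a + 1) (by omega) (by omega)
      have h2 := step p ((a - 1 : ℕ) : ZMod n) ((a + d : ℕ) : ZMod n)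
        (small _ (by omega) (by omega)) (small _ (by omega) (by omega))
      have e1 : ((a - 1 : ℕ) : ZMod n) + 1 = (a : ZMod n) := by
        rw [← Nat.cast_add_one]; congr 1; omega
      have e2 : ((a - 1 : ℕ) : ZMod n) + 2 = ((a + 1 : ℕ) : ZMod n) := by
        push_cast; rw [← e1]; ring
      have e3 : ((a + d : ℕ) : ZMod n) + 2 = ((a + (d + 2) : ℕ) : ZMod n) := by
        push_cast; ring
      have e4 : ((a + d : ℕ) : ZMod n) + 1 = ((a + 1 + d : ℕ) : ZMod n) := by
        push_cast; ring
      rw [e1, e2, e3, e4] at h2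
      rw [h2, h1]
      simp only [Nat.odd_iff]
      omega
  have par2 : ∀ p, ∀ a b : ℕ, 2 ≤ a → a ≤ n + 1 → 2 ≤ b → b ≤ n + 1 →
      ((G p).Adj (c (a : ZMod n)) (c (b : ZMod n)) ↔ (a + b) % 2 = 1) := by
    intro p a b ha ha' hb hb'
    rcases le_total a b with h | h
    · obtain ⟨d, rfl⟩ := Nat.exists_eq_add_of_le h
      rw [par p d a ha hb', Nat.odd_iff]; omega
    · obtain ⟨d, rfl⟩ := Nat.exists_eq_add_of_le h
      rw [SimpleGraph.adj_comm, par p d b hb ha', Nat.odd_iff]; omega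
  have hnn : ((n : ℕ) : ZMod n) = 0 := ZMod.natCast_self n
  have heven : n % 2 = 0 := by
    have h := (par2 0 (n + 1) 2 (by omega) (by omega) (by omega) (by omega)).1 (by
      have := hall 0 1
      push_cast
      rw [hnn, zero_add]
      rwa [show (1 : ZMod n) + 1 = 2 by norm_num] at this)
    omega
  have rep : ∀ t : ZMod n, ∃ a : ℕ, 2 ≤ a ∧ a ≤ n + 1 ∧ t = (a : ZMod n) := by
    intro t
    have := ZMod.val_lt (t - 2)
    refine ⟨(t - 2).val + 2, by omega, by omega, ?_⟩
    push_cast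
    rw [ZMod.natCast_zmod_val]; ring
  intro a b _ i
  have hflip : ∀ t, (G a).Adj (c i) (c (t + 1)) ↔ ¬ (G b).Adj (c i) (c (t + 0)) := by
    intro t
    rw [add_zero]
    obtain ⟨s, hs, hs', rfl⟩ := rep i
    obtain ⟨u, hu, hu', rfl⟩ := rep t
    rw [par2 b s u hs hs' hu hu']
    by_cases h : u = n + 1
    · have e : (u : ZMod n) + 1 = ((2 : ℕ) : ZMod n) := by
        rw [h]; push_cast; rw [hnn]; norm_num
      rw [e, par2 a s 2 hs hs' (by omega) (by omega)]
      omega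
    · have e : (u : ZMod n) + 1 = ((u + 1 : ℕ) : ZMod n) := by push_cast; ring
      rw [e, par2 a s (u + 1) hs hs' (by omega) (by omega)]
      omega
  rw [degree_eq_card (G a) c hc _ 1, degree_eq_card (G b) c hc _ 0]
  simp only [hflip]
  have := Finset.card_filter_add_card_filter_not (s := (Finset.univ : Finset (ZMod n)))
    (fun t => (G b).Adj (c i) (c (t + 0)))
  rw [Finset.card_univ, ZMod.card] at this
  omega
end
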